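/- For each integer m ≥ 1, there exists a finite simple graph G such that pcr(G) = 36(1+4m) and rcr(G) ≥ 36(1+4m)+m. In particular, there exist graphs whose rectilinear crossing number strictly exceeds their pseudolinear crossing number. -/

import Mathlib

open Set

noncomputable section

abbrev Plane : Type := ℝ × ℝ

/-- The setoid on nonzero vectors of `ℝ³` identifying nonzero scalar multiples. -/
def projSetoid : Setoid {v : Fin 3 → ℝ // v ≠ 0} where
  r v w := ∃ c : ℝ, c ≠ 0 ∧ c • v.1 = w.1
  iseqv := by
    constructor
    · exact fun v => ⟨1, one_ne_zero, one_smul _ _⟩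
    · rintro v w ⟨c, hc, h⟩
      exact ⟨c⁻¹, inv_ne_zero hc, by rw [← h, smul_smul, inv_mul_cancel₀ hc, one_smul]⟩
    · rintro u v w ⟨c, hc, h⟩ ⟨d, hd, h'⟩
      exact ⟨d * c, mul_ne_zero hd hc, by rw [← h', ← h, smul_smul]⟩

/-- The real projective plane, as the quotient of `ℝ³ \ {0}` by nonzero scaling. -/
def RP2 : Type := Quotient projSetoid

instance : TopologicalSpace RP2 := instTopologicalSpaceQuotient

/-- The standard affine embedding of the plane in the projective plane. -/
def planeToRP2 (p : Plane) : RP2 :=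
  Quotient.mk projSetoid ⟨![p.1, p.2, 1], by
    intro h
    simpa using congrFun h 2⟩

/-- A pseudoline: a simple closed curve in the projective plane that does not
disconnect it. -/
def IsPseudoline (L : Set RP2) : Prop :=
  ∃ f : AddCircle (1 : ℝ) → RP2,
    Continuous f ∧ Function.Injective f ∧ Set.range f = L ∧ IsConnected Lᶜ

/-- A drawing of a graph in the plane: vertices are distinct points, each edge is a
simple arc (parametrized on `[0,1]`) joining its endpoints, and no arc passes
through a vertex other than its endpoints. -/
structure Drawing {V : Type*} (G : SimpleGraph V) where
  vert : V → Plane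
  vert_inj : Function.Injective vert
  arc : G.edgeSet → ℝ → Plane
  arc_cont : ∀ e, ContinuousOn (arc e) (Icc 0 1)
  arc_injOn : ∀ e, InjOn (arc e) (Icc 0 1)
  arc_ends : ∀ e : G.edgeSet, ∃ x y : V,
    (e : Sym2 V) = s(x, y) ∧ arc e 0 = vert x ∧ arc e 1 = vert y
  arc_avoid : ∀ (e : G.edgeSet) (t : ℝ), t ∈ Icc (0:ℝ) 1 →
    (∃ v, arc e t = vert v) → t = 0 ∨ t = 1

namespace Drawing

variable {V : Type*} {G : SimpleGraph V} (D : Drawing G)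

/-- The interior (relative to its endpoints) of the arc of an edge. -/
def interOf (e : G.edgeSet) : Set Plane := D.arc e '' Ioo 0 1

/-- The set of crossings of a drawing: pairs consisting of a point of the plane
together with an (unordered) pair of distinct edges whose interiors both pass
through the point. -/
def CrossSet : Set (Plane × Sym2 G.edgeSet) :=
  { x | ∃ e f : G.edgeSet, e ≠ f ∧ x.2 = s(e, f) ∧
      x.1 ∈ D.interOf e ∧ x.1 ∈ D.interOf f }

/-- The weighted number of crossings of a drawing: each crossing of a pair of
edges `e`, `f` contributes `w e * w f`. -/
def wcount (w : Sym2 V → ℕ) : ℕ :=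
  ∑ᶠ x ∈ D.CrossSet,
    Sym2.lift ⟨fun e f : G.edgeSet => w e * w f, fun e f => mul_comm _ _⟩ x.2

/-- A drawing is pseudolinear if each edge can be extended to a pseudoline of the
projective plane (via the standard affine embedding of the plane in the projective
plane) so that the extensions form a pseudoline arrangement: any two of the
pseudolines extending distinct edges meet in exactly one point. -/
def IsPseudolinear : Prop :=
  ∃ L : G.edgeSet → Set RP2,
    (∀ e, IsPseudoline (L e)) ∧
    (∀ e, ∀ t ∈ Icc (0:ℝ) 1, planeToRP2 (D.arc e t) ∈ L e) ∧
    (∀ e f, e ≠ f → ∃! p, p ∈ L e ∧ p ∈ L f)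

/-- A drawing is rectilinear if every edge is drawn as a straight line segment. -/
def IsRectilinear : Prop :=
  ∀ e, ∀ t ∈ Icc (0:ℝ) 1, D.arc e t = (1 - t) • D.arc e 0 + t • D.arc e 1

/-- A drawing is x-monotone if every edge meets every vertical line in at most one
point. -/
def IsMonotone : Prop :=
  ∀ e, InjOn (fun t => (D.arc e t).1) (Icc 0 1)

end Drawing

/-- The crossing number of `G` relative to a class of drawings `P`: the minimum
number of crossings in a drawing of `G` satisfying `P` (with finitely many
crossings). -/
def crNumP {V : Type*} (G : SimpleGraph V) (P : Drawing G → Prop) : ℕ :=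
  sInf { n | ∃ D : Drawing G, P D ∧ D.CrossSet.Finite ∧ D.CrossSet.ncard = n }

/-- The crossing number `cr G`. -/
def crNum {V : Type*} (G : SimpleGraph V) : ℕ := crNumP G fun _ => True

/-- The pseudolinear crossing number `pcr G`. -/
def pcrNum {V : Type*} (G : SimpleGraph V) : ℕ := crNumP G Drawing.IsPseudolinear

/-- The rectilinear crossing number `rcr G`. -/
def rcrNum {V : Type*} (G : SimpleGraph V) : ℕ := crNumP G Drawing.IsRectilinear

/-- The monotone crossing number `mon-cr G`. -/
def moncrNum {V : Type*} (G : SimpleGraph V) : ℕ := crNumP G Drawing.IsMonotone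

/-- The weighted crossing number of `(G, w)` relative to a class of drawings. -/
def wcrNumP {V : Type*} (G : SimpleGraph V) (w : Sym2 V → ℕ) (P : Drawing G → Prop) : ℕ :=
  sInf { n | ∃ D : Drawing G, P D ∧ D.CrossSet.Finite ∧ D.wcount w = n }

/-- The weighted crossing number `cr (G, w)`. -/
def wcrNum {V : Type*} (G : SimpleGraph V) (w : Sym2 V → ℕ) : ℕ :=
  wcrNumP G w fun _ => True

/-- The weighted pseudolinear crossing number `pcr (G, w)`. -/
def wpcrNum {V : Type*} (G : SimpleGraph V) (w : Sym2 V → ℕ) : ℕ :=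
  wcrNumP G w Drawing.IsPseudolinear

/-- The weighted rectilinear crossing number `rcr (G, w)`. -/
def wrcrNum {V : Type*} (G : SimpleGraph V) (w : Sym2 V → ℕ) : ℕ :=
  wcrNumP G w Drawing.IsRectilinear

theorem exists_exp_lift {A : Type*} [TopologicalSpace A] [SimplyConnectedSpace A]
    [LocallyPathConnectedSpace A] (f : C(A, ℂ)) (hf : ∀ a, f a ≠ 0) :
    ∃ g : C(A, ℂ), ∀ a, Complex.exp (g a) = f a := by
  obtain ⟨a₀⟩ := (inferInstance : Nonempty A)
  obtain ⟨F, ⟨-, h⟩, -⟩ := Complex.isCoveringMapOn_exp.existsUnique_continuousMap_lifts f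
    (a₀ := a₀) (e₀ := Complex.log (f a₀)) (Complex.exp_log (hf a₀)) (fun a => hf a)
  exact ⟨F, fun a => congrFun h a⟩

theorem exp_lift_increment_eq {f₁ f₂ g₁ g₂ : C(ℝ, ℂ)} (h₁ : ∀ t, Complex.exp (g₁ t) = f₁ t)
    (h₂ : ∀ t, Complex.exp (g₂ t) = f₂ t) (c : ℂ) (h : ∀ t, f₁ t = c * f₂ t) :
    g₁ 1 - g₁ 0 = g₂ 1 - g₂ 0 := by
  have hf : ∀ t, f₁ t ≠ 0 := fun t => h₁ t ▸ Complex.exp_ne_zero _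
  have hf2 : ∀ t, f₂ t ≠ 0 := fun t => h₂ t ▸ Complex.exp_ne_zero _
  obtain ⟨F, -, hu⟩ := Complex.isCoveringMapOn_exp.existsUnique_continuousMap_lifts f₁
    (a₀ := 0) (e₀ := g₁ 0) (h₁ 0) (fun a => hf a)
  have e1 := hu g₁ ⟨rfl, funext h₁⟩
  let g₃ : C(ℝ, ℂ) := ⟨fun t => g₂ t + (g₁ 0 - g₂ 0), by fun_prop⟩
  have e3 := hu g₃ ⟨by simp [g₃], funext fun t => by
    change Complex.exp (g₂ t + (g₁ 0 - g₂ 0)) = f₁ t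
    rw [Complex.exp_add, Complex.exp_sub, h₁, h₂, h₂, h 0, h t]
    field_simp [hf2 0]⟩
  have : g₁ 1 = g₃ 1 := by rw [e1, e3]
  rw [this]
  change g₂ 1 + (g₁ 0 - g₂ 0) - g₁ 0 = _
  ring

/-- `α` is the change of a continuous logarithm of `f` along `[0, 1]`. -/
def LogIncrement (f : ℝ → ℂ) (α : ℂ) : Prop :=
  ∃ g : C(ℝ, ℂ), (∀ t, Complex.exp (g t) = f t) ∧ g 1 - g 0 = α

theorem LogIncrement.unique {f₁ f₂ : ℝ → ℂ} {α β : ℂ} (hα : LogIncrement f₁ α)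
    (hβ : LogIncrement f₂ β) (c : ℂ) (h : ∀ t, f₁ t = c * f₂ t) : α = β := by
  obtain ⟨g₁, h₁, rfl⟩ := hα
  obtain ⟨g₂, h₂, rfl⟩ := hβ
  have k₁ : f₁ = fun t => Complex.exp (g₁ t) := funext fun t => (h₁ t).symm
  have k₂ : f₂ = fun t => Complex.exp (g₂ t) := funext fun t => (h₂ t).symm
  exact exp_lift_increment_eq (f₁ := ⟨f₁, by rw [k₁]; fun_prop⟩) (f₂ := ⟨f₂, by rw [k₂]; fun_prop⟩)
    h₁ h₂ c h

theorem exists_logIncrement (f : ℝ → ℂ) (hf : Continuous f) (h0 : ∀ t, f t ≠ 0) :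
    ∃ α, LogIncrement f α := by
  obtain ⟨g, hg⟩ := exists_exp_lift (A := ℝ) ⟨f, hf⟩ h0
  exact ⟨_, g, hg, rfl⟩

theorem logIncrement_disjoint {γ δ : ℝ → ℂ} (hγ : Continuous γ) (hδ : Continuous δ)
    (h : ∀ s t, γ s ≠ δ t) {α₀ α₁ β₀ β₁ : ℂ}
    (hα₀ : LogIncrement (fun t => γ t - δ 0) α₀) (hα₁ : LogIncrement (fun t => γ t - δ 1) α₁)
    (hβ₀ : LogIncrement (fun t => δ t - γ 0) β₀) (hβ₁ : LogIncrement (fun t => δ t - γ 1) β₁) :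
    α₀ + β₁ = α₁ + β₀ := by
  obtain ⟨G, hG⟩ := exists_exp_lift (A := ℝ × ℝ) ⟨fun p => γ p.1 - δ p.2, by fun_prop⟩
    (fun p => sub_ne_zero.2 (h _ _))
  simp only [ContinuousMap.coe_mk] at hG
  have a0 : LogIncrement (fun t => γ t - δ 0) (G (1, 0) - G (0, 0)) :=
    ⟨⟨fun t => G (t, 0), by fun_prop⟩, fun t => hG _, rfl⟩
  have a1 : LogIncrement (fun t => γ t - δ 1) (G (1, 1) - G (0, 1)) :=
    ⟨⟨fun t => G (t, 1), by fun_prop⟩, fun t => hG _, rfl⟩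
  have b0 : LogIncrement (fun t => γ 0 - δ t) (G (0, 1) - G (0, 0)) :=
    ⟨⟨fun t => G (0, t), by fun_prop⟩, fun t => hG _, rfl⟩
  have b1 : LogIncrement (fun t => γ 1 - δ t) (G (1, 1) - G (1, 0)) :=
    ⟨⟨fun t => G (1, t), by fun_prop⟩, fun t => hG _, rfl⟩
  rw [hα₀.unique a0 1 (by simp), hα₁.unique a1 1 (by simp),
    hβ₀.unique b0 (-1) (by simp), hβ₁.unique b1 (-1) (by simp)]
  ring

theorem LogIncrement.exists_int {f : ℝ → ℂ} {α : ℂ} (h : LogIncrement f α) {a b : ℂ}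
    (ha : Complex.exp a = f 0) (hb : Complex.exp b = f 1) :
    ∃ n : ℤ, α = b - a + n * (2 * Real.pi * Complex.I) := by
  obtain ⟨g, hg, rfl⟩ := h
  obtain ⟨m, hm⟩ := Complex.exp_eq_exp_iff_exists_int.1 ((hg 0).trans ha.symm)
  obtain ⟨n, hn⟩ := Complex.exp_eq_exp_iff_exists_int.1 ((hg 1).trans hb.symm)
  refine ⟨n - m, ?_⟩
  rw [hm, hn]; push_cast; ring

/-- In a planar drawing of `K₅` two independent edges meet. -/
theorem exists_independent_paths_meet (P : Fin 5 → ℂ) (γ : Fin 5 → Fin 5 → ℝ → ℂ)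
    (hc : ∀ i j, i < j → Continuous (γ i j))
    (h0 : ∀ i j, i < j → γ i j 0 = P i) (h1 : ∀ i j, i < j → γ i j 1 = P j)
    (hP : Function.Injective P)
    (hav : ∀ i j k, i < j → k ≠ i → k ≠ j → ∀ t, γ i j t ≠ P k) :
    ∃ i j k l, i < j ∧ k < l ∧ i ≠ k ∧ i ≠ l ∧ j ≠ k ∧ j ≠ l ∧ ∃ s t, γ i j s = γ k l t := by
  by_contra! hcon
  have hα : ∀ v i j, ∃ α, i < j → v ≠ i → v ≠ j → LogIncrement (fun t => γ i j t - P v) α := by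
    intro v i j
    by_cases h : i < j ∧ v ≠ i ∧ v ≠ j
    · obtain ⟨α, hα⟩ := exists_logIncrement (fun t => γ i j t - P v)
        (by have := hc i j h.1; fun_prop) (fun t => sub_ne_zero.2 (hav _ _ _ h.1 h.2.1 h.2.2 t))
      exact ⟨α, fun _ _ _ => hα⟩
    · exact ⟨0, fun a b c => absurd ⟨a, b, c⟩ h⟩
  choose α hα using hα
  let ε : Fin 5 → Fin 5 → ℤ := fun v w => if v < w then 0 else 1
  let L : Fin 5 → Fin 5 → ℂ := fun v w => Complex.log (P (max v w) - P (min v w))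
  let θ : Fin 5 → Fin 5 → ℂ := fun v w => L v w + ε v w * (Real.pi * Complex.I)
  have hL : ∀ v w, L v w = L w v := fun v w => by simp only [L, max_comm, min_comm]
  have hθ : ∀ v w, v ≠ w → Complex.exp (θ v w) = P w - P v := by
    intro v w h
    rcases lt_or_gt_of_ne h with h' | h'
    · simp only [θ, ε, L, if_pos h', max_eq_right h'.le, min_eq_left h'.le]
      simp [Complex.exp_log (sub_ne_zero.2 (hP.ne h.symm))]
    · simp only [θ, ε, L, if_neg h'.not_gt, max_eq_left h'.le, min_eq_right h'.le]
      simp [Complex.exp_add, Complex.exp_log (sub_ne_zero.2 (hP.ne h)), Complex.exp_pi_mul_I]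
  have hn : ∀ v i j, ∃ n : ℤ, i < j → v ≠ i → v ≠ j →
      α v i j = θ v j - θ v i + n * (2 * Real.pi * Complex.I) := by
    intro v i j
    by_cases h : i < j ∧ v ≠ i ∧ v ≠ j
    · obtain ⟨n, hn⟩ := (hα v i j h.1 h.2.1 h.2.2).exists_int (a := θ v i) (b := θ v j)
        (by rw [hθ v i h.2.1, h0 _ _ h.1]) (by rw [hθ v j h.2.2, h1 _ _ h.1])
      exact ⟨n, fun _ _ _ => hn⟩
    · exact ⟨0, fun a b c => absurd ⟨a, b, c⟩ h⟩
  choose n hn using hn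
  have key : ∀ a b c d, a < b → c < d → a ≠ c → a ≠ d → b ≠ c → b ≠ d →
      (ε c b - ε c a) + (ε b d - ε b c) - (ε d b - ε d a) - (ε a d - ε a c) +
        2 * (n c a b + n b c d - n d a b - n a c d) = 0 := by
    intro a b c d hab hcd hac had hbc hbd
    have e := logIncrement_disjoint (γ := γ a b) (δ := γ c d) (hc _ _ hab) (hc _ _ hcd)
      (fun s t => hcon a b c d hab hcd hac had hbc hbd s t)
      (by simpa [h0 _ _ hcd] using hα c a b hab hac.symm hbc.symm)
      (by simpa [h1 _ _ hcd] using hα d a b hab had.symm hbd.symm)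
      (by simpa [h0 _ _ hab] using hα a c d hcd hac had)
      (by simpa [h1 _ _ hab] using hα b c d hcd hbc hbd)
    rw [hn c a b hab hac.symm hbc.symm, hn d a b hab had.symm hbd.symm, hn a c d hcd hac had,
      hn b c d hcd hbc hbd] at e
    simp only [θ] at e
    rw [hL c b, hL c a, hL d b, hL d a] at e
    have hpi : (Real.pi * Complex.I : ℂ) ≠ 0 := by
      simp [Real.pi_ne_zero]
    have e2 : (((ε c b - ε c a) + (ε b d - ε b c) - (ε d b - ε d a) - (ε a d - ε a c) +
        2 * (n c a b + n b c d - n d a b - n a c d) : ℤ) : ℂ) * (Real.pi * Complex.I) = 0 := by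
      push_cast
      linear_combination e
    have := (mul_eq_zero.1 e2).resolve_right hpi
    exact_mod_cast this
  have k1 := key 0 1 2 3 (by decide) (by decide) (by decide) (by decide) (by decide) (by decide)
  have k2 := key 0 2 1 3 (by decide) (by decide) (by decide) (by decide) (by decide) (by decide)
  have k3 := key 0 3 1 2 (by decide) (by decide) (by decide) (by decide) (by decide) (by decide)
  have k4 := key 0 1 2 4 (by decide) (by decide) (by decide) (by decide) (by decide) (by decide)
  have k5 := key 0 2 1 4 (by decide) (by decide) (by decide) (by decide) (by decide) (by decide)
  have k6 := key 0 4 1 2 (by decide) (by decide) (by decide) (by decide) (by decide) (by decide)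
  have k7 := key 0 1 3 4 (by decide) (by decide) (by decide) (by decide) (by decide) (by decide)
  have k8 := key 0 3 1 4 (by decide) (by decide) (by decide) (by decide) (by decide) (by decide)
  have k9 := key 0 4 1 3 (by decide) (by decide) (by decide) (by decide) (by decide) (by decide)
  have k10 := key 0 2 3 4 (by decide) (by decide) (by decide) (by decide) (by decide) (by decide)
  have k11 := key 0 3 2 4 (by decide) (by decide) (by decide) (by decide) (by decide) (by decide)
  have k12 := key 0 4 2 3 (by decide) (by decide) (by decide) (by decide) (by decide) (by decide)
  have k13 := key 1 2 3 4 (by decide) (by decide) (by decide) (by decide) (by decide) (by decide)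
  have k14 := key 1 3 2 4 (by decide) (by decide) (by decide) (by decide) (by decide) (by decide)
  have k15 := key 1 4 2 3 (by decide) (by decide) (by decide) (by decide) (by decide) (by decide)
  clear hn hα hL hθ key hcon
  simp only [ε, Fin.reduceLT, if_true, if_false] at k1 k2 k3 k4 k5 k6 k7 k8 k9 k10 k11 k12 k13 k14 k15
  omega

theorem exists_independent_sets_meet (P : Fin 5 → Plane) (E : Fin 5 → Fin 5 → Set Plane)
    (hE : ∀ i j, i < j → JoinedIn (E i j) (P i) (P j))
    (hav : ∀ i j k, i < j → k ≠ i → k ≠ j → P k ∉ E i j) :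
    ∃ i j k l, i < j ∧ k < l ∧ i ≠ k ∧ i ≠ l ∧ j ≠ k ∧ j ≠ l ∧ (E i j ∩ E k l).Nonempty := by
  have hEi : ∀ i k, i ≠ k → ∃ a b, a < b ∧ P i ∈ E a b ∧ k ≠ a ∧ k ≠ b := by
    have h : ∀ i k : Fin 5, i ≠ k → ∃ a b, a < b ∧ (i = a ∨ i = b) ∧ k ≠ a ∧ k ≠ b := by decide
    intro i k hik
    obtain ⟨a, b, hab, h1, h2⟩ := h i k hik
    refine ⟨a, b, hab, ?_, h2⟩
    rcases h1 with rfl | rfl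
    · exact (hE _ _ hab).source_mem
    · exact (hE _ _ hab).target_mem
  have hP : Function.Injective P := by
    intro i k h
    by_contra hik
    obtain ⟨a, b, hab, h1, h2, h3⟩ := hEi i k hik
    exact hav a b k hab h2 h3 (h ▸ h1)
  let T := Complex.equivRealProdCLM.symm
  have hγ : ∀ i j, ∃ γ : ℝ → Plane, i < j → Continuous γ ∧ γ 0 = P i ∧ γ 1 = P j ∧
      ∀ t, γ t ∈ E i j := by
    intro i j
    by_cases hij : i < j
    · obtain ⟨γ, hγ⟩ := hE i j hij
      refine ⟨γ.extend, fun _ => ⟨γ.continuous_extend, γ.extend_zero, γ.extend_one, fun t => ?_⟩⟩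
      have : γ.extend t ∈ range γ.extend := mem_range_self t
      rw [Path.extend_range] at this
      obtain ⟨s, hs⟩ := this
      exact hs ▸ hγ s
    · exact ⟨fun _ => 0, fun h => absurd h hij⟩
  choose γ hγ using hγ
  obtain ⟨i, j, k, l, h1, h2, h3, h4, h5, h6, s, t, hst⟩ := exists_independent_paths_meet
    (fun i => T (P i)) (fun i j t => T (γ i j t))
    (fun i j h => T.continuous.comp (hγ i j h).1) (fun i j h => by rw [(hγ i j h).2.1])
    (fun i j h => by rw [(hγ i j h).2.2.1]) (T.injective.comp hP)
    (fun i j k h h1 h2 t e => hav i j k h h1 h2 (T.injective e ▸ (hγ i j h).2.2.2 t))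
  exact ⟨i, j, k, l, h1, h2, h3, h4, h5, h6, γ i j s, (hγ i j h1).2.2.2 s,
    T.injective hst ▸ (hγ k l h2).2.2.2 t⟩

/-- The pairs `{x, y}` and `{z, w}` alternate in the linear (equivalently, cyclic) order. -/
def Interleave (x y z w : ℕ) : Prop :=
  (min x y < min z w ∧ min z w < max x y ∧ max x y < max z w) ∨
    (min z w < min x y ∧ min x y < max z w ∧ max z w < max x y)

instance (x y z w : ℕ) : Decidable (Interleave x y z w) := by
  unfold Interleave; infer_instance

/-- A wheel drawn in the plane: a cycle of arcs `C i` through the points `v 0, …, v N` and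
spokes `S i` from a hub `h`, together with a set `O` that avoids the spokes. -/
structure PlaneWheel (N : ℕ) where
  v : ℕ → Plane
  h : Plane
  C : ℕ → Set Plane
  S : ℕ → Set Plane
  O : Set Plane
  joinedC : ∀ i < N, JoinedIn (C i) (v i) (v (i + 1))
  joinedC_last : JoinedIn (C N) (v N) (v 0)
  joinedS : ∀ i, 1 ≤ i → i ≤ N → JoinedIn (S i) h (v i)
  disjointC : ∀ i j, i + 1 < j → j ≤ N → (0 < i ∨ j < N) → Disjoint (C i) (C j)
  disjointSC : ∀ k i, 1 ≤ k → k ≤ N → i ≤ N → k ≠ i → k ≠ i + 1 → Disjoint (S k) (C i)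
  interSO : ∀ k, 1 ≤ k → k ≤ N → S k ∩ O ⊆ {v k}
  h_notMem_C : ∀ i ≤ N, h ∉ C i
  h_notMem_O : h ∉ O
  v_notMem_C : ∀ k i, 1 ≤ k → k ≤ N → i ≤ N → k ≠ i → k ≠ i + 1 → v k ∉ C i
  v_notMem_S : ∀ j k, 1 ≤ j → j ≤ N → 1 ≤ k → k ≤ N → j ≠ k → v j ∉ S k

namespace PlaneWheel
variable {N : ℕ} (W : PlaneWheel N)

theorem joinedIn_Ico {a b : ℕ} (hab : a < b) (hb : b ≤ N) :
    JoinedIn (⋃ i ∈ Ico a b, W.C i) (W.v a) (W.v b) := by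
  induction b, hab using Nat.le_induction with
  | base => exact (W.joinedC a (by omega)).mono (subset_biUnion_of_mem (u := W.C) (by simp))
  | succ b hab ih =>
    refine ((ih (by omega)).mono ?_).trans
      ((W.joinedC b (by omega)).mono (subset_biUnion_of_mem (u := W.C) (by simp; omega)))
    exact biUnion_subset_biUnion_left (Ico_subset_Ico_right (by omega))

theorem joinedIn_wrap {a d : ℕ} (ha : 1 ≤ a) (hd : d ≤ N) (haN : a ≤ N) :
    JoinedIn (⋃ i ∈ Icc d N ∪ Iio a, W.C i) (W.v a) (W.v d) := by
  have h1 := W.joinedC_last.mono (subset_biUnion_of_mem (u := W.C)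
    (show N ∈ Icc d N ∪ Iio a by simp [hd]))
  have h2 := (W.joinedIn_Ico (a := 0) (b := a) (by omega) haN).mono
    (show _ ⊆ ⋃ i ∈ Icc d N ∪ Iio a, W.C i from
      biUnion_subset_biUnion_left (fun i hi => by simp at hi ⊢; omega))
  refine (h1.trans h2).symm.trans ?_
  rcases hd.eq_or_lt with rfl | hd
  · exact JoinedIn.refl h1.source_mem
  · exact ((W.joinedIn_Ico hd le_rfl).mono
      (biUnion_subset_biUnion_left (fun i hi => by simp at hi ⊢; omega))).symm

theorem inter_nonempty_aux {a b c d : ℕ} (ha : 1 ≤ a) (hab : a < b) (hbc : b < c) (hcd : c < d)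
    (hd : d ≤ N) {A B : Set Plane} (hAO : A ⊆ W.O) (hBO : B ⊆ W.O)
    (hA : JoinedIn A (W.v a) (W.v c)) (hB : JoinedIn B (W.v b) (W.v d))
    (hbA : W.v b ∉ A) (hdA : W.v d ∉ A) (haB : W.v a ∉ B) (hcB : W.v c ∉ B) :
    (A ∩ B).Nonempty := by
  let U : Set ℕ → Set Plane := fun I => ⋃ i ∈ I, W.C i
  have hUS : ∀ I k, 1 ≤ k → k ≤ N → (∀ i ∈ I, i ≤ N ∧ k ≠ i ∧ k ≠ i + 1) →
      ¬ (W.S k ∩ U I).Nonempty := by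
    rintro I k h1 h2 h ⟨p, hp, hpU⟩
    obtain ⟨i, hi, hpi⟩ := mem_iUnion₂.1 hpU
    obtain ⟨h3, h4, h5⟩ := h i hi
    exact (W.disjointSC k i h1 h2 h3 h4 h5).notMem_of_mem_left hp hpi
  have hUU : ∀ I J, (∀ i ∈ I, ∀ j ∈ J, (i + 1 < j ∧ j ≤ N ∧ (0 < i ∨ j < N)) ∨
      (j + 1 < i ∧ i ≤ N ∧ (0 < j ∨ i < N))) → ¬ (U I ∩ U J).Nonempty := by
    rintro I J h ⟨p, hp, hp'⟩
    obtain ⟨i, hi, hpi⟩ := mem_iUnion₂.1 hp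
    obtain ⟨j, hj, hpj⟩ := mem_iUnion₂.1 hp'
    rcases h i hi j hj with h | h
    · exact (W.disjointC i j h.1 h.2.1 h.2.2).notMem_of_mem_left hpi hpj
    · exact (W.disjointC j i h.1 h.2.1 h.2.2).notMem_of_mem_left hpj hpi
  have hUh : ∀ I, (∀ i ∈ I, i ≤ N) → W.h ∉ U I := by
    intro I h hp
    obtain ⟨i, hi, hpi⟩ := mem_iUnion₂.1 hp
    exact W.h_notMem_C i (h i hi) hpi
  have hUv : ∀ I k, 1 ≤ k → k ≤ N → (∀ i ∈ I, i ≤ N ∧ k ≠ i ∧ k ≠ i + 1) → W.v k ∉ U I := by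
    intro I k h1 h2 h hp
    obtain ⟨i, hi, hpi⟩ := mem_iUnion₂.1 hp
    obtain ⟨h3, h4, h5⟩ := h i hi
    exact W.v_notMem_C k i h1 h2 h3 h4 h5 hpi
  have hSO : ∀ k Z, 1 ≤ k → k ≤ N → Z ⊆ W.O → W.v k ∉ Z → ¬ (W.S k ∩ Z).Nonempty := by
    rintro k Z h1 h2 hZ hk ⟨p, hp, hp'⟩
    have := W.interSO k h1 h2 ⟨hp, hZ hp'⟩
    exact hk (this ▸ hp')
  by_contra hcon
  let E : Fin 5 → Fin 5 → Set Plane :=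
    ![![∅, W.S a, W.S b, W.S c, W.S d],
      ![∅, ∅, U (Ico a b), A, U (Icc d N ∪ Iio a)],
      ![∅, ∅, ∅, U (Ico b c), B],
      ![∅, ∅, ∅, ∅, U (Ico c d)],
      ![∅, ∅, ∅, ∅, ∅]]
  let P : Fin 5 → Plane := ![W.h, W.v a, W.v b, W.v c, W.v d]
  have hjoin : ∀ i j, i < j → JoinedIn (E i j) (P i) (P j) := by
    intro i j hij
    fin_cases i <;> fin_cases j <;> simp at hij
    · exact W.joinedS a (by omega) (by omega)
    · exact W.joinedS b (by omega) (by omega)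
    · exact W.joinedS c (by omega) (by omega)
    · exact W.joinedS d (by omega) (by omega)
    · exact W.joinedIn_Ico (by omega) (by omega)
    · exact hA
    · exact W.joinedIn_wrap (by omega) (by omega) (by omega)
    · exact W.joinedIn_Ico (by omega) (by omega)
    · exact hB
    · exact W.joinedIn_Ico (by omega) (by omega)
  have havoid : ∀ i j k, i < j → k ≠ i → k ≠ j → P k ∉ E i j := by
    intro i j k hij hki hkj
    fin_cases i <;> fin_cases j <;> simp at hij <;> fin_cases k <;> simp at hki hkj
    all_goals first
      | exact W.v_notMem_S _ _ (by omega) (by omega) (by omega) (by omega) (by omega)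
      | exact hUh _ (by intro i hi; simp at hi; omega)
      | exact hUv _ _ (by omega) (by omega) (by intro i hi; simp at hi; omega)
      | exact fun h => W.h_notMem_O (hAO h)
      | exact fun h => W.h_notMem_O (hBO h)
      | assumption
  obtain ⟨i, j, k, l, h1, h2, h3, h4, h5, h6, hne⟩ :=
    exists_independent_sets_meet P E hjoin havoid
  have e1 := hUS (Ico b c) a (by omega) (by omega) (by intro i hi; simp at hi; omega)
  have e2 := hUS (Ico c d) a (by omega) (by omega) (by intro i hi; simp at hi; omega)
  have e3 := hUS (Ico c d) b (by omega) (by omega) (by intro i hi; simp at hi; omega)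
  have e4 := hUS (Icc d N ∪ Iio a) b (by omega) (by omega) (by intro i hi; simp at hi; omega)
  have e5 := hUS (Ico a b) c (by omega) (by omega) (by intro i hi; simp at hi; omega)
  have e6 := hUS (Icc d N ∪ Iio a) c (by omega) (by omega) (by intro i hi; simp at hi; omega)
  have e7 := hUS (Ico a b) d (by omega) (by omega) (by intro i hi; simp at hi; omega)
  have e8 := hUS (Ico b c) d (by omega) (by omega) (by intro i hi; simp at hi; omega)
  have f1 := hUU (Ico a b) (Ico c d)
    (by intro i hi j hj; simp at hi hj; omega)
  have f2 := hUU (Icc d N ∪ Iio a) (Ico b c)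
    (by intro i hi j hj; simp at hi hj; omega)
  have g1 := hSO a B (by omega) (by omega) hBO haB
  have g2 := hSO c B (by omega) (by omega) hBO hcB
  have g3 := hSO b A (by omega) (by omega) hAO hbA
  have g4 := hSO d A (by omega) (by omega) hAO hdA
  clear hUS hUU hUh hUv hSO hjoin havoid hA hB hAO hBO
  wlog hik : i < k generalizing i j k l
  · exact this k l i j h2 h1 h3.symm h5.symm h4.symm h6.symm (inter_comm _ _ ▸ hne) (by omega)
  fin_cases i <;> fin_cases j <;> simp at h1 <;> fin_cases k <;> simp at hik h3 h5 <;>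
    fin_cases l <;> simp at h2 h4 h6
  all_goals contradiction

theorem inter_nonempty {x y z w : ℕ} (hi : Interleave x y z w)
    (hx : 1 ≤ x) (hy : 1 ≤ y) (hz : 1 ≤ z) (hw : 1 ≤ w)
    (hx' : x ≤ N) (hy' : y ≤ N) (hz' : z ≤ N) (hw' : w ≤ N)
    {A B : Set Plane} (hAO : A ⊆ W.O) (hBO : B ⊆ W.O)
    (hA : JoinedIn A (W.v x) (W.v y)) (hB : JoinedIn B (W.v z) (W.v w))
    (hzA : W.v z ∉ A) (hwA : W.v w ∉ A) (hxB : W.v x ∉ B) (hyB : W.v y ∉ B) :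
    (A ∩ B).Nonempty := by
  unfold Interleave at hi
  wlog hxy : x ≤ y generalizing x y
  · exact this (by rwa [min_comm y, max_comm y]) hy hx hy' hx' hA.symm hyB hxB (by omega)
  wlog hzw : z ≤ w generalizing z w
  · exact this hw hz hw' hz' hB.symm hwA hzA (by rwa [min_comm w, max_comm w]) (by omega)
  rw [min_eq_left hxy, min_eq_left hzw, max_eq_right hxy, max_eq_right hzw] at hi
  rcases hi with ⟨h1, h2, h3⟩ | ⟨h1, h2, h3⟩
  · exact W.inter_nonempty_aux hx h1 h2 h3 hw' hAO hBO hA hB hzA hwA hxB hyB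
  · rw [inter_comm]
    exact W.inter_nonempty_aux hz h1 h2 h3 hy' hBO hAO hB hA hxB hyB hzA hwA

end PlaneWheel

namespace Drawing

variable {V : Type*} {G : SimpleGraph V} (D : Drawing G)

/-- The closed arc of an edge. -/
def arcSet (e : G.edgeSet) : Set Plane := D.arc e '' Icc 0 1

theorem joinedIn_arcSet {e : G.edgeSet} {x y : V} (h : (e : Sym2 V) = s(x, y)) :
    JoinedIn (D.arcSet e) (D.vert x) (D.vert y) := by
  have key : JoinedIn (D.arcSet e) (D.arc e 0) (D.arc e 1) :=
    ((isPathConnected_iff.2 ⟨by simp, fun a ha b hb =>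
      ((convex_Icc (0:ℝ) 1).isPathConnected ⟨0, by simp⟩).joinedIn a ha b hb⟩ :
      IsPathConnected (Icc (0:ℝ) 1)).image' (D.arc_cont e)).joinedIn _
        (mem_image_of_mem _ (by simp)) _ (mem_image_of_mem _ (by simp))
  obtain ⟨a, b, hab, h0, h1⟩ := D.arc_ends e
  rw [h0, h1] at key
  rcases Sym2.eq_iff.1 (hab.symm.trans h) with ⟨rfl, rfl⟩ | ⟨rfl, rfl⟩
  · exact key
  · exact key.symm

theorem mem_of_vert_mem_arcSet {e : G.edgeSet} {w : V} (h : D.vert w ∈ D.arcSet e) :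
    w ∈ (e : Sym2 V) := by
  obtain ⟨t, ht, hw⟩ := h
  obtain ⟨a, b, hab, h0, h1⟩ := D.arc_ends e
  rw [hab]
  rcases D.arc_avoid e t ht ⟨w, hw⟩ with rfl | rfl
  · rw [D.vert_inj (hw.symm.trans h0)]; simp
  · rw [D.vert_inj (hw.symm.trans h1)]; simp

theorem eq_vert_or_mem_interOf {e : G.edgeSet} {p : Plane} (h : p ∈ D.arcSet e) :
    (∃ w ∈ (e : Sym2 V), p = D.vert w) ∨ p ∈ D.interOf e := by
  obtain ⟨t, ht, rfl⟩ := h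
  obtain ⟨a, b, hab, h0, h1⟩ := D.arc_ends e
  rcases eq_or_lt_of_le ht.1 with rfl | h2
  · exact Or.inl ⟨a, by simp [hab], h0⟩
  rcases eq_or_lt_of_le ht.2 with rfl | h3
  · exact Or.inl ⟨b, by simp [hab], h1⟩
  exact Or.inr ⟨t, ⟨h2, h3⟩, rfl⟩

theorem common_vert_or_mem_crossSet {e f : G.edgeSet} (hef : e ≠ f) {p : Plane}
    (he : p ∈ D.arcSet e) (hf : p ∈ D.arcSet f) :
    (∃ w, w ∈ (e : Sym2 V) ∧ w ∈ (f : Sym2 V) ∧ p = D.vert w) ∨ (p, s(e, f)) ∈ D.CrossSet := by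
  rcases D.eq_vert_or_mem_interOf he with ⟨w, hw, rfl⟩ | he'
  · exact Or.inl ⟨w, hw, D.mem_of_vert_mem_arcSet hf, rfl⟩
  rcases D.eq_vert_or_mem_interOf hf with ⟨w, hw, rfl⟩ | hf'
  · exact Or.inl ⟨w, D.mem_of_vert_mem_arcSet he, hw, rfl⟩
  exact Or.inr ⟨e, f, hef, rfl, he', hf'⟩

/-- An edge is clean if it takes part in no crossing. -/
def Clean (e : G.edgeSet) : Prop := ∀ x ∈ D.CrossSet, e ∉ x.2

variable {D}

theorem exists_clean {n c : ℕ} (hfin : D.CrossSet.Finite) (hc : D.CrossSet.ncard ≤ c)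
    (hn : 2 * c < n) (f : Fin n × Bool → G.edgeSet) (hf : Function.Injective f) :
    ∃ k, ∀ b, D.Clean (f (k, b)) := by
  classical
  by_contra! hcon
  choose b hb using hcon
  let g : Fin n → G.edgeSet := fun k => f (k, b k)
  have hg : Function.Injective g := fun i j h => congrArg Prod.fst (hf h)
  have hsub : Finset.univ.image g ⊆ hfin.toFinset.biUnion fun x => x.2.toFinset := by
    intro e he
    obtain ⟨k, -, rfl⟩ := Finset.mem_image.1 he
    have := hb k
    simp only [Clean, not_forall, not_not] at this
    obtain ⟨x, hx, hx'⟩ := this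
    exact Finset.mem_biUnion.2 ⟨x, by simpa using hx, by simpa using hx'⟩
  have h1 := Finset.card_le_card hsub
  rw [Finset.card_image_of_injective _ hg, Finset.card_univ, Fintype.card_fin] at h1
  have h2 := Finset.card_biUnion_le_card_mul hfin.toFinset (fun x => x.2.toFinset) 2 (by
    rintro ⟨p, z⟩ -
    induction z with | _ a b
    simpa [Sym2.toFinset_mk_eq] using Finset.card_le_two)
  rw [← ncard_eq_toFinset_card _ hfin] at h2
  omega

end Drawing

/-- An indexing of the edges of a graph by a type `E`, with a choice of orientation. -/
structure EdgeIndexing {V : Type*} (G : SimpleGraph V) (E : Type*) where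
  edge : E ≃ G.edgeSet
  src : E → V
  tgt : E → V
  spec : ∀ e, (edge e : Sym2 V) = s(src e, tgt e)

/-- The graph with prescribed edges. -/
def graphOfEnds {V E : Type*} (src tgt : E → V) : SimpleGraph V :=
  SimpleGraph.fromEdgeSet (range fun e => s(src e, tgt e))

/-- The tautological edge indexing of a graph with prescribed edges. -/
def graphOfEndsIndexing {V E : Type*} (src tgt : E → V) (hne : ∀ e, src e ≠ tgt e)
    (hinj : Function.Injective fun e => s(src e, tgt e)) :
    EdgeIndexing (graphOfEnds src tgt) E where
  edge := Equiv.ofBijective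
    (fun e => ⟨s(src e, tgt e), by
      simp only [graphOfEnds, SimpleGraph.edgeSet_fromEdgeSet]
      exact ⟨mem_range_self e, by simpa using hne e⟩⟩)
    ⟨fun a b h => hinj (by simpa using h), by
      rintro ⟨z, hz⟩
      simp only [graphOfEnds, SimpleGraph.edgeSet_fromEdgeSet, mem_sdiff] at hz
      obtain ⟨⟨e, rfl⟩, -⟩ := hz
      exact ⟨e, rfl⟩⟩
  src := src
  tgt := tgt
  spec _ := rfl

/-- The vertices of the gadget: a rim `g 0, …, g 30`, a hub, six tripod centres, and the
middle vertices of the thick rim edges (`cmid`) and of the thick spokes (`smid`). -/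
inductive GVert
  | g (i : Fin 31)
  | hub
  | ctr (t : Fin 6)
  | cmid (i : Fin 31) (k : Fin 193)
  | smid (i : Fin 30) (k : Fin 193)

/-- The edges of the gadget: nine chords, the legs of six tripods, thick rim edges and
thick spokes. -/
inductive GEdge
  | chord (c i : Fin 3)
  | leg (t : Fin 6) (q : Fin 3)
  | cyc (i : Fin 31) (k : Fin 193) (b : Bool)
  | spk (i : Fin 30) (k : Fin 193) (b : Bool)

/-- The rim position of the common end of the chords of a class. -/
def rootIdx : Fin 3 → Fin 31 := ![1, 11, 21]

/-- The rim position of the other end of a chord. -/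
def chordIdx : Fin 3 → Fin 3 → Fin 31 := ![![19, 16, 13], ![26, 23, 29], ![3, 9, 6]]

/-- The rim position of the end of a leg. -/
def legIdx : Fin 6 → Fin 3 → Fin 31 :=
  ![![20, 27, 4], ![17, 24, 10], ![14, 30, 7], ![18, 22, 5], ![15, 28, 2], ![12, 25, 8]]

namespace GEdge

/-- The first end of an edge. -/
def src : GEdge → GVert
  | chord c _ => .g (rootIdx c)
  | leg t _ => .ctr t
  | cyc i _ false => .g i
  | cyc i k true => .cmid i k
  | spk _ _ false => .hub
  | spk i k true => .smid i k

/-- The second end of an edge. -/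
def tgt : GEdge → GVert
  | chord c i => .g (chordIdx c i)
  | leg t q => .g (legIdx t q)
  | cyc i k false => .cmid i k
  | cyc i _ true => .g (i + 1)
  | spk i k false => .smid i k
  | spk i _ true => .g i.succ

end GEdge

theorem GEdge.src_ne_tgt (e : GEdge) : e.src ≠ e.tgt := by
  rcases e with ⟨c, i⟩ | ⟨t, q⟩ | ⟨i, k, _ | _⟩ | ⟨i, k, _ | _⟩ <;> simp [GEdge.src, GEdge.tgt]
  revert c i; decide

theorem GEdge.sym2_injective : Function.Injective fun e : GEdge => s(e.src, e.tgt) := by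
  have hc : ∀ c i c' i', rootIdx c = rootIdx c' ∧ chordIdx c i = chordIdx c' i' ∨
      rootIdx c = chordIdx c' i' ∧ chordIdx c i = rootIdx c' → c = c' ∧ i = i' := by decide
  have hl : ∀ t q q', legIdx t q = legIdx t q' → q = q' := by decide
  intro e f h
  rcases e with ⟨c, i⟩ | ⟨t, q⟩ | ⟨i, k, _ | _⟩ | ⟨i, k, _ | _⟩ <;>
    rcases f with ⟨c', i'⟩ | ⟨t', q'⟩ | ⟨i', k', _ | _⟩ | ⟨i', k', _ | _⟩ <;>
    simp [GEdge.src, GEdge.tgt] at h ⊢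
  · exact hc _ _ _ _ h
  · obtain ⟨rfl, h⟩ := h
    exact ⟨rfl, hl _ _ _ h⟩
  all_goals grind

/-- The gadget graph. -/
def gadget : SimpleGraph GVert := graphOfEnds GEdge.src GEdge.tgt

/-- The edges of the gadget graph, indexed by `GEdge`. -/
def gadgetEdges : EdgeIndexing gadget GEdge :=
  graphOfEndsIndexing GEdge.src GEdge.tgt GEdge.src_ne_tgt GEdge.sym2_injective

instance : Finite GVert := by
  let f : Fin 31 ⊕ Unit ⊕ Fin 6 ⊕ (Fin 31 × Fin 193) ⊕ (Fin 30 × Fin 193) → GVert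
    | .inl i => .g i
    | .inr (.inl _) => .hub
    | .inr (.inr (.inl t)) => .ctr t
    | .inr (.inr (.inr (.inl (i, k)))) => .cmid i k
    | .inr (.inr (.inr (.inr (i, k)))) => .smid i k
  refine Finite.of_surjective f ?_
  rintro (i | _ | t | ⟨i, k⟩ | ⟨i, k⟩)
  · exact ⟨.inl i, rfl⟩
  · exact ⟨.inr (.inl ()), rfl⟩
  · exact ⟨.inr (.inr (.inl t)), rfl⟩
  · exact ⟨.inr (.inr (.inr (.inl (i, k)))), rfl⟩
  · exact ⟨.inr (.inr (.inr (.inr (i, k)))), rfl⟩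

theorem gadgetEdges_spec (e : GEdge) : (gadgetEdges.edge e : Sym2 GVert) = s(e.src, e.tgt) := rfl

namespace Gadget

variable (D : Drawing gadget)

/-- The closed arc of an edge of the gadget. -/
def arc (e : GEdge) : Set Plane := D.arcSet (gadgetEdges.edge e)

theorem joinedIn_arc (e : GEdge) : JoinedIn (arc D e) (D.vert e.src) (D.vert e.tgt) :=
  D.joinedIn_arcSet (gadgetEdges.spec e)

theorem eq_of_vert_mem_arc {e : GEdge} {w : GVert} (h : D.vert w ∈ arc D e) :
    w = e.src ∨ w = e.tgt := by
  have := D.mem_of_vert_mem_arcSet h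
  rw [gadgetEdges_spec, Sym2.mem_iff] at this
  exact this

theorem common_vert_or_mem_crossSet {e f : GEdge} (hef : e ≠ f) {p : Plane}
    (he : p ∈ arc D e) (hf : p ∈ arc D f) :
    (∃ w, (w = e.src ∨ w = e.tgt) ∧ (w = f.src ∨ w = f.tgt) ∧ p = D.vert w) ∨
      (p, s(gadgetEdges.edge e, gadgetEdges.edge f)) ∈ D.CrossSet := by
  have := D.common_vert_or_mem_crossSet (gadgetEdges.edge.injective.ne hef) he hf
  simpa only [gadgetEdges_spec, Sym2.mem_iff] using this

/-- The union of the arcs of the chords and of the legs. -/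
def objects : Set Plane := (⋃ c, ⋃ i, arc D (.chord c i)) ∪ ⋃ t, ⋃ q, arc D (.leg t q)

variable {D}

theorem mem_objects {p : Plane} (hp : p ∈ objects D) :
    ∃ e, p ∈ arc D e ∧ ((∃ c i, e = .chord c i) ∨ ∃ t q, e = .leg t q) := by
  rcases hp with hp | hp
  · simp only [mem_iUnion] at hp
    obtain ⟨c, i, h⟩ := hp
    exact ⟨_, h, Or.inl ⟨c, i, rfl⟩⟩
  · simp only [mem_iUnion] at hp
    obtain ⟨c, i, h⟩ := hp
    exact ⟨_, h, Or.inr ⟨c, i, rfl⟩⟩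

theorem arc_chord_subset (c i : Fin 3) : arc D (.chord c i) ⊆ objects D :=
  (subset_iUnion₂ (s := fun c i => arc D (.chord c i)) c i).trans subset_union_left

theorem arc_leg_subset (t : Fin 6) (q : Fin 3) : arc D (.leg t q) ⊆ objects D :=
  (subset_iUnion₂ (s := fun t q => arc D (.leg t q)) t q).trans subset_union_right

set_option maxHeartbeats 1000000 in
theorem exists_wheel (hfin : D.CrossSet.Finite) (hc : D.CrossSet.ncard ≤ 96) :
    ∃ W : PlaneWheel 30, W.O = objects D ∧ ∀ i, W.v i = D.vert (.g (Fin.ofNat 31 i)) := by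
  have hkc : ∀ i, ∃ k, ∀ b, D.Clean (gadgetEdges.edge (.cyc i k b)) := fun i =>
    D.exists_clean hfin hc (by norm_num) (fun x => gadgetEdges.edge (.cyc i x.1 x.2))
      (fun x y h => by simpa [Prod.ext_iff] using h)
  have hks : ∀ i, ∃ k, ∀ b, D.Clean (gadgetEdges.edge (.spk i k b)) := fun i =>
    D.exists_clean hfin hc (by norm_num) (fun x => gadgetEdges.edge (.spk i x.1 x.2))
      (fun x y h => by simpa [Prod.ext_iff] using h)
  choose kc hkc using hkc
  choose ks hks using hks
  have clean : ∀ e f, D.Clean (gadgetEdges.edge e) → e ≠ f → ∀ p, p ∈ arc D e → p ∈ arc D f →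
      ∃ w, (w = e.src ∨ w = e.tgt) ∧ (w = f.src ∨ w = f.tgt) ∧ p = D.vert w := by
    intro e f he hef p hp hp'
    exact (common_vert_or_mem_crossSet D hef hp hp').resolve_right fun h => he _ h (by simp)
  have val : ∀ i, i ≤ 30 → (Fin.ofNat 31 i).val = i := fun i hi => Nat.mod_eq_of_lt (by omega)
  have val' : ∀ i, 1 ≤ i → i ≤ 30 → (Fin.ofNat 30 (i - 1)).val + 1 = i := fun i h1 hi => by
    simp [Fin.ofNat]; omega
  have succ_eq : ∀ i, 1 ≤ i → i ≤ 30 → (Fin.ofNat 30 (i - 1)).succ = Fin.ofNat 31 i :=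
    fun i h1 hi => Fin.ext (by rw [val i hi]; exact val' i h1 hi)
  let C : Fin 31 → Set Plane := fun i => ⋃ b, arc D (.cyc i (kc i) b)
  let S : Fin 30 → Set Plane := fun i => ⋃ b, arc D (.spk i (ks i) b)
  have joinC : ∀ i, JoinedIn (C i) (D.vert (.g i)) (D.vert (.g (i + 1))) := fun i =>
    ((joinedIn_arc D (.cyc i (kc i) false)).mono (subset_iUnion_of_subset false subset_rfl)).trans
      ((joinedIn_arc D (.cyc i (kc i) true)).mono (subset_iUnion_of_subset true subset_rfl))
  have joinS : ∀ i, JoinedIn (S i) (D.vert .hub) (D.vert (.g i.succ)) := fun i =>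
    ((joinedIn_arc D (.spk i (ks i) false)).mono (subset_iUnion_of_subset false subset_rfl)).trans
      ((joinedIn_arc D (.spk i (ks i) true)).mono (subset_iUnion_of_subset true subset_rfl))
  have disjCC : ∀ i j, i ≠ j → i + 1 ≠ j → j + 1 ≠ i → Disjoint (C i) (C j) := by
    intro i j h1 h2 h3
    rw [Set.disjoint_left]
    intro p hp hp'
    simp only [C, mem_iUnion] at hp hp'
    obtain ⟨b, hp⟩ := hp
    obtain ⟨b', hp'⟩ := hp'
    obtain ⟨w, hw, hw', -⟩ := clean _ _ (hkc i b) (by simp [h1]) p hp hp'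
    cases b <;> cases b' <;> rcases hw with rfl | rfl <;>
      simp_all [GEdge.src, GEdge.tgt]
  have disjSC : ∀ (k : Fin 30) (i : Fin 31), k.succ ≠ i → k.succ ≠ i + 1 →
      Disjoint (S k) (C i) := by
    intro i j h1 h2
    rw [Set.disjoint_left]
    intro p hp hp'
    simp only [C, S, mem_iUnion] at hp hp'
    obtain ⟨b, hp⟩ := hp
    obtain ⟨b', hp'⟩ := hp'
    obtain ⟨w, hw, hw', -⟩ := clean _ _ (hks i b) (by simp) p hp hp'
    cases b <;> cases b' <;> rcases hw with rfl | rfl <;>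
      simp_all [GEdge.src, GEdge.tgt]
  have interSO : ∀ k : Fin 30, S k ∩ objects D ⊆ {D.vert (.g k.succ)} := by
    rintro k p ⟨hp, hp'⟩
    simp only [S, mem_iUnion] at hp
    obtain ⟨b, hp⟩ := hp
    obtain ⟨e, hpe, he⟩ := mem_objects hp'
    obtain ⟨w, hw, hw', rfl⟩ := clean _ e (hks k b) (by
      rcases he with ⟨_, _, rfl⟩ | ⟨_, _, rfl⟩ <;> simp) p hp hpe
    rcases he with ⟨_, _, rfl⟩ | ⟨_, _, rfl⟩ <;> cases b <;> rcases hw with rfl | rfl <;>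
      simp_all [GEdge.src, GEdge.tgt]
  have hubC : ∀ i, D.vert .hub ∉ C i := by
    intro i h
    simp only [C, mem_iUnion] at h
    obtain ⟨b, h⟩ := h
    have := eq_of_vert_mem_arc D h
    cases b <;> simp [GEdge.src, GEdge.tgt] at this
  have hubO : D.vert .hub ∉ objects D := by
    intro h
    obtain ⟨e, hpe, he⟩ := mem_objects h
    have := eq_of_vert_mem_arc D hpe
    rcases he with ⟨_, _, rfl⟩ | ⟨_, _, rfl⟩ <;> simp [GEdge.src, GEdge.tgt] at this
  have vC : ∀ j i, j ≠ i → j ≠ i + 1 → D.vert (.g j) ∉ C i := by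
    intro j i h1 h2 h
    simp only [C, mem_iUnion] at h
    obtain ⟨b, h⟩ := h
    have := eq_of_vert_mem_arc D h
    cases b <;> simp_all [GEdge.src, GEdge.tgt]
  have vS : ∀ (j : Fin 31) (k : Fin 30), j ≠ k.succ → D.vert (.g j) ∉ S k := by
    intro j i h1 h
    simp only [S, mem_iUnion] at h
    obtain ⟨b, h⟩ := h
    have := eq_of_vert_mem_arc D h
    cases b <;> simp_all [GEdge.src, GEdge.tgt]
  have add1 : ∀ i, Fin.ofNat 31 (i + 1) = Fin.ofNat 31 i + 1 := fun i => by
    ext; simp [Fin.ofNat, Fin.val_add]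
  have ne_of : ∀ i j, i ≤ 30 → j ≤ 30 → i ≠ j → Fin.ofNat 31 i ≠ Fin.ofNat 31 j := by
    intro i j hi hj h e
    exact h (by rw [← val i hi, ← val j hj, e])
  have ne_of' : ∀ i j, i ≤ 30 → 1 ≤ j → j ≤ 30 → j ≠ i + 1 →
      Fin.ofNat 31 j ≠ Fin.ofNat 31 i + 1 := by
    intro i j hi h1 hj h e
    rw [← add1] at e
    rcases Nat.lt_or_ge i 30 with h3 | h3
    · exact ne_of j (i + 1) hj (by omega) h e
    · obtain rfl : i = 30 := by omega
      have := val j hj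
      have h0 : (Fin.ofNat 31 (30 + 1)).val = 0 := rfl
      rw [e, h0] at this
      omega
  refine ⟨{
    v := fun i => D.vert (.g (Fin.ofNat 31 i))
    h := D.vert .hub
    C := fun i => C (Fin.ofNat 31 i)
    S := fun i => S (Fin.ofNat 30 (i - 1))
    O := objects D
    joinedC := fun i _ => by rw [add1]; exact joinC _
    joinedC_last := joinC _
    joinedS := fun i h1 h2 => by rw [← succ_eq i h1 h2]; exact joinS _
    disjointC := fun i j h1 h2 h3 => disjCC _ _ (ne_of _ _ (by omega) h2 (by omega))
      (ne_of' _ _ (by omega) (by omega) h2 (by omega)).symm (by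
        rcases Nat.eq_zero_or_pos i with rfl | hi
        · rw [← add1]; exact ne_of _ _ (by omega) (by omega) (by omega)
        · exact (ne_of' _ _ h2 hi (by omega) (by omega)).symm)
    disjointSC := fun k i h1 h2 h3 h4 h5 => disjSC _ _
      (by rw [succ_eq k h1 h2]; exact ne_of _ _ h2 h3 h4)
      (by rw [succ_eq k h1 h2]; exact ne_of' _ _ h3 h1 h2 h5)
    interSO := fun k h1 h2 => by rw [← succ_eq k h1 h2]; exact interSO _
    h_notMem_C := fun i _ => hubC _
    h_notMem_O := hubO
    v_notMem_C := fun k i h1 h2 h3 h4 h5 => vC _ _ (ne_of _ _ h2 h3 h4) (ne_of' _ _ h3 h1 h2 h5)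
    v_notMem_S := fun j k h1 h2 h3 h4 h5 => vS _ _
      (by rw [succ_eq k h3 h4]; exact ne_of _ _ h2 h4 h5) }, rfl, fun _ => rfl⟩

end Gadget

namespace Gadget

variable {D : Drawing gadget}

theorem inter_nonempty (hfin : D.CrossSet.Finite) (hc : D.CrossSet.ncard ≤ 96)
    {x y z w : Fin 31} (hi : Interleave x y z w) (hx : x ≠ 0) (hy : y ≠ 0) (hz : z ≠ 0)
    (hw : w ≠ 0) {A B : Set Plane} (hAO : A ⊆ objects D) (hBO : B ⊆ objects D)
    (hA : JoinedIn A (D.vert (.g x)) (D.vert (.g y)))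
    (hB : JoinedIn B (D.vert (.g z)) (D.vert (.g w)))
    (hzA : D.vert (.g z) ∉ A) (hwA : D.vert (.g w) ∉ A)
    (hxB : D.vert (.g x) ∉ B) (hyB : D.vert (.g y) ∉ B) : (A ∩ B).Nonempty := by
  obtain ⟨W, hO, hv⟩ := exists_wheel hfin hc
  have hv' : ∀ i : Fin 31, D.vert (.g i) = W.v i := fun i => by rw [hv]; simp
  have pos : ∀ i : Fin 31, i ≠ 0 → 1 ≤ i.val := fun i h =>
    Nat.one_le_iff_ne_zero.2 fun h' => h (Fin.ext h')
  simp only [hv'] at *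
  rw [← hO] at hAO hBO
  exact W.inter_nonempty hi (pos x hx) (pos y hy) (pos z hz) (pos w hw) (by omega) (by omega)
    (by omega) (by omega) hAO hBO hA hB hzA hwA hxB hyB

theorem legIdx_ne_zero : ∀ t q, legIdx t q ≠ 0 := by decide

theorem rootIdx_ne_zero : ∀ c, rootIdx c ≠ 0 := by decide

theorem chordIdx_ne_zero : ∀ c i, chordIdx c i ≠ 0 := by decide

theorem legIdx_ne_rootIdx : ∀ t q c, legIdx t q ≠ rootIdx c := by decide

theorem legIdx_ne_chordIdx : ∀ t q c i, legIdx t q ≠ chordIdx c i := by decide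

theorem chordIdx_ne_rootIdx : ∀ c i c', chordIdx c i ≠ rootIdx c' := by decide

theorem rootIdx_injective : Function.Injective rootIdx := by
  unfold Function.Injective; decide

theorem chordIdx_injective {c i c' i'} : chordIdx c i = chordIdx c' i' → c = c' ∧ i = i' := by
  revert c i c' i'; decide

theorem legIdx_injective {t q t' q'} : legIdx t q = legIdx t' q' → t = t' ∧ q = q' := by
  revert t q t' q'; decide

/-- The path formed by two legs of a tripod. -/
def twoLegs (D : Drawing gadget) (t : Fin 6) (q q' : Fin 3) : Set Plane :=
  arc D (.leg t q) ∪ arc D (.leg t q')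

theorem twoLegs_subset (t : Fin 6) (q q' : Fin 3) : twoLegs D t q q' ⊆ objects D :=
  union_subset (arc_leg_subset t q) (arc_leg_subset t q')

theorem joinedIn_twoLegs (t : Fin 6) (q q' : Fin 3) :
    JoinedIn (twoLegs D t q q') (D.vert (.g (legIdx t q))) (D.vert (.g (legIdx t q'))) :=
  ((joinedIn_arc D (.leg t q)).symm.mono subset_union_left).trans
    ((joinedIn_arc D (.leg t q')).mono subset_union_right)

theorem eq_of_mem_twoLegs {t : Fin 6} {q q' : Fin 3} {i : Fin 31}
    (h : D.vert (.g i) ∈ twoLegs D t q q') : i = legIdx t q ∨ i = legIdx t q' := by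
  rcases h with h | h <;> have := eq_of_vert_mem_arc D h <;> simp [GEdge.src, GEdge.tgt] at this <;>
    tauto

theorem eq_of_mem_chord {c i : Fin 3} {j : Fin 31}
    (h : D.vert (.g j) ∈ arc D (.chord c i)) : j = rootIdx c ∨ j = chordIdx c i := by
  have := eq_of_vert_mem_arc D h
  simpa [GEdge.src, GEdge.tgt] using this

theorem chord_chord {c i c' i' : Fin 3} (h : c ≠ c') {p : Plane}
    (hp : p ∈ arc D (.chord c i)) (hp' : p ∈ arc D (.chord c' i')) :
    (p, s(gadgetEdges.edge (.chord c i), gadgetEdges.edge (.chord c' i'))) ∈ D.CrossSet := by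
  refine (common_vert_or_mem_crossSet D (by simp [h]) hp hp').resolve_left ?_
  rintro ⟨w, hw, hw', -⟩
  rcases hw with rfl | rfl <;> simp [GEdge.src, GEdge.tgt] at hw'
  · rcases hw' with hw' | hw'
    · exact h (rootIdx_injective hw')
    · exact chordIdx_ne_rootIdx _ _ _ hw'.symm
  · rcases hw' with hw' | hw'
    · exact chordIdx_ne_rootIdx _ _ _ hw'
    · exact h (chordIdx_injective hw').1

theorem chord_leg {c i : Fin 3} {t : Fin 6} {q : Fin 3} {p : Plane}
    (hp : p ∈ arc D (.chord c i)) (hp' : p ∈ arc D (.leg t q)) :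
    (p, s(gadgetEdges.edge (.chord c i), gadgetEdges.edge (.leg t q))) ∈ D.CrossSet := by
  refine (common_vert_or_mem_crossSet D (by simp) hp hp').resolve_left ?_
  rintro ⟨w, hw, hw', -⟩
  rcases hw with rfl | rfl <;> simp [GEdge.src, GEdge.tgt] at hw'
  · exact legIdx_ne_rootIdx _ _ _ hw'.symm
  · exact legIdx_ne_chordIdx _ _ _ _ hw'.symm

theorem leg_leg {t t' : Fin 6} {q q' : Fin 3} (h : t ≠ t') {p : Plane}
    (hp : p ∈ arc D (.leg t q)) (hp' : p ∈ arc D (.leg t' q')) :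
    (p, s(gadgetEdges.edge (.leg t q), gadgetEdges.edge (.leg t' q'))) ∈ D.CrossSet := by
  refine (common_vert_or_mem_crossSet D (by simp [h]) hp hp').resolve_left ?_
  rintro ⟨w, hw, hw', -⟩
  rcases hw with rfl | rfl <;> simp [GEdge.src, GEdge.tgt] at hw'
  · exact h hw'
  · exact h (legIdx_injective hw').1

theorem exists_chord_chord (hfin : D.CrossSet.Finite) (hc : D.CrossSet.ncard ≤ 96)
    {c i c' i' : Fin 3} (h : c ≠ c') : ∃ p, p ∈ arc D (.chord c i) ∧ p ∈ arc D (.chord c' i') := by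
  have hi : ∀ c i c' i', c ≠ c' →
      Interleave (rootIdx c) (chordIdx c i) (rootIdx c') (chordIdx c' i') := by decide
  refine inter_nonempty hfin hc (hi c i c' i' h) (rootIdx_ne_zero _) (chordIdx_ne_zero _ _)
    (rootIdx_ne_zero _) (chordIdx_ne_zero _ _) (arc_chord_subset c i) (arc_chord_subset c' i')
    (joinedIn_arc D (.chord c i)) (joinedIn_arc D (.chord c' i')) ?_ ?_ ?_ ?_ <;>
    intro hm <;> rcases eq_of_mem_chord hm with h1 | h1
  · exact h (rootIdx_injective h1.symm)
  · exact chordIdx_ne_rootIdx _ _ _ h1.symm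
  · exact chordIdx_ne_rootIdx _ _ _ h1
  · exact h (chordIdx_injective h1.symm).1
  · exact h (rootIdx_injective h1)
  · exact chordIdx_ne_rootIdx _ _ _ h1.symm
  · exact chordIdx_ne_rootIdx _ _ _ h1
  · exact h (chordIdx_injective h1).1

theorem exists_chord_twoLegs (hfin : D.CrossSet.Finite) (hc : D.CrossSet.ncard ≤ 96)
    {c i : Fin 3} {t : Fin 6} {q q' : Fin 3}
    (hi : Interleave (rootIdx c) (chordIdx c i) (legIdx t q) (legIdx t q')) :
    ∃ p, p ∈ arc D (.chord c i) ∧ p ∈ twoLegs D t q q' := by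
  refine inter_nonempty hfin hc hi (rootIdx_ne_zero _) (chordIdx_ne_zero _ _)
    (legIdx_ne_zero _ _) (legIdx_ne_zero _ _) (arc_chord_subset c i) (twoLegs_subset t q q')
    (joinedIn_arc D (.chord c i)) (joinedIn_twoLegs t q q') ?_ ?_ ?_ ?_ <;> intro hm
  · rcases eq_of_mem_chord hm with h1 | h1
    exacts [legIdx_ne_rootIdx _ _ _ h1, legIdx_ne_chordIdx _ _ _ _ h1]
  · rcases eq_of_mem_chord hm with h1 | h1
    exacts [legIdx_ne_rootIdx _ _ _ h1, legIdx_ne_chordIdx _ _ _ _ h1]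
  · rcases eq_of_mem_twoLegs hm with h1 | h1
    exacts [legIdx_ne_rootIdx _ _ _ h1.symm, legIdx_ne_rootIdx _ _ _ h1.symm]
  · rcases eq_of_mem_twoLegs hm with h1 | h1
    exacts [legIdx_ne_chordIdx _ _ _ _ h1.symm, legIdx_ne_chordIdx _ _ _ _ h1.symm]

theorem exists_twoLegs_twoLegs (hfin : D.CrossSet.Finite) (hc : D.CrossSet.ncard ≤ 96)
    {t t' : Fin 6} {q r q' r' : Fin 3} (h : t ≠ t')
    (hi : Interleave (legIdx t q) (legIdx t r) (legIdx t' q') (legIdx t' r')) :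
    ∃ p, p ∈ twoLegs D t q r ∧ p ∈ twoLegs D t' q' r' := by
  refine inter_nonempty hfin hc hi (legIdx_ne_zero _ _) (legIdx_ne_zero _ _)
    (legIdx_ne_zero _ _) (legIdx_ne_zero _ _) (twoLegs_subset t q r) (twoLegs_subset t' q' r')
    (joinedIn_twoLegs t q r) (joinedIn_twoLegs t' q' r') ?_ ?_ ?_ ?_ <;> intro hm <;>
    rcases eq_of_mem_twoLegs hm with h1 | h1
  · exact h (legIdx_injective h1).1.symm
  · exact h (legIdx_injective h1).1.symm
  · exact h (legIdx_injective h1).1.symm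
  · exact h (legIdx_injective h1).1.symm
  · exact h (legIdx_injective h1).1
  · exact h (legIdx_injective h1).1
  · exact h (legIdx_injective h1).1
  · exact h (legIdx_injective h1).1

/-- The chord or tripod to which an edge of the gadget belongs. -/
inductive Obj
  | chord (c i : Fin 3)
  | tripod (t : Fin 6)
  | frame
  deriving DecidableEq

/-- The object to which an edge belongs. -/
def obj : GEdge → Obj
  | .chord c i => .chord c i
  | .leg t _ => .tripod t
  | _ => .frame

/-- The pair of objects of a crossing. -/
def label (x : Plane × Sym2 gadget.edgeSet) : Sym2 Obj :=
  x.2.map fun e => obj (gadgetEdges.edge.symm e)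

@[simp]
theorem label_mk (p : Plane) (e f : GEdge) :
    label (p, s(gadgetEdges.edge e, gadgetEdges.edge f)) = s(obj e, obj f) := by
  simp [label]

/-- The object with a given number. -/
def objOf (n : Fin 15) : Obj :=
  if h : n.val < 9 then .chord ⟨n / 3, by omega⟩ ⟨n % 3, by omega⟩ else .tripod ⟨n - 9, by omega⟩

theorem objOf_injective : Function.Injective objOf := by
  unfold Function.Injective; decide

/-- The pairs of objects that have to cross. -/
def required : Finset (Fin 15 × Fin 15) :=
  Finset.univ.filter fun x => x.1 < x.2 ∧ (x.2.val < 9 → x.1.val / 3 ≠ x.2.val / 3)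

set_option maxRecDepth 10000 in
theorem card_required : required.card = 96 := by decide

theorem exists_crossing (hfin : D.CrossSet.Finite) (hc : D.CrossSet.ncard ≤ 96) :
    ∀ r ∈ required, ∃ x ∈ D.CrossSet, label x = s(objOf r.1, objOf r.2) := by
  rintro ⟨a, b⟩ hr
  simp only [required, Finset.mem_filter, Finset.mem_univ, true_and] at hr
  obtain ⟨hab, hr⟩ := hr
  have hab' : a.val < b.val := hab
  have hct : ∀ c i t, ∃ q q', Interleave (rootIdx c) (chordIdx c i) (legIdx t q) (legIdx t q') := by
    decide
  have htt : ∀ t t', t ≠ t' → ∃ q r q' r',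
      Interleave (legIdx t q) (legIdx t r) (legIdx t' q') (legIdx t' r') := by
    decide
  by_cases hb : b.val < 9
  · have ha : a.val < 9 := by omega
    have hne : (⟨a / 3, by omega⟩ : Fin 3) ≠ ⟨b / 3, by omega⟩ := by
      simpa [Fin.ext_iff] using hr hb
    obtain ⟨p, h1, h2⟩ := exists_chord_chord hfin hc
      (i := ⟨a % 3, by omega⟩) (i' := ⟨b % 3, by omega⟩) hne
    exact ⟨_, chord_chord hne h1 h2, by simp [obj, objOf, ha, hb]⟩
  · by_cases ha : a.val < 9
    · obtain ⟨q, q', hi⟩ := hct ⟨a / 3, by omega⟩ ⟨a % 3, by omega⟩ ⟨b - 9, by omega⟩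
      obtain ⟨p, h1, h2⟩ := exists_chord_twoLegs hfin hc hi
      rcases h2 with h2 | h2 <;> exact ⟨_, chord_leg h1 h2, by simp [obj, objOf, ha, hb]⟩
    · have hne : (⟨a - 9, by omega⟩ : Fin 6) ≠ ⟨b - 9, by omega⟩ := by
        simp only [ne_eq, Fin.ext_iff]; omega
      obtain ⟨q, r, q', r', hi⟩ := htt _ _ hne
      obtain ⟨p, h1, h2⟩ := exists_twoLegs_twoLegs hfin hc hne hi
      rcases h1 with h1 | h1 <;> rcases h2 with h2 | h2 <;>
        exact ⟨_, leg_leg hne h1 h2, by simp [obj, objOf, ha, hb]⟩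

theorem crossing_bound (hfin : D.CrossSet.Finite) :
    96 ≤ D.CrossSet.ncard ∧ (D.CrossSet.ncard = 96 → InjOn label D.CrossSet) := by
  rcases Nat.lt_or_ge 96 D.CrossSet.ncard with h | hc
  · exact ⟨h.le, by omega⟩
  have : Nonempty (Plane × Sym2 gadget.edgeSet) :=
    ⟨0, s(gadgetEdges.edge (.chord 0 0), gadgetEdges.edge (.chord 0 0))⟩
  choose! F hF hF' using exists_crossing hfin hc
  have hinj : InjOn F (required : Set (Fin 15 × Fin 15)) := by
    rintro ⟨a, b⟩ hr ⟨a', b'⟩ hr' h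
    have h1 := hF' _ hr
    rw [h, hF' _ hr'] at h1
    simp only [required, Finset.coe_filter, Finset.mem_univ, true_and, mem_ofPred_eq] at hr hr'
    rcases Sym2.eq_iff.1 h1 with ⟨h2, h3⟩ | ⟨h2, h3⟩
    · exact Prod.ext (objOf_injective h2).symm (objOf_injective h3).symm
    · have h4 := objOf_injective h2
      have h5 := objOf_injective h3
      simp only at h4 h5
      omega
  have himg : F '' required ⊆ D.CrossSet := by
    rintro _ ⟨r, hr, rfl⟩
    exact hF r hr
  have hcard : (F '' (required : Set (Fin 15 × Fin 15))).ncard = 96 := by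
    rw [hinj.ncard_image, ncard_coe_finset, card_required]
  refine ⟨hcard ▸ ncard_le_ncard himg hfin, fun h x hx y hy hxy => ?_⟩
  have heq := eq_of_subset_of_ncard_le himg (by omega) hfin
  rw [← heq] at hx hy
  obtain ⟨r, hr, rfl⟩ := hx
  obtain ⟨r', hr', rfl⟩ := hy
  rw [hF' r hr, hF' r' hr'] at hxy
  simp only [required, Finset.coe_filter, Finset.mem_univ, true_and, mem_ofPred_eq] at hr hr'
  rcases Sym2.eq_iff.1 hxy with ⟨h2, h3⟩ | ⟨h2, h3⟩
  · rw [show r = r' from Prod.ext (objOf_injective h2) (objOf_injective h3)]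
  · have h4 := objOf_injective h2
    have h5 := objOf_injective h3
    omega

end Gadget

theorem Drawing.IsRectilinear.arcSet_eq {V : Type*} {G : SimpleGraph V} {D : Drawing G}
    (hD : D.IsRectilinear) {e : G.edgeSet} {x y : V} (h : (e : Sym2 V) = s(x, y)) :
    D.arcSet e = segment ℝ (D.vert x) (D.vert y) := by
  have key : D.arcSet e = segment ℝ (D.arc e 0) (D.arc e 1) := by
    rw [segment_eq_image]
    exact image_congr fun t ht => hD e t ht
  obtain ⟨a, b, hab, h0, h1⟩ := D.arc_ends e
  rw [key, h0, h1]
  rcases Sym2.eq_iff.1 (hab.symm.trans h) with ⟨rfl, rfl⟩ | ⟨rfl, rfl⟩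
  · rfl
  · exact segment_symm _ _ _

/-- Twice the signed area of the triangle `a b p`. -/
def area (a b p : Plane) : ℝ := (b.1 - a.1) * (p.2 - a.2) - (b.2 - a.2) * (p.1 - a.1)

theorem swirl {A B C A' B' C' P Q R : Plane} {l m n u v w : ℝ}
    (hl : 0 < l ∧ l < 1) (hm : 0 < m ∧ m < 1) (hn : 0 < n ∧ n < 1)
    (hu : 0 < u) (hv : 0 < v) (hw : 0 < w)
    (hQ : Q = A + l • (P - A)) (hP : P = B + m • (R - B)) (hR : R = C + n • (Q - C))
    (hA : Q = A + u • (A' - A)) (hB : P = B + v • (B' - B)) (hC : R = C + w • (C' - C))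
    (hΔ : area A B C ≠ 0) :
    0 < area A B C * area C A A' ∧ 0 < area A B C * area A B A' ∧
    0 < area A B C * area A B B' ∧ 0 < area A B C * area B C B' ∧
    0 < area A B C * area B C C' ∧ 0 < area A B C * area C A C' ∧
    (area A B C * area A B A') * (area A B C * area B C B') * (area A B C * area C A C') <
    (area A B C * area C A A') * (area A B C * area A B B') * (area A B C * area B C C') := by
  obtain ⟨hl0, hl1⟩ := hl
  obtain ⟨hm0, hm1⟩ := hm
  obtain ⟨hn0, hn1⟩ := hn
  have hlm : l * m < 1 := by nlinarith
  have hlmn : l * m * n < 1 := by nlinarith [mul_pos hl0 hm0]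
  have hκ : 0 < 1 - l * m * n := by linarith
  simp only [Prod.ext_iff, Prod.fst_add, Prod.snd_add, Prod.smul_fst, Prod.smul_snd, Prod.fst_sub,
    Prod.snd_sub, smul_eq_mul] at hQ hP hR hA hB hC
  obtain ⟨hQ1, hQ2⟩ := hQ
  obtain ⟨hP1, hP2⟩ := hP
  obtain ⟨hR1, hR2⟩ := hR
  obtain ⟨hA1, hA2⟩ := hA
  obtain ⟨hB1, hB2⟩ := hB
  obtain ⟨hC1, hC2⟩ := hC
  set Δ := area A B C with hΔdef
  have a1 : (1 - l * m * n) * u * (A'.1 - A.1) =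
      l * (1 - m) * (B.1 - A.1) + l * m * (1 - n) * (C.1 - A.1) := by
    linear_combination hQ1 + l * hP1 + l * m * hR1 - (1 - l * m * n) * hA1
  have a2 : (1 - l * m * n) * u * (A'.2 - A.2) =
      l * (1 - m) * (B.2 - A.2) + l * m * (1 - n) * (C.2 - A.2) := by
    linear_combination hQ2 + l * hP2 + l * m * hR2 - (1 - l * m * n) * hA2
  have b1 : (1 - l * m * n) * v * (B'.1 - B.1) =
      m * (1 - n) * (C.1 - B.1) + m * n * (1 - l) * (A.1 - B.1) := by
    linear_combination hP1 + m * hR1 + m * n * hQ1 - (1 - l * m * n) * hB1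
  have b2 : (1 - l * m * n) * v * (B'.2 - B.2) =
      m * (1 - n) * (C.2 - B.2) + m * n * (1 - l) * (A.2 - B.2) := by
    linear_combination hP2 + m * hR2 + m * n * hQ2 - (1 - l * m * n) * hB2
  have c1 : (1 - l * m * n) * w * (C'.1 - C.1) =
      n * (1 - l) * (A.1 - C.1) + n * l * (1 - m) * (B.1 - C.1) := by
    linear_combination hR1 + n * hQ1 + n * l * hP1 - (1 - l * m * n) * hC1
  have c2 : (1 - l * m * n) * w * (C'.2 - C.2) =
      n * (1 - l) * (A.2 - C.2) + n * l * (1 - m) * (B.2 - C.2) := by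
    linear_combination hR2 + n * hQ2 + n * l * hP2 - (1 - l * m * n) * hC2
  have ay : area C A A' = l * (1 - m) / ((1 - l * m * n) * u) * Δ := by
    rw [div_mul_eq_mul_div, eq_div_iff (by positivity), hΔdef]
    unfold area
    linear_combination (A.1 - C.1) * a2 - (A.2 - C.2) * a1
  have az : area A B A' = l * m * (1 - n) / ((1 - l * m * n) * u) * Δ := by
    rw [div_mul_eq_mul_div, eq_div_iff (by positivity), hΔdef]
    unfold area
    linear_combination (B.1 - A.1) * a2 - (B.2 - A.2) * a1
  have bz : area A B B' = m * (1 - n) / ((1 - l * m * n) * v) * Δ := by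
    rw [div_mul_eq_mul_div, eq_div_iff (by positivity), hΔdef]
    unfold area
    linear_combination (B.1 - A.1) * b2 - (B.2 - A.2) * b1
  have bx : area B C B' = m * n * (1 - l) / ((1 - l * m * n) * v) * Δ := by
    rw [div_mul_eq_mul_div, eq_div_iff (by positivity), hΔdef]
    unfold area
    linear_combination (C.1 - B.1) * b2 - (C.2 - B.2) * b1
  have cx : area B C C' = n * (1 - l) / ((1 - l * m * n) * w) * Δ := by
    rw [div_mul_eq_mul_div, eq_div_iff (by positivity), hΔdef]
    unfold area
    linear_combination (C.1 - B.1) * c2 - (C.2 - B.2) * c1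
  have cy : area C A C' = n * l * (1 - m) / ((1 - l * m * n) * w) * Δ := by
    rw [div_mul_eq_mul_div, eq_div_iff (by positivity), hΔdef]
    unfold area
    linear_combination (A.1 - C.1) * c2 - (A.2 - C.2) * c1
  have hΔ2 : 0 < Δ * Δ := mul_self_pos.2 hΔ
  have hl' : 0 < 1 - l := by linarith
  have hm' : 0 < 1 - m := by linarith
  have hn' : 0 < 1 - n := by linarith
  have pos : ∀ x, 0 < x → 0 < Δ * (x * Δ) := fun x hx => by
    rw [mul_left_comm]; exact mul_pos hx hΔ2
  rw [ay, az, bz, bx, cx, cy]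
  refine ⟨pos _ (by positivity), pos _ (by positivity), pos _ (by positivity),
    pos _ (by positivity), pos _ (by positivity), pos _ (by positivity), ?_⟩
  have hT : 0 < l * (1 - m) / ((1 - l * m * n) * u) * (m * (1 - n) / ((1 - l * m * n) * v)) *
      (n * (1 - l) / ((1 - l * m * n) * w)) * (Δ * Δ) ^ 3 := by positivity
  have := mul_lt_mul_of_pos_right hlmn hT
  refine lt_of_eq_of_lt ?_ (this.trans_eq ?_) <;> ring

namespace Gadget

variable {D : Drawing gadget}

/-- The chords of the six triangles: the chord of class `c` in the triangle of a tripod. -/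
def tri : Fin 6 → Fin 3 → Fin 3 :=
  ![![0, 0, 0], ![1, 1, 1], ![2, 2, 2], ![0, 1, 2], ![1, 2, 0], ![2, 0, 1]]

/-- The class following a class, in the orientation of a triangle. -/
def nxt (t : Fin 6) (c : Fin 3) : Fin 3 := if t.val < 3 then c + 1 else c + 2

/-- The class preceding a class, in the orientation of a triangle. -/
def prv (t : Fin 6) (c : Fin 3) : Fin 3 := if t.val < 3 then c + 2 else c + 1

theorem prv_nxt : ∀ t c, prv t (nxt t c) = c := by decide

theorem prv_prv : ∀ t c, prv t (prv t c) = nxt t c := by decide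

theorem nxt_ne : ∀ t c, nxt t c ≠ c := by decide

theorem prv_ne : ∀ t c, prv t c ≠ c := by decide

theorem nxt_ne_prv : ∀ t c, nxt t c ≠ prv t c := by decide

theorem chord_leg_unique (hfin : D.CrossSet.Finite) (hc : D.CrossSet.ncard = 96)
    {c i : Fin 3} {t : Fin 6} {q q' : Fin 3} {p p' : Plane}
    (h : p ∈ arc D (.chord c i)) (h' : p' ∈ arc D (.chord c i))
    (hq : p ∈ arc D (.leg t q)) (hq' : p' ∈ arc D (.leg t q')) : p = p' ∧ q = q' := by
  have := (crossing_bound hfin).2 hc (chord_leg h hq) (chord_leg h' hq') (by simp [obj])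
  simpa using this

theorem chord_chord_unique (hfin : D.CrossSet.Finite) (hc : D.CrossSet.ncard = 96)
    {c i c' i' : Fin 3} (hcc : c ≠ c') {p p' : Plane}
    (h : p ∈ arc D (.chord c i)) (h' : p' ∈ arc D (.chord c i))
    (hq : p ∈ arc D (.chord c' i')) (hq' : p' ∈ arc D (.chord c' i')) : p = p' := by
  have := (crossing_bound hfin).2 hc (chord_chord hcc h hq) (chord_chord hcc h' hq') (by simp)
  simpa using this

theorem eq_prv_of_mem (hfin : D.CrossSet.Finite) (hc : D.CrossSet.ncard = 96)
    {t : Fin 6} {c q : Fin 3} {p : Plane}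
    (h : p ∈ arc D (.chord c (tri t c))) (hq : p ∈ arc D (.leg t q)) : q = prv t c := by
  have h1 : ∀ t c, Interleave (rootIdx c) (chordIdx c (tri t c))
    (legIdx t (prv t c)) (legIdx t c) := by decide
  have h2 : ∀ t c, Interleave (rootIdx c) (chordIdx c (tri t c))
    (legIdx t (prv t c)) (legIdx t (nxt t c)) := by decide
  obtain ⟨p1, hp1, hp1'⟩ := exists_chord_twoLegs hfin hc.le (h1 t c)
  obtain ⟨p2, hp2, hp2'⟩ := exists_chord_twoLegs hfin hc.le (h2 t c)
  rcases hp1' with hp1' | hp1'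
  · exact (chord_leg_unique hfin hc h hp1 hq hp1').2
  rcases hp2' with hp2' | hp2'
  · exact (chord_leg_unique hfin hc h hp2 hq hp2').2
  exact absurd (chord_leg_unique hfin hc hp2 hp1 hp2' hp1').2 (nxt_ne t c)

theorem arc_eq_segment (hD : D.IsRectilinear) (e : GEdge) :
    arc D e = segment ℝ (D.vert e.src) (D.vert e.tgt) :=
  hD.arcSet_eq (gadgetEdges_spec e)

theorem segment_subset_arc (hD : D.IsRectilinear) {e : GEdge} {p q : Plane}
    (hp : p ∈ arc D e) (hq : q ∈ arc D e) :
    segment ℝ p q ⊆ arc D e := by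
  rw [arc_eq_segment hD] at *
  exact (convex_segment _ _).segment_subset hp hq

theorem src_mem (e : GEdge) : D.vert e.src ∈ arc D e := (joinedIn_arc D e).source_mem

theorem tgt_mem (e : GEdge) : D.vert e.tgt ∈ arc D e := (joinedIn_arc D e).target_mem

/-- On a side of a triangle, the intersection with the preceding side comes before the
intersection with the following side. -/
theorem order (hfin : D.CrossSet.Finite) (hc : D.CrossSet.ncard = 96)
    (hD : D.IsRectilinear) (t : Fin 6) (c : Fin 3) {P Q : Plane}
    (hP : P ∈ arc D (.chord c (tri t c))) (hP' : P ∈ arc D (.chord (nxt t c) (tri t (nxt t c))))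
    (hQ : Q ∈ arc D (.chord c (tri t c))) (hQ' : Q ∈ arc D (.chord (prv t c) (tri t (prv t c)))) :
    (∃ l : ℝ, (0 < l ∧ l < 1) ∧
      Q = D.vert (.g (rootIdx c)) + l • (P - D.vert (.g (rootIdx c)))) ∧
    ∃ u : ℝ, 0 < u ∧ Q = D.vert (.g (rootIdx c)) +
      u • (D.vert (.g (chordIdx c (tri t c))) - D.vert (.g (rootIdx c))) := by
  set A := D.vert (.g (rootIdx c)) with hA
  set A' := D.vert (.g (chordIdx c (tri t c))) with hA'
  have hAm : A ∈ arc D (.chord c (tri t c)) := src_mem (.chord c _)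
  have hAm' : A' ∈ arc D (.chord c (tri t c)) := tgt_mem (.chord c _)
  have h1 : ∀ t c, Interleave (rootIdx c) (rootIdx (nxt t c))
    (legIdx t (prv t c)) (legIdx t (nxt t c)) := by decide
  have h2 : ∀ t c, Interleave (chordIdx (prv t c) (tri t (prv t c))) (chordIdx c (tri t c))
    (legIdx t (prv t c)) (legIdx t c) := by decide
  have not1 : ∀ i j t q, D.vert (.g (legIdx t q)) ∉ arc D (.chord i j) := fun i j t q h => by
    rcases eq_of_mem_chord h with h | h
    exacts [legIdx_ne_rootIdx _ _ _ h, legIdx_ne_chordIdx _ _ _ _ h]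
  have not2 : ∀ i t q q', D.vert (.g (rootIdx i)) ∉ twoLegs D t q q' := fun i t q q' h => by
    rcases eq_of_mem_twoLegs h with h | h <;> exact legIdx_ne_rootIdx _ _ _ h.symm
  have not3 : ∀ i j t q q', D.vert (.g (chordIdx i j)) ∉ twoLegs D t q q' := fun i j t q q' h => by
    rcases eq_of_mem_twoLegs h with h | h <;> exact legIdx_ne_chordIdx _ _ _ _ h.symm
  have sAP := segment_subset_arc hD hAm hP
  have sPB := segment_subset_arc hD hP' (src_mem (.chord (nxt t c) _))
  have sCQ := segment_subset_arc hD (tgt_mem (.chord (prv t c) _)) hQ'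
  have sQA := segment_subset_arc hD hQ hAm'
  obtain ⟨S, hS1, hS2⟩ := inter_nonempty hfin hc.le (h1 t c) (rootIdx_ne_zero _)
    (rootIdx_ne_zero _) (legIdx_ne_zero _ _) (legIdx_ne_zero _ _)
    (union_subset (sAP.trans (arc_chord_subset _ _)) (sPB.trans (arc_chord_subset _ _)))
    (twoLegs_subset t (prv t c) (nxt t c))
    (((JoinedIn.of_segment_subset subset_rfl).mono subset_union_left).trans
      ((JoinedIn.of_segment_subset subset_rfl).mono subset_union_right))
    (joinedIn_twoLegs t (prv t c) (nxt t c))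
    (fun h => h.elim (fun h => not1 _ _ _ _ (sAP h)) fun h => not1 _ _ _ _ (sPB h))
    (fun h => h.elim (fun h => not1 _ _ _ _ (sAP h)) fun h => not1 _ _ _ _ (sPB h))
    (not2 _ _ _ _) (not2 _ _ _ _)
  obtain ⟨S', hS1', hS2'⟩ := inter_nonempty hfin hc.le (h2 t c) (chordIdx_ne_zero _ _)
    (chordIdx_ne_zero _ _) (legIdx_ne_zero _ _) (legIdx_ne_zero _ _)
    (union_subset (sCQ.trans (arc_chord_subset _ _)) (sQA.trans (arc_chord_subset _ _)))
    (twoLegs_subset t (prv t c) c)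
    (((JoinedIn.of_segment_subset subset_rfl).mono subset_union_left).trans
      ((JoinedIn.of_segment_subset subset_rfl).mono subset_union_right))
    (joinedIn_twoLegs t (prv t c) c)
    (fun h => h.elim (fun h => not1 _ _ _ _ (sCQ h)) fun h => not1 _ _ _ _ (sQA h))
    (fun h => h.elim (fun h => not1 _ _ _ _ (sCQ h)) fun h => not1 _ _ _ _ (sQA h))
    (not3 _ _ _ _ _) (not3 _ _ _ _ _)
  have hS : S ∈ segment ℝ A P ∧ S ∈ arc D (.leg t (prv t c)) := by
    rcases hS1 with hS1 | hS1 <;> rcases hS2 with hS2 | hS2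
    · exact ⟨hS1, hS2⟩
    · exact absurd (eq_prv_of_mem hfin hc (sAP hS1) hS2) (nxt_ne_prv t c)
    · exact absurd (eq_prv_of_mem hfin hc (sPB hS1) hS2) (by rw [prv_nxt]; exact prv_ne t c)
    · exact absurd (eq_prv_of_mem hfin hc (sPB hS1) hS2) (by rw [prv_nxt]; exact nxt_ne t c)
  have hS' : S' ∈ segment ℝ Q A' ∧ S' ∈ arc D (.leg t (prv t c)) := by
    rcases hS1' with hS1' | hS1' <;> rcases hS2' with hS2' | hS2'
    · exact absurd (eq_prv_of_mem hfin hc (sCQ hS1') hS2')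
        (by rw [prv_prv]; exact (nxt_ne_prv t c).symm)
    · exact absurd (eq_prv_of_mem hfin hc (sCQ hS1') hS2')
        (by rw [prv_prv]; exact (nxt_ne t c).symm)
    · exact ⟨hS1', hS2'⟩
    · exact absurd (eq_prv_of_mem hfin hc (sQA hS1') hS2') (prv_ne t c).symm
  obtain ⟨hS1, hS2⟩ := hS
  obtain ⟨hS1', hS2'⟩ := hS'
  obtain rfl := (chord_leg_unique hfin hc (sAP hS1) (sQA hS1') hS2 hS2').1
  have hSP : S ≠ P := by
    rintro rfl
    have := eq_prv_of_mem hfin hc hP' hS2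
    rw [prv_nxt] at this
    exact prv_ne t c this
  have hQA : Q ≠ A := by
    intro h
    rcases eq_of_mem_chord (h ▸ hQ') with h | h
    · exact prv_ne t c (rootIdx_injective h).symm
    · exact chordIdx_ne_rootIdx _ _ _ h.symm
  have hAA : A' - A ≠ 0 := sub_ne_zero.2 fun h => by
    have := D.vert_inj h
    simp only [GVert.g.injEq] at this
    exact chordIdx_ne_rootIdx _ _ _ this
  rw [arc_eq_segment hD] at hP hQ
  simp only [segment_eq_image', mem_image, GEdge.src, GEdge.tgt, ← hA, ← hA'] at hP hQ hS1 hS1'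
  obtain ⟨μ, ⟨hμ0, hμ1⟩, hμ⟩ := hP
  obtain ⟨lam, ⟨hl0, hl1⟩, hl⟩ := hQ
  obtain ⟨σ, ⟨hσ0, hσ1⟩, hσ⟩ := hS1
  obtain ⟨τ, ⟨hτ0, hτ1⟩, hτ⟩ := hS1'
  have hl0' : 0 < lam := lt_of_le_of_ne hl0 fun h => hQA (by rw [← hl, ← h]; simp)
  have hrel : σ * μ = lam + τ * (1 - lam) := by
    have h3 : (σ * μ - (lam + τ * (1 - lam))) • (A' - A) = 0 := by
      have h4 : A + σ • (P - A) = Q + τ • (A' - Q) := hσ.trans hτ.symm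
      have h5 : P = A + μ • (A' - A) := hμ.symm
      have h6 : Q = A + lam • (A' - A) := hl.symm
      rw [h5, h6, ← sub_eq_zero] at h4
      rw [← h4]
      module
    rcases smul_eq_zero.1 h3 with h3 | h3
    · linarith
    · exact absurd h3 hAA
  have hσ1' : σ ≠ 1 := by
    rintro rfl
    exact hSP (by rw [← hσ]; simp)
  have hσ2 : σ < 1 := lt_of_le_of_ne hσ1 hσ1'
  have hμ0' : 0 < μ := lt_of_le_of_ne hμ0 (by rintro rfl; nlinarith)
  have hlt : lam < μ := by nlinarith
  refine ⟨⟨lam / μ, ⟨by positivity, (div_lt_one hμ0').2 hlt⟩, ?_⟩, lam, hl0', hl.symm⟩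
  rw [← hμ, ← hl, add_sub_cancel_left, smul_smul, div_mul_cancel₀ _ hμ0'.ne']

end Gadget

theorem exists_smul_eq_of_cross_eq_zero {a b : Plane} (hb : b ≠ 0)
    (h : a.1 * b.2 - a.2 * b.1 = 0) : ∃ s : ℝ, a = s • b := by
  by_cases h1 : b.1 = 0
  · have h2 : b.2 ≠ 0 := fun h2 => hb (Prod.ext h1 h2)
    refine ⟨a.2 / b.2, Prod.ext ?_ ?_⟩
    · simp only [h1, mul_zero, sub_zero, mul_eq_zero, h2, or_false] at h
      simp [h, h1]
    · simp [h2]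
  · refine ⟨a.1 / b.1, Prod.ext ?_ ?_⟩
    · simp [h1]
    · simp only [Prod.smul_snd, smul_eq_mul]
      field_simp
      linarith

theorem cross_ne_zero {A A' B B' P : Plane} (hP : P ∈ openSegment ℝ A A')
    (hP' : P ∈ openSegment ℝ B B') (hAA : A ≠ A') (hBB : B ≠ B')
    (hu : ∀ p ∈ segment ℝ A A', p ∈ segment ℝ B B' → p = P) :
    (A'.1 - A.1) * (B'.2 - B.2) - (A'.2 - A.2) * (B'.1 - B.1) ≠ 0 := by
  intro h
  obtain ⟨s, hs⟩ := exists_smul_eq_of_cross_eq_zero (a := A' - A) (b := B' - B)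
    (sub_ne_zero.2 hBB.symm) h
  rw [openSegment_eq_image'] at hP hP'
  obtain ⟨μ, ⟨hμ0, hμ1⟩, hμ⟩ := hP
  obtain ⟨ν, ⟨hν0, hν1⟩, hν⟩ := hP'
  obtain ⟨δ, hδ0, hδ1, hδ2, hδ3⟩ : ∃ δ : ℝ, 0 < δ ∧ δ ≤ 1 - μ ∧ δ * |s| ≤ ν ∧ δ * |s| ≤ 1 - ν := by
    refine ⟨min (1 - μ) (min ν (1 - ν) / (1 + |s|)), ?_, min_le_left _ _, ?_, ?_⟩
    · exact lt_min (by linarith) (div_pos (lt_min hν0 (by linarith)) (by positivity))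
    all_goals
      have h1 : min (1 - μ) (min ν (1 - ν) / (1 + |s|)) * |s| ≤ min ν (1 - ν) := by
        refine (mul_le_mul_of_nonneg_right (min_le_right _ _) (abs_nonneg s)).trans ?_
        rw [div_mul_eq_mul_div, div_le_iff₀ (by positivity)]
        have : 0 < min ν (1 - ν) := lt_min hν0 (by linarith)
        nlinarith [abs_nonneg s]
    · exact h1.trans (min_le_left _ _)
    · exact h1.trans (min_le_right _ _)
  have h1 := hu (P + δ • (A' - A))
    (by
      rw [segment_eq_image']
      exact ⟨μ + δ, ⟨by linarith, by linarith⟩, by simp only [← hμ]; module⟩)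
    (by
      rw [segment_eq_image', hs]
      have habs : |δ * s| = δ * |s| := by rw [abs_mul, abs_of_pos hδ0]
      have := abs_le.1 (habs.trans_le hδ2)
      have := abs_le.1 (habs.trans_le hδ3)
      exact ⟨ν + δ * s, ⟨by linarith, by linarith⟩, by simp only [← hν]; module⟩)
  rw [add_eq_left, smul_eq_zero] at h1
  rcases h1 with h1 | h1
  · exact hδ0.ne' h1
  · exact hAA (sub_eq_zero.1 h1).symm

theorem swirl_area_ne_zero {A B C A' B' P Q R : Plane} {l m n u v : ℝ}
    (hl : 0 < l ∧ l < 1) (hm : 0 < m ∧ m < 1) (hn : 0 < n ∧ n < 1)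
    (hu : 0 < u) (hv : 0 < v)
    (hQ : Q = A + l • (P - A)) (hP : P = B + m • (R - B)) (hR : R = C + n • (Q - C))
    (hA : Q = A + u • (A' - A)) (hB : P = B + v • (B' - B))
    (h : (A'.1 - A.1) * (B'.2 - B.2) - (A'.2 - A.2) * (B'.1 - B.1) ≠ 0) :
    area A B C ≠ 0 := by
  obtain ⟨hl0, hl1⟩ := hl
  obtain ⟨hm0, hm1⟩ := hm
  obtain ⟨hn0, hn1⟩ := hn
  have hlm : l * m < 1 := by nlinarith
  have hlmn : l * m * n < 1 := by nlinarith [mul_pos hl0 hm0]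
  have hκ : 0 < 1 - l * m * n := by linarith
  simp only [Prod.ext_iff, Prod.fst_add, Prod.snd_add, Prod.smul_fst, Prod.smul_snd, Prod.fst_sub,
    Prod.snd_sub, smul_eq_mul] at hQ hP hR hA hB
  obtain ⟨hQ1, hQ2⟩ := hQ
  obtain ⟨hP1, hP2⟩ := hP
  obtain ⟨hR1, hR2⟩ := hR
  obtain ⟨hA1, hA2⟩ := hA
  obtain ⟨hB1, hB2⟩ := hB
  have a1 : (1 - l * m * n) * u * (A'.1 - A.1) =
      l * (1 - m) * (B.1 - A.1) + l * m * (1 - n) * (C.1 - A.1) := by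
    linear_combination hQ1 + l * hP1 + l * m * hR1 - (1 - l * m * n) * hA1
  have a2 : (1 - l * m * n) * u * (A'.2 - A.2) =
      l * (1 - m) * (B.2 - A.2) + l * m * (1 - n) * (C.2 - A.2) := by
    linear_combination hQ2 + l * hP2 + l * m * hR2 - (1 - l * m * n) * hA2
  have b1 : (1 - l * m * n) * v * (B'.1 - B.1) =
      m * (1 - n) * (C.1 - B.1) + m * n * (1 - l) * (A.1 - B.1) := by
    linear_combination hP1 + m * hR1 + m * n * hQ1 - (1 - l * m * n) * hB1
  have b2 : (1 - l * m * n) * v * (B'.2 - B.2) =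
      m * (1 - n) * (C.2 - B.2) + m * n * (1 - l) * (A.2 - B.2) := by
    linear_combination hP2 + m * hR2 + m * n * hQ2 - (1 - l * m * n) * hB2
  intro hΔ
  have key : ((1 - l * m * n) * u) * ((1 - l * m * n) * v) *
      ((A'.1 - A.1) * (B'.2 - B.2) - (A'.2 - A.2) * (B'.1 - B.1)) = 0 := by
    have : ((1 - l * m * n) * u * (A'.1 - A.1)) * ((1 - l * m * n) * v * (B'.2 - B.2)) -
      ((1 - l * m * n) * u * (A'.2 - A.2)) * ((1 - l * m * n) * v * (B'.1 - B.1)) = 0 := by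
      rw [a1, a2, b1, b2]
      unfold area at hΔ
      linear_combination (l * (1 - m) * (m * (1 - n)) +
        l * m * (1 - n) * (m * n * (1 - l)) + l * m * (1 - n) * (m * (1 - n))) * hΔ
    linear_combination this
  exact (mul_ne_zero (by positivity) h) key

namespace Gadget

variable {D : Drawing gadget}

theorem nxt_nxt : ∀ t c, nxt t (nxt t c) = prv t c := by decide

theorem nxt_prv : ∀ t c, nxt t (prv t c) = c := by decide

/-- The positions of the roots of the chords. -/
def root (D : Drawing gadget) (c : Fin 3) : Plane := D.vert (.g (rootIdx c))

/-- The positions of the other ends of the chords. -/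
def tip (D : Drawing gadget) (c i : Fin 3) : Plane := D.vert (.g (chordIdx c i))

theorem triangle (hfin : D.CrossSet.Finite) (hc : D.CrossSet.ncard = 96) (hD : D.IsRectilinear)
    (t : Fin 6) {c d e : Fin 3} (hd : d = nxt t c) (he : e = prv t c) :
    let A := root D c
    let B := root D d
    let C := root D e
    let A' := tip D c (tri t c)
    let B' := tip D d (tri t d)
    let C' := tip D e (tri t e)
    area A B C ≠ 0 ∧
    0 < area A B C * area C A A' ∧ 0 < area A B C * area A B A' ∧
    0 < area A B C * area A B B' ∧ 0 < area A B C * area B C B' ∧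
    0 < area A B C * area B C C' ∧ 0 < area A B C * area C A C' ∧
    (area A B C * area A B A') * (area A B C * area B C B') * (area A B C * area C A C') <
    (area A B C * area C A A') * (area A B C * area A B B') * (area A B C * area B C C') := by
  intro A B C A' B' C'
  have hcd : c ≠ d := hd ▸ (nxt_ne t c).symm
  have hce : c ≠ e := he ▸ (prv_ne t c).symm
  have hde : d ≠ e := hd ▸ he ▸ nxt_ne_prv t c
  obtain ⟨P, hP1, hP2⟩ := exists_chord_chord hfin hc.le (i := tri t c) (i' := tri t d) hcd
  obtain ⟨Q, hQ1, hQ2⟩ := exists_chord_chord hfin hc.le (i := tri t c) (i' := tri t e) hce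
  obtain ⟨R, hR1, hR2⟩ := exists_chord_chord hfin hc.le (i := tri t d) (i' := tri t e) hde
  obtain ⟨⟨l, hl, hl'⟩, u, hu, hu'⟩ := order hfin hc hD t c hP1 (hd ▸ hP2) hQ1 (he ▸ hQ2)
  have o2 := @order D hfin hc hD t d R P hR1
  rw [hd, nxt_nxt, prv_nxt, ← he, ← hd] at o2
  obtain ⟨⟨m, hm, hm'⟩, v, hv, hv'⟩ := o2 hR2 hP2 hP1
  have o3 := @order D hfin hc hD t e Q R hQ2
  rw [he, nxt_prv, prv_prv, ← he, ← hd] at o3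
  obtain ⟨⟨n, hn, hn'⟩, w, hw, hw'⟩ := o3 hQ1 hR2 hR1
  have hαP : P ∈ segment ℝ A A' := by
    have := hP1
    rwa [arc_eq_segment hD] at this
  have hβP : P ∈ segment ℝ B B' := by
    have := hP2
    rwa [arc_eq_segment hD] at this
  have ne : ∀ i j k, root D i ≠ tip D j k := fun i j k h => by
    have := D.vert_inj h
    simp only [GVert.g.injEq] at this
    exact chordIdx_ne_rootIdx _ _ _ this.symm
  have notM : ∀ i j k, i ≠ j → root D i ∉ arc D (.chord j k) := fun i j k h hm => by
    rcases eq_of_mem_chord hm with h1 | h1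
    · exact h (rootIdx_injective h1)
    · exact chordIdx_ne_rootIdx _ _ _ h1.symm
  have notM' : ∀ i i' j k, i ≠ j → tip D i i' ∉ arc D (.chord j k) := fun i i' j k h hm => by
    rcases eq_of_mem_chord hm with h1 | h1
    · exact chordIdx_ne_rootIdx _ _ _ h1
    · exact h (chordIdx_injective h1).1
  have hcross := cross_ne_zero (P := P) (A := A) (A' := A') (B := B) (B' := B')
    (mem_openSegment_of_ne_left_right (by rintro rfl; exact notM _ _ _ hcd hP2)
      (by rintro rfl; exact notM' _ _ _ _ hcd hP2) hαP)
    (mem_openSegment_of_ne_left_right (by rintro rfl; exact notM _ _ _ hcd.symm hP1)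
      (by rintro rfl; exact notM' _ _ _ _ hcd.symm hP1) hβP)
    (ne _ _ _) (ne _ _ _) (fun p hp hp' => chord_chord_unique hfin hc hcd
      (by rw [arc_eq_segment hD]; exact hp) hP1 (by rw [arc_eq_segment hD]; exact hp') hP2)
  have hΔ := swirl_area_ne_zero hl hm hn hu hv hl' hm' hn' hu' hv' hcross
  exact ⟨hΔ, swirl hl hm hn hu hv hw hl' hm' hn' hu' hv' hw' hΔ⟩

theorem rectilinear_bound (hD : D.IsRectilinear) (hfin : D.CrossSet.Finite) :
    97 ≤ D.CrossSet.ncard := by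
  rcases (crossing_bound hfin).1.lt_or_eq with h | h
  · exact h
  exfalso
  have hpos : ∀ t : Fin 6, t.val < 3 → _ := fun t ht => triangle hfin h.symm hD t (c := 0) (d := 1)
    (e := 2) (by simp [nxt, ht]) (by simp [prv, ht])
  have hneg : ∀ t : Fin 6, ¬ t.val < 3 → _ := fun t ht =>
    triangle hfin h.symm hD t (c := 0) (d := 2)
    (e := 1) (by simp [nxt, ht]) (by simp [prv, ht])
  have flip : ∀ a b p, area b a p = - area a b p := fun a b p => by unfold area; ring
  have flip' : area (root D 0) (root D 2) (root D 1) =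
    - area (root D 0) (root D 1) (root D 2) := by unfold area; ring
  simp only [flip', flip (root D 2) (root D 0), flip (root D 1) (root D 2),
    flip (root D 0) (root D 1), neg_mul_neg] at hneg
  set Δ := area (root D 0) (root D 1) (root D 2)
  have p0 := hpos 0 (by decide)
  have p1 := hpos 1 (by decide)
  have p2 := hpos 2 (by decide)
  have n0 := (hneg 3 (by decide)).2.2.2.2.2.2.2
  have n1 := (hneg 4 (by decide)).2.2.2.2.2.2.2
  have n2 := (hneg 5 (by decide)).2.2.2.2.2.2.2
  simp only [show tri 0 = ![0, 0, 0] from rfl, show tri 1 = ![1, 1, 1] from rfl,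
    show tri 2 = ![2, 2, 2] from rfl, show tri 3 = ![0, 1, 2] from rfl,
    show tri 4 = ![1, 2, 0] from rfl, show tri 5 = ![2, 0, 1] from rfl,
    Matrix.cons_val_zero, Matrix.cons_val_one, Matrix.cons_val] at p0 p1 p2 n0 n1 n2
  obtain ⟨-, a0, a1, a2, a3, a4, a5, a6⟩ := p0
  obtain ⟨-, b0, b1, b2, b3, b4, b5, b6⟩ := p1
  obtain ⟨-, c0, c1, c2, c3, c4, c5, c6⟩ := p2
  have hp := mul_lt_mul'' (mul_lt_mul'' a6 b6 (by positivity) (by positivity)) c6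
    (by positivity) (by positivity)
  have hn := mul_lt_mul'' (mul_lt_mul'' n0 n1 (by positivity) (by positivity)) n2
    (by positivity) (by positivity)
  refine lt_irrefl _ (hp.trans ?_)
  refine lt_of_eq_of_lt ?_ (hn.trans_eq ?_) <;> ring

end Gadget

/-- The point of the projective plane with given homogeneous coordinates. -/
def toRP2 (v : {v : Fin 3 → ℝ // v ≠ 0}) : RP2 := Quotient.mk projSetoid v

theorem toRP2_eq {v w : {v : Fin 3 → ℝ // v ≠ 0}} :
    toRP2 v = toRP2 w ↔ ∃ k : ℝ, k ≠ 0 ∧ k • v.1 = w.1 :=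
  ⟨fun h => Quotient.exact h, fun h => Quotient.sound h⟩

theorem continuous_toRP2 : Continuous toRP2 := continuous_quotient_mk'

theorem toRP2_surjective : Function.Surjective toRP2 := Quotient.mk_surjective

/-- The locus `y = c (x, z)` in the projective plane, for a homogeneous function `c`. -/
def homLocus (c : ℝ → ℝ → ℝ) : Set RP2 :=
  { p | ∃ (v : {v : Fin 3 → ℝ // v ≠ 0}), p = toRP2 v ∧
      v.1 1 = c (v.1 0) (v.1 2) }

theorem mk_mem_homLocus {c : ℝ → ℝ → ℝ}
    (hc : ∀ k x z, c (k * x) (k * z) = k * c x z)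
    {v : {v : Fin 3 → ℝ // v ≠ 0}} :
    toRP2 v ∈ homLocus c ↔ v.1 1 = c (v.1 0) (v.1 2) := by
  refine ⟨?_, fun h => ⟨v, rfl, h⟩⟩
  rintro ⟨w, hw, h⟩
  obtain ⟨k, hk, hkw⟩ := toRP2_eq.1 hw
  rw [← hkw] at h
  simp only [Pi.smul_apply, smul_eq_mul, hc] at h
  exact mul_left_cancel₀ hk h

theorem planeToRP2_mem_homLocus {c : ℝ → ℝ → ℝ}
    (hc : ∀ k x z, c (k * x) (k * z) = k * c x z)
    {p : Plane} : planeToRP2 p ∈ homLocus c ↔ p.2 = c p.1 1 := by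
  change toRP2 _ ∈ _ ↔ _
  rw [mk_mem_homLocus hc]
  simp

theorem isPseudoline_homLocus {c : ℝ → ℝ → ℝ}
    (hc : ∀ k x z, c (k * x) (k * z) = k * c x z)
    (hcont : Continuous fun p : ℝ × ℝ => c p.1 p.2) :
    IsPseudoline (homLocus c) := by
  have hc0 : c 0 0 = 0 := by simpa using hc 0 0 0
  let g : ℝ → {v : Fin 3 → ℝ // v ≠ 0} := fun θ =>
    ⟨![Real.cos (Real.pi * θ), c (Real.cos (Real.pi * θ)) (Real.sin (Real.pi * θ)),
      Real.sin (Real.pi * θ)], fun h => by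
        have h0 := congrFun h 0
        have h2 := congrFun h 2
        simp at h0 h2
        have := Real.sin_sq_add_cos_sq (Real.pi * θ)
        rw [h0, h2] at this
        norm_num at this⟩
  have hg : Continuous g := by
    refine Continuous.subtype_mk (continuous_pi fun i => ?_) _
    fin_cases i
    · simp only [Fin.zero_eta, Matrix.cons_val_zero]; fun_prop
    · exact hcont.comp (f := fun θ : ℝ => (Real.cos (Real.pi * θ), Real.sin (Real.pi * θ)))
        (by fun_prop)
    · simp only [Fin.reduceFinMk, Matrix.cons_val]; fun_prop
  have hper : Function.Periodic (fun θ => toRP2 (g θ)) 1 := by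
    intro θ
    refine toRP2_eq.2 ⟨-1, by norm_num, ?_⟩
    ext i
    fin_cases i
    · simp [g, mul_add, Real.cos_add_pi]
    · have := hc (-1) (Real.cos (Real.pi * θ)) (Real.sin (Real.pi * θ))
      simp [g, mul_add, Real.cos_add_pi, Real.sin_add_pi] at this ⊢
      linarith
    · simp [g, mul_add, Real.sin_add_pi]
  refine ⟨hper.lift, ?_, ?_, ?_, ?_⟩
  · exact continuous_coinduced_dom.2 (continuous_toRP2.comp hg)
  · intro a b hab
    induction a using QuotientAddGroup.induction_on with | _ a
    induction b using QuotientAddGroup.induction_on with | _ b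
    rw [hper.lift_coe, hper.lift_coe] at hab
    obtain ⟨k, hk, hkw⟩ := toRP2_eq.1 hab
    have h0 := congrFun hkw 0
    have h2 := congrFun hkw 2
    simp [g] at h0 h2
    have hs : Real.sin (Real.pi * a - Real.pi * b) = 0 := by
      rw [Real.sin_sub, ← h0, ← h2]; ring
    obtain ⟨n, hn⟩ := Real.sin_eq_zero_iff.1 hs
    have hn' : (n : ℝ) = a - b := by
      have : Real.pi * n = Real.pi * (a - b) := by linarith
      exact mul_left_cancel₀ Real.pi_ne_zero this
    rw [QuotientAddGroup.eq, AddSubgroup.mem_zmultiples_iff]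
    exact ⟨-n, by simp [hn']; ring⟩
  · ext p
    constructor
    · rintro ⟨a, rfl⟩
      induction a using QuotientAddGroup.induction_on with | _ a
      rw [hper.lift_coe, mk_mem_homLocus hc]
      simp [g]
    · rintro ⟨v, rfl, hv⟩
      have hne : (⟨v.1 0, v.1 2⟩ : ℂ) ≠ 0 := by
        intro h
        rw [Complex.ext_iff] at h
        simp at h
        rw [h.1, h.2, hc0] at hv
        exact v.2 (by ext i; fin_cases i <;> simp [h, hv])
      set w : ℂ := ⟨v.1 0, v.1 2⟩ with hw
      have hpos : ‖w‖ ≠ 0 := norm_ne_zero_iff.2 hne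
      refine ⟨((Complex.arg w / Real.pi : ℝ) : AddCircle (1 : ℝ)), ?_⟩
      rw [hper.lift_coe]
      refine toRP2_eq.2 ⟨‖w‖, hpos, ?_⟩
      have hπ : Real.pi * (w.arg / Real.pi) = w.arg := by field_simp
      have h1 : ‖w‖ * Real.cos w.arg = v.1 0 := Complex.norm_mul_cos_arg w
      have h2 : ‖w‖ * Real.sin w.arg = v.1 2 := Complex.norm_mul_sin_arg w
      ext i
      fin_cases i
      · simpa [g, hπ] using h1
      · simp only [g, hπ]
        change ‖w‖ * c _ _ = v.1 1
        rw [← hc, h1, h2, hv]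
      · simpa [g, hπ] using h2
  · let q : ℝ × ℝ × Ioi (0:ℝ) → {v : Fin 3 → ℝ // v ≠ 0} := fun p =>
      ⟨![p.1, c p.1 p.2.1 + p.2.2, p.2.1], fun h => by
        have h0 := congrFun h 0
        have h1 := congrFun h 1
        have h2 := congrFun h 2
        simp at h0 h1 h2
        rw [h0, h2, hc0] at h1
        have := mem_Ioi.1 p.2.2.2
        linarith⟩
    have hq : Continuous q := by
      refine Continuous.subtype_mk (continuous_pi fun i => ?_) _
      fin_cases i
      · simp only [Fin.zero_eta, Matrix.cons_val_zero]; fun_prop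
      · have := hcont.comp (f := fun p : ℝ × ℝ × Ioi (0:ℝ) => (p.1, p.2.1)) (by fun_prop)
        exact this.add (by fun_prop)
      · simp only [Fin.reduceFinMk, Matrix.cons_val]; fun_prop
    have hconn : ConnectedSpace (ℝ × ℝ × Ioi (0:ℝ)) := by
      have : ConnectedSpace (Ioi (0:ℝ)) := isConnected_iff_connectedSpace.1 isConnected_Ioi
      infer_instance
    have : (homLocus c)ᶜ = range (toRP2 ∘ q) := by
      ext p
      constructor
      · intro hp
        obtain ⟨v, rfl⟩ := toRP2_surjective p
        rw [mem_compl_iff, mk_mem_homLocus hc] at hp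
        rcases lt_or_gt_of_ne hp with h | h
        · refine ⟨(-v.1 0, -v.1 2, ⟨c (v.1 0) (v.1 2) - v.1 1, by simpa using h⟩),
            toRP2_eq.2 ⟨-1, by norm_num, ?_⟩⟩
          have := hc (-1) (v.1 0) (v.1 2)
          ext i
          fin_cases i
          · simp [q]
          · simp [q] at this ⊢
            linarith
          · simp [q]
        · refine ⟨(v.1 0, v.1 2, ⟨v.1 1 - c (v.1 0) (v.1 2), by simpa using h⟩),
            toRP2_eq.2 ⟨1, by norm_num, ?_⟩⟩
          ext i
          fin_cases i <;> simp [q]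
      · rintro ⟨p, rfl⟩
        rw [mem_compl_iff, Function.comp_apply, mk_mem_homLocus hc]
        have := mem_Ioi.1 p.2.2.2
        simp only [q, Matrix.cons_val]
        linarith
    rw [this]
    exact isConnected_range (continuous_toRP2.comp hq)

theorem existsUnique_mem_homLocus {c c' : ℝ → ℝ → ℝ}
    (hc : ∀ k x z, c (k * x) (k * z) = k * c x z)
    (hc' : ∀ k x z, c' (k * x) (k * z) = k * c' x z)
    {x₀ z₀ : ℝ} (h0 : (x₀, z₀) ≠ 0) (h : c x₀ z₀ = c' x₀ z₀)
    (hu : ∀ x z, c x z = c' x z → ∃ k, x = k * x₀ ∧ z = k * z₀) :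
    ∃! p, p ∈ homLocus c ∧ p ∈ homLocus c' := by
  have hv0 : ![x₀, c x₀ z₀, z₀] ≠ 0 := fun h => h0 (by
    have h1 := congrFun h 0
    have h2 := congrFun h 2
    simp at h1 h2
    simp [h1, h2])
  refine ⟨toRP2 ⟨_, hv0⟩, ⟨?_, ?_⟩, ?_⟩
  · rw [mk_mem_homLocus hc]; simp
  · rw [mk_mem_homLocus hc']; simpa using h
  · rintro p ⟨hp, hp'⟩
    obtain ⟨v, rfl⟩ := toRP2_surjective p
    rw [mk_mem_homLocus hc] at hp
    rw [mk_mem_homLocus hc'] at hp'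
    obtain ⟨k, hk1, hk2⟩ := hu _ _ (hp.symm.trans hp')
    have hv : v.1 = k • ![x₀, c x₀ z₀, z₀] := by
      ext i
      fin_cases i
      · simpa using hk1
      · simp [hp, hk1, hk2, hc]
      · simpa using hk2
    have hk : k ≠ 0 := by
      rintro rfl
      exact v.2 (by rw [hv, zero_smul])
    exact toRP2_eq.2 ⟨k⁻¹, inv_ne_zero hk, by rw [hv, smul_smul, inv_mul_cancel₀ hk, one_smul]⟩

/-- The homogeneous form of a tent of height `2277` and slope `33` centred at `-272`. -/
def tentHom (x z : ℝ) : ℝ :=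
  2277 * z - (abs (2277 * z + |33 * (x + 272 * z)|) - abs (2277 * z - |33 * (x + 272 * z)|)) / 2

theorem tentHom_mul (k x z : ℝ) : tentHom (k * x) (k * z) = k * tentHom x z := by
  have h1 : 33 * (k * x + 272 * (k * z)) = k * (33 * (x + 272 * z)) := by ring
  rw [tentHom, tentHom, h1, abs_mul k]
  generalize |33 * (x + 272 * z)| = A
  rcases le_total 0 k with hk | hk
  · have h2 : 2277 * (k * z) + k * A = k * (2277 * z + A) := by ring
    have h3 : 2277 * (k * z) - k * A = k * (2277 * z - A) := by ring
    rw [abs_of_nonneg hk, h2, h3, abs_mul k, abs_mul k, abs_of_nonneg hk]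
    ring
  · have h2 : 2277 * (k * z) + -k * A = k * (2277 * z - A) := by ring
    have h3 : 2277 * (k * z) - -k * A = k * (2277 * z + A) := by ring
    rw [abs_of_nonpos hk, h2, h3, abs_mul k, abs_mul k, abs_of_nonpos hk]
    ring

theorem tentHom_zero (x : ℝ) : tentHom x 0 = 0 := by simp [tentHom]

theorem continuous_tentHom : Continuous fun p : ℝ × ℝ => tentHom p.1 p.2 := by
  unfold tentHom; fun_prop

theorem tentHom_one (x : ℝ) : tentHom x 1 = max 0 (2277 - 33 * |x + 272|) := by
  have h : |33 * (x + 272 * 1)| = 33 * |x + 272| := by rw [abs_mul]; norm_num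
  have := abs_nonneg (x + 272)
  rw [tentHom, h]
  generalize |x + 272| = A at *
  rw [abs_of_nonneg (by linarith : (0:ℝ) ≤ 2277 * 1 + 33 * A)]
  rcases le_total (33 * A) 2277 with h1 | h1
  · rw [abs_of_nonneg (by linarith), max_eq_right (by linarith)]; ring
  · rw [abs_of_nonpos (by linarith), max_eq_left (by linarith)]; ring

theorem abs_tentHom_sub_le (x y : ℝ) : |tentHom x 1 - tentHom y 1| ≤ 33 * |x - y| := by
  rw [tentHom_one, tentHom_one, max_comm 0, max_comm 0]
  refine (abs_max_sub_max_le_abs _ _ _).trans ?_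
  have h := abs_abs_sub_abs_le_abs_sub (y + 272) (x + 272)
  have : 2277 - 33 * |x + 272| - (2277 - 33 * |y + 272|) = 33 * (|y + 272| - |x + 272|) := by ring
  rw [this, abs_mul, abs_of_nonneg (by norm_num : (0:ℝ) ≤ 33), abs_sub_comm x y]
  refine mul_le_mul_of_nonneg_left (h.trans_eq ?_) (by norm_num)
  congr 1; ring

/-- Two kinds of curves: lines, and vertical translates of the graph of the tent. -/
inductive Curve
  | line (s t : ℝ)
  | bump (t : ℝ)

namespace Curve

/-- The homogeneous function defining a curve. -/
def hom : Curve → ℝ → ℝ → ℝ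
  | line s t, x, z => s * x + t * z
  | bump t, x, z => t * z + tentHom x z

/-- The function whose graph is the curve. -/
def toFun (c : Curve) (x : ℝ) : ℝ := c.hom x 1

/-- A line is steep if its slope exceeds those of the tent; tents are always admitted. -/
def Steep : Curve → Prop
  | line s _ => 33 < |s|
  | bump _ => True

/-- Vertical translation of a curve. -/
def shift (τ : ℝ) : Curve → Curve
  | line s t => line s (t + τ)
  | bump t => bump (t + τ)

@[simp] theorem toFun_line (s t x : ℝ) : (line s t).toFun x = s * x + t := by simp [toFun, hom]

@[simp] theorem toFun_bump (t x : ℝ) : (bump t).toFun x = t + tentHom x 1 := by simp [toFun, hom]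

@[simp] theorem toFun_shift (τ : ℝ) (c : Curve) (x : ℝ) :
    (c.shift τ).toFun x = c.toFun x + τ := by
  cases c <;> simp [shift] <;> ring

@[simp] theorem steep_shift (τ : ℝ) (c : Curve) : (c.shift τ).Steep ↔ c.Steep := by
  cases c <;> rfl

theorem shift_injective (τ : ℝ) : Function.Injective (shift τ) := by
  intro c c' h
  cases c <;> cases c' <;> simp_all [shift]

theorem hom_mul (c : Curve) (k x z : ℝ) : c.hom (k * x) (k * z) = k * c.hom x z := by
  cases c
  · simp only [hom]; ring
  · simp only [hom, tentHom_mul]; ring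

theorem continuous_hom (c : Curve) : Continuous fun p : ℝ × ℝ => c.hom p.1 p.2 := by
  cases c
  · simp only [hom]; fun_prop
  · have := continuous_tentHom
    simp only [hom]; fun_prop

theorem continuous_toFun (c : Curve) : Continuous c.toFun :=
  c.continuous_hom.comp (f := fun x : ℝ => (x, (1 : ℝ))) (by fun_prop)

theorem hom_eq_toFun (c : Curve) {x z : ℝ} (hz : z ≠ 0) : c.hom x z = z * c.toFun (x / z) := by
  rw [toFun, ← hom_mul, mul_div_cancel₀ _ hz, mul_one]

/-- The asymptotic slope of a curve. -/
def slope : Curve → ℝ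
  | line s _ => s
  | bump _ => 0

theorem hom_zero (c : Curve) (x : ℝ) : c.hom x 0 = c.slope * x := by
  cases c <;> simp [hom, slope, tentHom_zero]

/-- Distinct steep curves differ by a nonzero constant, or else they have different slopes and
their difference is a strictly monotone bijection of the line. -/
theorem sub_cases {c c' : Curve} (h : c.Steep) (h' : c'.Steep) (hne : c ≠ c') :
    (c.slope = c'.slope ∧ ∃ k ≠ 0, ∀ x, c.toFun x - c'.toFun x = k) ∨
    (c.slope ≠ c'.slope ∧ Function.Surjective (fun x => c.toFun x - c'.toFun x) ∧
      (StrictMono (fun x => c.toFun x - c'.toFun x) ∨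
        StrictAnti (fun x => c.toFun x - c'.toFun x))) := by
  have affine : ∀ s t : ℝ, s ≠ 0 → ∀ f : ℝ → ℝ, (∀ x, f x = s * x + t) →
      Function.Surjective f ∧ (StrictMono f ∨ StrictAnti f) := by
    intro s t hs f hf
    refine ⟨fun y => ⟨(y - t) / s, by rw [hf]; field_simp; ring⟩, ?_⟩
    rcases lt_or_gt_of_ne hs with h1 | h1
    · exact Or.inr fun x y hxy => by rw [hf, hf]; nlinarith
    · exact Or.inl fun x y hxy => by rw [hf, hf]; nlinarith
  have tent_bd : ∀ x, 0 ≤ tentHom x 1 ∧ tentHom x 1 ≤ 2277 := fun x => by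
    rw [tentHom_one]
    exact ⟨le_max_left _ _, max_le (by norm_num) (by have := abs_nonneg (x + 272); linarith)⟩
  have mixed : ∀ s t : ℝ, 33 < |s| → ∀ f : ℝ → ℝ, Continuous f →
      ((∀ x, f x = s * x + t - tentHom x 1)) →
      Function.Surjective f ∧ (StrictMono f ∨ StrictAnti f) := by
    intro s t hs f hcont hf
    have hlip : ∀ x y, x < y → |tentHom y 1 - tentHom x 1| ≤ 33 * (y - x) := fun x y hxy => by
      have := abs_tentHom_sub_le y x
      rwa [abs_of_pos (sub_pos.2 hxy)] at this
    have hs0 : s ≠ 0 := fun h => by norm_num [h] at hs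
    constructor
    · intro y
      have key : ∀ a b, f a ≤ y → y ≤ f b → ∃ x, f x = y := fun a b ha hb =>
        mem_range_of_exists_le_of_exists_ge hcont ⟨a, ha⟩ ⟨b, hb⟩
      refine key ((y - t) / s) ((y - t + 2277) / s) ?_ ?_
      · rw [hf, mul_div_cancel₀ _ hs0]; linarith [(tent_bd ((y - t) / s)).1]
      · rw [hf, mul_div_cancel₀ _ hs0]; linarith [(tent_bd ((y - t + 2277) / s)).2]
    · rcases lt_abs.1 hs with h1 | h1
      · refine Or.inl fun x y hxy => ?_
        rw [hf, hf]
        have := (abs_le.1 (hlip x y hxy)).2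
        nlinarith
      · refine Or.inr fun x y hxy => ?_
        rw [hf, hf]
        have := (abs_le.1 (hlip x y hxy)).1
        nlinarith
  rcases c with ⟨s, t⟩ | t <;> rcases c' with ⟨s', t'⟩ | t'
  · rcases eq_or_ne s s' with rfl | hs
    · refine Or.inl ⟨rfl, t - t', sub_ne_zero.2 fun h => hne (by rw [h]), fun x => ?_⟩
      simp
    · exact Or.inr ⟨hs, affine (s - s') (t - t') (sub_ne_zero.2 hs) _ fun x => by
        simp only [toFun_line]; ring⟩
  · refine Or.inr ⟨fun h0 => ?_, mixed s (t - t') h _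
      ((continuous_toFun _).sub (continuous_toFun _)) fun x => by
        simp only [toFun_line, toFun_bump]; ring⟩
    simp only [slope] at h0
    simp only [Steep, h0] at h
    norm_num at h
  · have hs : 33 < |-s'| := by simpa [Steep] using h'
    refine Or.inr ⟨fun h0 => ?_, ?_⟩
    · simp only [slope] at h0
      rw [← h0] at hs
      norm_num at hs
    · obtain ⟨h1, h2⟩ := mixed s' (t' - t) h' (fun x => (line s' t').toFun x - (bump t).toFun x)
        ((continuous_toFun _).sub (continuous_toFun _)) fun x => by
        simp only [toFun_line, toFun_bump]; ring
      have hneg : (fun x => (bump t).toFun x - (line s' t').toFun x) =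
        fun x => -((line s' t').toFun x - (bump t).toFun x) := by ext; ring
      rw [hneg]
      exact ⟨neg_surjective.comp h1, h2.symm.imp StrictAnti.neg StrictMono.neg⟩
  · refine Or.inl ⟨rfl, t - t', sub_ne_zero.2 fun h => hne (by rw [h]), fun x => ?_⟩
    simp

theorem existsUnique_mem {c c' : Curve} (h : c.Steep) (h' : c'.Steep) (hne : c ≠ c') :
    ∃! p, p ∈ homLocus c.hom ∧ p ∈ homLocus c'.hom := by
  rcases sub_cases h h' hne with ⟨hs, k, hk, hD⟩ | ⟨hs, hsurj, hmono⟩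
  · refine existsUnique_mem_homLocus c.hom_mul c'.hom_mul (x₀ := 1) (z₀ := 0) (by simp)
      (by rw [hom_zero, hom_zero, hs]) fun x z hxz => ⟨x, by simp, ?_⟩
    by_contra hz
    rw [mul_zero] at hz
    rw [hom_eq_toFun _ hz, hom_eq_toFun _ hz] at hxz
    have := mul_left_cancel₀ hz hxz
    exact hk (by rw [← hD (x / z), this, sub_self])
  · obtain ⟨x₀, hx₀⟩ := hsurj 0
    have hx₀' := sub_eq_zero.1 hx₀
    refine existsUnique_mem_homLocus c.hom_mul c'.hom_mul (x₀ := x₀) (z₀ := 1) (by simp)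
      hx₀' fun x z hxz => ?_
    rcases eq_or_ne z 0 with rfl | hz
    · rw [hom_zero, hom_zero] at hxz
      have hx : x = 0 := by
        by_contra hx
        exact hs (mul_right_cancel₀ hx hxz)
      exact ⟨0, by simp [hx], by simp⟩
    · rw [hom_eq_toFun _ hz, hom_eq_toFun _ hz] at hxz
      have := mul_left_cancel₀ hz hxz
      have hinj : Function.Injective (fun x => c.toFun x - c'.toFun x) :=
        hmono.elim StrictMono.injective StrictAnti.injective
      have h1 : x / z = x₀ := hinj (by simp only [this, sub_self]; exact hx₀.symm)
      exact ⟨z, by rw [← h1, mul_div_cancel₀ _ hz], by simp⟩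

theorem eq_of_toFun_eq {c c' : Curve} (h : c.Steep) (h' : c'.Steep) (hne : c ≠ c') {x y : ℝ}
    (hx : c.toFun x = c'.toFun x) (hy : c.toFun y = c'.toFun y) : x = y := by
  rcases sub_cases h h' hne with ⟨-, k, hk, hD⟩ | ⟨-, -, hmono⟩
  · exact absurd ((hD x).symm.trans (sub_eq_zero.2 hx)) hk
  · exact hmono.elim StrictMono.injective StrictAnti.injective
      ((sub_eq_zero.2 hx).trans (sub_eq_zero.2 hy).symm)

theorem toFun_ne_of_mul_nonneg {c c' : Curve} (h : c.Steep) (h' : c'.Steep) (hne : c ≠ c')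
    {l r x : ℝ} (hx : x ∈ Ioo l r)
    (hD : 0 ≤ (c.toFun l - c'.toFun l) * (c.toFun r - c'.toFun r)) :
    c.toFun x ≠ c'.toFun x := by
  intro hxx
  have h0 := sub_eq_zero.2 hxx
  rcases sub_cases h h' hne with ⟨-, k, hk, hD'⟩ | ⟨-, -, hmono | hmono⟩
  · exact hk ((hD' x).symm.trans h0)
  · have h1 := hmono hx.1
    have h2 := hmono hx.2
    simp only [h0] at h1 h2
    nlinarith
  · have h1 := hmono hx.1
    have h2 := hmono hx.2
    simp only [h0] at h1 h2
    nlinarith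

end Curve

/-- The open interval between two reals in any order. -/
def openBetween (a b : ℝ) : Set ℝ := Ioo (min a b) (max a b)

theorem openBetween_eq_image {a b : ℝ} (h : a ≠ b) :
    openBetween a b = (fun t => (1 - t) * a + t * b) '' Ioo 0 1 := by
  ext x
  simp only [openBetween, mem_Ioo, mem_image]
  have h0 : b - a ≠ 0 := sub_ne_zero.2 h.symm
  constructor
  · intro hx
    refine ⟨(x - a) / (b - a), ?_, by field_simp; ring⟩
    rcases lt_or_gt_of_ne h with h1 | h1
    · rw [min_eq_left h1.le, max_eq_right h1.le] at hx
      exact ⟨div_pos (by linarith) (by linarith), (div_lt_one (by linarith)).2 (by linarith)⟩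
    · rw [min_eq_right h1.le, max_eq_left h1.le] at hx
      exact ⟨div_pos_of_neg_of_neg (by linarith) (by linarith),
        (div_lt_one_of_neg (by linarith)).2 (by linarith)⟩
  · rintro ⟨t, ⟨ht0, ht1⟩, rfl⟩
    rcases lt_or_gt_of_ne h with h1 | h1
    · rw [min_eq_left h1.le, max_eq_right h1.le]
      constructor <;> nlinarith
    · rw [min_eq_right h1.le, max_eq_left h1.le]
      constructor <;> nlinarith

/-- A drawing each of whose edges is an arc of a steep curve, with distinct curves for distinct
edges. -/
structure NiceDrawing {V E : Type*} (src tgt : E → V) where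
  pos : V → Plane
  pos_injective : Function.Injective pos
  curve : E → Curve
  steep : ∀ e, (curve e).Steep
  curve_injective : Function.Injective curve
  src_mem : ∀ e, (curve e).toFun (pos (src e)).1 = (pos (src e)).2
  tgt_mem : ∀ e, (curve e).toFun (pos (tgt e)).1 = (pos (tgt e)).2
  x_ne : ∀ e, (pos (src e)).1 ≠ (pos (tgt e)).1
  avoid : ∀ e v, (pos v).1 ∈ openBetween (pos (src e)).1 (pos (tgt e)).1 →
    (curve e).toFun (pos v).1 ≠ (pos v).2

namespace NiceDrawing

section

variable {V E : Type*} {src tgt : E → V} (N : NiceDrawing src tgt)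

/-- The open interval of abscissas of an edge. -/
def dom (e : E) : Set ℝ := openBetween (N.pos (src e)).1 (N.pos (tgt e)).1

/-- The parametrization of the abscissa along an edge. -/
def absc (e : E) (t : ℝ) : ℝ := (1 - t) * (N.pos (src e)).1 + t * (N.pos (tgt e)).1

theorem absc_zero (e : E) : N.absc e 0 = (N.pos (src e)).1 := by simp [absc]

theorem absc_one (e : E) : N.absc e 1 = (N.pos (tgt e)).1 := by simp [absc]

theorem absc_injective (e : E) : Function.Injective (N.absc e) := by
  intro t t' h
  have h0 := sub_ne_zero.2 (N.x_ne e)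
  simp only [absc] at h
  exact mul_right_cancel₀ h0 (by linarith)

theorem dom_eq (e : E) : N.dom e = N.absc e '' Ioo 0 1 := openBetween_eq_image (N.x_ne e)

/-- The pairs of edges that cross. -/
def crossPairs : Set (Sym2 E) :=
  { z | ∃ e f, e ≠ f ∧ z = s(e, f) ∧
    ∃ x, x ∈ N.dom e ∧ x ∈ N.dom f ∧ (N.curve e).toFun x = (N.curve f).toFun x }

end

section ToDrawing

variable {V E : Type*} {G : SimpleGraph V} {I : EdgeIndexing G E} (N : NiceDrawing I.src I.tgt)

/-- The drawing given by arcs of curves. -/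
def toDrawing : Drawing G where
  vert := N.pos
  vert_inj := N.pos_injective
  arc e t := (N.absc (I.edge.symm e) t, (N.curve (I.edge.symm e)).toFun (N.absc (I.edge.symm e) t))
  arc_cont e := by
    have h1 : Continuous (N.absc (I.edge.symm e)) := by unfold absc; fun_prop
    exact (h1.prodMk ((Curve.continuous_toFun _).comp h1)).continuousOn
  arc_injOn e := fun t _ t' _ h => N.absc_injective _ (congrArg Prod.fst h)
  arc_ends e := ⟨I.src (I.edge.symm e), I.tgt (I.edge.symm e), by
      rw [← I.spec, Equiv.apply_symm_apply], by
      ext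
      · exact N.absc_zero _
      · simp only [absc_zero]; exact N.src_mem _, by
      ext
      · exact N.absc_one _
      · simp only [absc_one]; exact N.tgt_mem _⟩
  arc_avoid e t ht := by
    rintro ⟨v, hv⟩
    by_contra! hcon
    have hd : N.absc (I.edge.symm e) t ∈ N.dom (I.edge.symm e) := by
      rw [dom_eq]
      exact mem_image_of_mem _ ⟨lt_of_le_of_ne ht.1 hcon.1.symm, lt_of_le_of_ne ht.2 hcon.2⟩
    have h1 := congrArg Prod.fst hv
    have h2 := congrArg Prod.snd hv
    simp only at h1 h2
    rw [h1] at hd h2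
    exact N.avoid _ v hd h2

theorem mem_interOf {e : G.edgeSet} {p : Plane} (h : p ∈ N.toDrawing.interOf e) :
    p.1 ∈ N.dom (I.edge.symm e) ∧ p.2 = (N.curve (I.edge.symm e)).toFun p.1 := by
  obtain ⟨t, ht, rfl⟩ := h
  exact ⟨by rw [dom_eq]; exact mem_image_of_mem _ ht, rfl⟩

theorem isPseudolinear : N.toDrawing.IsPseudolinear := by
  refine ⟨fun e => homLocus (N.curve (I.edge.symm e)).hom, fun e => ?_, fun e t _ => ?_,
    fun e f hef => ?_⟩
  · exact isPseudoline_homLocus (Curve.hom_mul _) (Curve.continuous_hom _)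
  · rw [planeToRP2_mem_homLocus (Curve.hom_mul _)]
    rfl
  · exact Curve.existsUnique_mem (N.steep _) (N.steep _)
      (N.curve_injective.ne (I.edge.symm.injective.ne hef))

theorem isRectilinear (h : ∀ e, ∃ s t, N.curve e = .line s t) : N.toDrawing.IsRectilinear := by
  intro e t _
  obtain ⟨s, u, hs⟩ := h (I.edge.symm e)
  ext
  · simp [toDrawing, absc]
  · simp only [toDrawing, absc, hs, Curve.toFun_line, Prod.smul_mk, Prod.mk_add_mk, smul_eq_mul]
    ring

variable {N}

theorem map_mem_crossPairs {x : Plane × Sym2 G.edgeSet} (hx : x ∈ N.toDrawing.CrossSet) :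
    x.2.map I.edge.symm ∈ N.crossPairs := by
  obtain ⟨e, f, hef, h2, he, hf⟩ := hx
  obtain ⟨he1, he2⟩ := N.mem_interOf he
  obtain ⟨hf1, hf2⟩ := N.mem_interOf hf
  rw [h2, Sym2.map_mk]
  exact ⟨_, _, I.edge.symm.injective.ne hef, rfl, x.1.1, he1, hf1, he2.symm.trans hf2⟩

theorem injOn_map :
    InjOn (fun x : Plane × Sym2 G.edgeSet => x.2.map I.edge.symm) N.toDrawing.CrossSet := by
  rintro ⟨p, z⟩ ⟨e, f, hef, h2, he, hf⟩ ⟨p', z'⟩ ⟨e', f', hef', h2', he', hf'⟩ h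
  have hz : z = z' := Sym2.map.injective I.edge.symm.injective h
  subst hz
  simp only at h2 h2' he hf he' hf'
  have hp : p' ∈ N.toDrawing.interOf e ∧ p' ∈ N.toDrawing.interOf f := by
    rcases Sym2.eq_iff.1 (h2.symm.trans h2') with ⟨rfl, rfl⟩ | ⟨rfl, rfl⟩
    · exact ⟨he', hf'⟩
    · exact ⟨hf', he'⟩
  obtain ⟨-, a1⟩ := N.mem_interOf he
  obtain ⟨-, a2⟩ := N.mem_interOf hf
  obtain ⟨-, a3⟩ := N.mem_interOf hp.1
  obtain ⟨-, a4⟩ := N.mem_interOf hp.2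
  have h1 : p.1 = p'.1 := Curve.eq_of_toFun_eq (N.steep (I.edge.symm e)) (N.steep (I.edge.symm f))
    (N.curve_injective.ne (I.edge.symm.injective.ne hef)) (a1.symm.trans a2) (a3.symm.trans a4)
  have h3 : p = p' := Prod.ext h1 (by rw [a1, a3, h1])
  rw [h3]

theorem crossSet_finite (h : N.crossPairs.Finite) : N.toDrawing.CrossSet.Finite :=
  Set.Finite.of_finite_image (h.subset (image_subset_iff.2 fun _ hx => map_mem_crossPairs hx))
    injOn_map

theorem crossSet_ncard_le (h : N.crossPairs.Finite) :
    N.toDrawing.CrossSet.ncard ≤ N.crossPairs.ncard := by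
  rw [← injOn_map.ncard_image]
  exact ncard_le_ncard (image_subset_iff.2 fun _ hx => map_mem_crossPairs hx) h

end ToDrawing

end NiceDrawing

namespace Drawing

variable {V V' : Type*} {G : SimpleGraph V} {G' : SimpleGraph V'}

/-- The restriction of a drawing along an embedding of graphs. -/
def comap (D : Drawing G') (φ : G ↪g G') : Drawing G where
  vert v := D.vert (φ v)
  vert_inj := D.vert_inj.comp φ.injective
  arc e := D.arc (φ.mapEdgeSet e)
  arc_cont e := D.arc_cont _
  arc_injOn e := D.arc_injOn _
  arc_ends := by
    rintro ⟨e, he⟩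
    obtain ⟨a, b, hab, h0, h1⟩ := D.arc_ends (φ.mapEdgeSet ⟨e, he⟩)
    induction e with | _ x y
    have h : s(φ x, φ y) = s(a, b) := hab
    rcases Sym2.eq_iff.1 h with ⟨rfl, rfl⟩ | ⟨rfl, rfl⟩
    · exact ⟨x, y, rfl, h0, h1⟩
    · exact ⟨y, x, Sym2.eq_swap, h0, h1⟩
  arc_avoid e t ht := by
    rintro ⟨v, hv⟩
    exact D.arc_avoid _ t ht ⟨_, hv⟩

variable (D : Drawing G') (φ : G ↪g G')

/-- The crossing of a drawing corresponding to a crossing of its restriction. -/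
def comapCross (x : Plane × Sym2 G.edgeSet) : Plane × Sym2 G'.edgeSet :=
  (x.1, x.2.map φ.mapEdgeSet)

theorem comapCross_injective : Function.Injective (comapCross φ) := by
  rintro ⟨p, z⟩ ⟨p', z'⟩ h
  have h1 : p = p' := congrArg Prod.fst h
  have h2 : z = z' := Sym2.map.injective φ.mapEdgeSet.injective (congrArg Prod.snd h)
  rw [h1, h2]

theorem comapCross_mem {x : Plane × Sym2 G.edgeSet} (hx : x ∈ (D.comap φ).CrossSet) :
    comapCross φ x ∈ D.CrossSet := by
  obtain ⟨e, f, hef, h2, he, hf⟩ := hx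
  refine ⟨φ.mapEdgeSet e, φ.mapEdgeSet f, φ.mapEdgeSet.injective.ne hef, ?_, he, hf⟩
  simp [comapCross, h2]

theorem comap_image_subset : comapCross φ '' (D.comap φ).CrossSet ⊆ D.CrossSet :=
  image_subset_iff.2 fun _ hx => D.comapCross_mem φ hx

variable {D}

theorem comap_finite (h : D.CrossSet.Finite) : (D.comap φ).CrossSet.Finite :=
  Set.Finite.of_finite_image (h.subset (D.comap_image_subset φ)) (comapCross_injective φ).injOn

theorem comap_ncard_le (h : D.CrossSet.Finite) :
    (D.comap φ).CrossSet.ncard ≤ D.CrossSet.ncard := by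
  rw [← ncard_image_of_injective _ (comapCross_injective φ)]
  exact ncard_le_ncard (D.comap_image_subset φ) h

theorem IsRectilinear.comap (h : D.IsRectilinear) : (D.comap φ).IsRectilinear :=
  fun e t ht => h (φ.mapEdgeSet e) t ht

theorem IsPseudolinear.comap (h : D.IsPseudolinear) : (D.comap φ).IsPseudolinear := by
  obtain ⟨L, h1, h2, h3⟩ := h
  exact ⟨fun e => L (φ.mapEdgeSet e), fun e => h1 _, fun e t ht => h2 _ t ht,
    fun e f hef => h3 _ _ (φ.mapEdgeSet.injective.ne hef)⟩

end Drawing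

namespace EdgeIndexing

variable {V E V' E' : Type*} {G : SimpleGraph V} {G' : SimpleGraph V'}

theorem adj (I : EdgeIndexing G E) (e : E) : G.Adj (I.src e) (I.tgt e) := by
  rw [← SimpleGraph.mem_edgeSet, ← I.spec]
  exact (I.edge e).2

theorem eq_of_ends (I : EdgeIndexing G E) {e f : E}
    (h : s(I.src e, I.tgt e) = s(I.src f, I.tgt f)) : e = f :=
  I.edge.injective (Subtype.ext (by rw [I.spec, I.spec, h]))

/-- The edges of a graph, indexed by themselves. -/
def refl (G : SimpleGraph V) : EdgeIndexing G G.edgeSet where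
  edge := Equiv.refl _
  src e := (Quot.out (e : Sym2 V)).1
  tgt e := (Quot.out (e : Sym2 V)).2
  spec e := (Quot.out_eq (e : Sym2 V)).symm

/-- The edges of a disjoint union. -/
def sum (I : EdgeIndexing G E) (J : EdgeIndexing G' E') : EdgeIndexing (G ⊕g G') (E ⊕ E') where
  edge := Equiv.ofBijective
    (Sum.elim (fun e => SimpleGraph.Embedding.sumInl.mapEdgeSet (I.edge e))
      (fun e => SimpleGraph.Embedding.sumInr.mapEdgeSet (J.edge e))) (by
    have key : ∀ e f, (SimpleGraph.Embedding.sumInl : G ↪g G ⊕g G').mapEdgeSet (I.edge e) ≠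
        SimpleGraph.Embedding.sumInr.mapEdgeSet (J.edge f) := by
      intro e f h
      have h1 : s(I.src e, I.tgt e).map Sum.inl = s(J.src f, J.tgt f).map Sum.inr := by
        rw [← I.spec, ← J.spec]; exact congrArg Subtype.val h
      simp at h1
    constructor
    · rintro (e | e) (f | f) h
      · exact congrArg Sum.inl (I.edge.injective
          (SimpleGraph.Embedding.sumInl.mapEdgeSet.injective h))
      · exact (key _ _ h).elim
      · exact (key _ _ h.symm).elim
      · exact congrArg Sum.inr (J.edge.injective
          (SimpleGraph.Embedding.sumInr.mapEdgeSet.injective h))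
    · rintro ⟨z, hz⟩
      induction z with | _ a b
      rcases a with a | a <;> rcases b with b | b
      · exact ⟨.inl (I.edge.symm ⟨s(a, b), hz⟩), by
          simp only [Sum.elim_inl, Equiv.apply_symm_apply]; rfl⟩
      · simp at hz
      · simp at hz
      · exact ⟨.inr (J.edge.symm ⟨s(a, b), hz⟩), by
          simp only [Sum.elim_inr, Equiv.apply_symm_apply]; rfl⟩)
  src := Sum.map I.src J.src
  tgt := Sum.map I.tgt J.tgt
  spec := by
    rintro (e | e)
    · change Sym2.map Sum.inl (I.edge e : Sym2 V) = _
      rw [I.spec]; rfl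
    · change Sym2.map Sum.inr (J.edge e : Sym2 V') = _
      rw [J.spec]; rfl

end EdgeIndexing

namespace Curve

/-- The line through two points. -/
def through (p q : Plane) : Curve :=
  line ((q.2 - p.2) / (q.1 - p.1)) (p.2 - (q.2 - p.2) / (q.1 - p.1) * p.1)

theorem through_left (p q : Plane) : (through p q).toFun p.1 = p.2 := by
  simp [through]

theorem through_right {p q : Plane} (h : p.1 ≠ q.1) : (through p q).toFun q.1 = q.2 := by
  have : q.1 - p.1 ≠ 0 := sub_ne_zero.2 h.symm
  simp only [through, toFun_line]
  field_simp
  ring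

theorem through_mul {p q : Plane} (h : p.1 ≠ q.1) (x : ℝ) :
    (q.1 - p.1) * (through p q).toFun x = p.2 * (q.1 - p.1) + (q.2 - p.2) * (x - p.1) := by
  have : q.1 - p.1 ≠ 0 := sub_ne_zero.2 h.symm
  simp only [through, toFun_line]
  field_simp
  ring

theorem steep_through {p q : Plane} (h : p.1 ≠ q.1) (hs : 33 * |q.1 - p.1| < |q.2 - p.2|) :
    (through p q).Steep := by
  simp only [through, Steep]
  rw [abs_div, lt_div_iff₀ (abs_pos.2 (sub_ne_zero.2 h.symm))]
  exact hs

/-- An integral certificate that two arcs do not cross. -/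
theorem toFun_ne_of_int {c c' : Curve} (h : c.Steep) (h' : c'.Steep) (hne : c ≠ c') {d d' : ℤ}
    (hd : 0 < d) (hd' : 0 < d') {n n' : ℤ → ℤ} (hn : ∀ x : ℤ, d * c.toFun x = n x)
    (hn' : ∀ x : ℤ, d' * c'.toFun x = n' x) {a b a' b' : ℤ}
    (hD : min (max a b) (max a' b') ≤ max (min a b) (min a' b') ∨
      0 ≤ (n (max (min a b) (min a' b')) * d' - n' (max (min a b) (min a' b')) * d) *
        (n (min (max a b) (max a' b')) * d' - n' (min (max a b) (max a' b')) * d))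
    {x : ℝ} (hx : x ∈ openBetween a b) (hx' : x ∈ openBetween a' b') : c.toFun x ≠ c'.toFun x := by
  obtain ⟨h1, h2⟩ := hx
  obtain ⟨h3, h4⟩ := hx'
  have hl : ((max (min a b) (min a' b') : ℤ) : ℝ) < x := by push_cast; exact max_lt h1 h3
  have hr : x < ((min (max a b) (max a' b') : ℤ) : ℝ) := by push_cast; exact lt_min h2 h4
  generalize max (min a b) (min a' b') = l at *
  generalize min (max a b) (max a' b') = r at *
  rcases hD with hD | hD
  · have : (r : ℝ) ≤ l := by exact_mod_cast hD
    linarith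
  · refine toFun_ne_of_mul_nonneg h h' hne ⟨hl, hr⟩ ?_
    have hD' : (0:ℝ) ≤ (n l * d' - n' l * d) * (n r * d' - n' r * d) := by exact_mod_cast hD
    rw [← hn, ← hn, ← hn', ← hn'] at hD'
    have hd0 : (0:ℝ) < d := by exact_mod_cast hd
    have hd0' : (0:ℝ) < d' := by exact_mod_cast hd'
    have hp : (0:ℝ) < (d * d') ^ 2 := by positivity
    refine nonneg_of_mul_nonneg_right (a := ((d:ℝ) * d') ^ 2) ?_ hp
    calc _ ≤ _ := hD'
      _ = _ := by ring

end Curve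

namespace NiceDrawing

variable {V E V' E' : Type*} {G : SimpleGraph V} {G' : SimpleGraph V'}

/-- The straight-line drawing on points in general position. -/
def straight (I : EdgeIndexing G E) (pos : V → Plane) (hx : Function.Injective fun v => (pos v).1)
    (hs : ∀ v w, v ≠ w → 33 * |(pos w).1 - (pos v).1| < |(pos w).2 - (pos v).2|)
    (hg : ∀ u v w, u ≠ v → u ≠ w → v ≠ w →
      (pos u).2 * ((pos v).1 - (pos u).1) + ((pos v).2 - (pos u).2) * ((pos w).1 - (pos u).1) ≠
        ((pos v).1 - (pos u).1) * (pos w).2) :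
    NiceDrawing I.src I.tgt where
  pos := pos
  pos_injective v w h := hx (congrArg Prod.fst h)
  curve e := Curve.through (pos (I.src e)) (pos (I.tgt e))
  steep e := Curve.steep_through (hx.ne (I.adj e).ne) (hs _ _ (I.adj e).ne)
  curve_injective e f h := by
    by_contra hef
    simp only at h
    have hon : ∀ g w, (Curve.through (pos (I.src g)) (pos (I.tgt g))).toFun (pos w).1 =
        (pos w).2 → w = I.src g ∨ w = I.tgt g := by
      intro g w hw
      by_contra! hcon
      refine hg _ _ _ (I.adj g).ne hcon.1.symm hcon.2.symm ?_
      rw [← Curve.through_mul (hx.ne (I.adj g).ne), hw]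
    have h1 := hon f (I.src e) (by rw [← h]; exact Curve.through_left _ _)
    have h2 := hon f (I.tgt e) (by rw [← h]; exact Curve.through_right (hx.ne (I.adj e).ne))
    refine hef (I.eq_of_ends ?_)
    have h3 := (I.adj e).ne
    rcases h1 with h1 | h1 <;> rcases h2 with h2 | h2 <;> rw [h1, h2] at h3 ⊢
    · exact absurd rfl h3
    · exact Sym2.eq_swap
    · exact absurd rfl h3
  src_mem e := Curve.through_left _ _
  tgt_mem e := Curve.through_right (hx.ne (I.adj e).ne)
  x_ne e := hx.ne (I.adj e).ne
  avoid e v hv := by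
    intro hcon
    have h1 : v ≠ I.src e := by rintro rfl; simp [openBetween] at hv; grind
    have h2 : v ≠ I.tgt e := by rintro rfl; simp [openBetween] at hv; grind
    refine hg _ _ _ (I.adj e).ne h1.symm h2.symm ?_
    rw [← Curve.through_mul (hx.ne (I.adj e).ne), hcon]

theorem exists_bound [Finite V] [Finite E] {src tgt : E → V} (N : NiceDrawing src tgt) :
    ∃ B, (∀ v, |(N.pos v).2| < B) ∧ (∀ e, |(N.curve e).toFun 0| < B) ∧
      ∀ e, ∀ x ∈ N.dom e, |(N.curve e).toFun x| < B := by
  obtain ⟨R, hR⟩ := (finite_range fun v => |(N.pos v).1|).bddAbove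
  obtain ⟨B₁, hB₁⟩ := (finite_range fun v => |(N.pos v).2|).bddAbove
  obtain ⟨B₂, hB₂⟩ := (finite_range fun e => |(N.curve e).toFun 0|).bddAbove
  have hb : ∀ e, ∃ b, ∀ x ∈ Icc (-R) R, |(N.curve e).toFun x| ≤ b := fun e =>
    isCompact_Icc.exists_bound_of_continuousOn (N.curve e).continuous_toFun.continuousOn
  choose b hb using hb
  obtain ⟨B₃, hB₃⟩ := (finite_range b).bddAbove
  refine ⟨max B₁ (max B₂ B₃) + 1, fun v => ?_, fun e => ?_, fun e x hx => ?_⟩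
  · have := (hB₁ (mem_range_self v)).trans (le_max_left B₁ (max B₂ B₃))
    linarith
  · have := (hB₂ (mem_range_self e)).trans ((le_max_left B₂ B₃).trans (le_max_right B₁ _))
    linarith
  · have h1 := abs_le.1 (hR (mem_range_self (src e)))
    have h2 := abs_le.1 (hR (mem_range_self (tgt e)))
    have h3 : x ∈ Icc (-R) R :=
      ⟨(le_min h1.1 h2.1).trans hx.1.le, hx.2.le.trans (max_le h1.2 h2.2)⟩
    have := (hB₃ (mem_range_self e)).trans ((le_max_right B₂ B₃).trans (le_max_right B₁ _))
    have := hb e x h3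
    linarith

/-- Drawing two graphs with disjoint images, one far above the other. -/
theorem exists_sum [Finite V] [Finite E] [Finite V'] [Finite E'] {src tgt : E → V}
    {src' tgt' : E' → V'} (N : NiceDrawing src tgt) (M : NiceDrawing src' tgt') :
    ∃ K : NiceDrawing (Sum.map src src') (Sum.map tgt tgt'),
      K.crossPairs.ncard ≤ N.crossPairs.ncard + M.crossPairs.ncard := by
  obtain ⟨B, hB1, hB2, hB3⟩ := N.exists_bound
  obtain ⟨C, hC1, hC2, hC3⟩ := M.exists_bound
  let K : NiceDrawing (Sum.map src src') (Sum.map tgt tgt') := {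
    pos := Sum.elim N.pos fun v => ((M.pos v).1, (M.pos v).2 + (B + C))
    pos_injective := by
      rintro (v | v) (w | w) h
      · exact congrArg _ (N.pos_injective h)
      · have h2 := congrArg Prod.snd h
        have h3 := abs_lt.1 (hB1 v)
        have h4 := abs_lt.1 (hC1 w)
        simp only [Sum.elim_inl, Sum.elim_inr] at h2
        linarith
      · have h2 := congrArg Prod.snd h
        have h3 := abs_lt.1 (hB1 w)
        have h4 := abs_lt.1 (hC1 v)
        simp only [Sum.elim_inl, Sum.elim_inr] at h2
        linarith
      · simp only [Sum.elim_inr, Prod.mk.injEq, add_left_inj] at h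
        exact congrArg _ (M.pos_injective (Prod.ext h.1 h.2))
    curve := Sum.elim N.curve fun e => (M.curve e).shift (B + C)
    steep := by
      rintro (e | e)
      · exact N.steep e
      · exact (Curve.steep_shift _ _).2 (M.steep e)
    curve_injective := by
      have key : ∀ e f, N.curve e ≠ (M.curve f).shift (B + C) := by
        intro e f h
        have h2 := congrArg (fun c => c.toFun 0) h
        have h3 := abs_lt.1 (hB2 e)
        have h4 := abs_lt.1 (hC2 f)
        simp only [Curve.toFun_shift] at h2
        linarith
      rintro (e | e) (f | f) h
      · exact congrArg _ (N.curve_injective h)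
      · exact (key _ _ h).elim
      · exact (key _ _ h.symm).elim
      · exact congrArg _ (M.curve_injective (Curve.shift_injective _ h))
    src_mem := by
      rintro (e | e)
      · exact N.src_mem e
      · simpa using M.src_mem e
    tgt_mem := by
      rintro (e | e)
      · exact N.tgt_mem e
      · simpa using M.tgt_mem e
    x_ne := by
      rintro (e | e)
      · exact N.x_ne e
      · exact M.x_ne e
    avoid := by
      rintro (e | e) (v | v) hv
      · exact N.avoid e v hv
      · have h3 := abs_lt.1 (hB3 e _ hv)
        have h4 := abs_lt.1 (hC1 v)
        simp only [Sum.elim_inl, Sum.elim_inr] at h3 ⊢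
        intro h
        linarith
      · have h3 := abs_lt.1 (hC3 e _ hv)
        have h4 := abs_lt.1 (hB1 v)
        simp only [Sum.elim_inl, Sum.elim_inr, Curve.toFun_shift] at h3 ⊢
        intro h
        linarith
      · have := M.avoid e v hv
        simpa using this }
  refine ⟨K, ?_⟩
  have hsub : K.crossPairs ⊆ Sym2.map Sum.inl '' N.crossPairs ∪ Sym2.map Sum.inr '' M.crossPairs := by
    rintro z ⟨e, f, hef, rfl, x, hx, hx', h⟩
    rcases e with e | e <;> rcases f with f | f
    · exact Or.inl ⟨s(e, f), ⟨e, f, by simpa using hef, rfl, x, hx, hx', h⟩, rfl⟩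
    · have h3 := abs_lt.1 (hB3 e _ hx)
      have h4 := abs_lt.1 (hC3 f _ hx')
      simp only [K, Sum.elim_inl, Sum.elim_inr, Curve.toFun_shift] at h
      linarith
    · have h3 := abs_lt.1 (hB3 f _ hx')
      have h4 := abs_lt.1 (hC3 e _ hx)
      simp only [K, Sum.elim_inl, Sum.elim_inr, Curve.toFun_shift] at h
      linarith
    · exact Or.inr ⟨s(e, f), ⟨e, f, by simpa using hef, rfl, x, hx, hx', by
        simpa [K] using h⟩, rfl⟩
  calc _ ≤ _ := ncard_le_ncard hsub (toFinite _)
    _ ≤ _ := ncard_union_le _ _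
    _ ≤ _ := add_le_add (ncard_image_le (toFinite _)) (ncard_image_le (toFinite _))

end NiceDrawing

/-- `p` bounds the crossing number from below and is attained by a nice drawing, while `q` bounds
the rectilinear crossing number from below. -/
structure CrossingBounds {V : Type} (G : SimpleGraph V) (p q : ℕ) : Prop where
  le_ncard : ∀ D : Drawing G, D.CrossSet.Finite → p ≤ D.CrossSet.ncard
  le_ncard_rectilinear : ∀ D : Drawing G, D.IsRectilinear → D.CrossSet.Finite →
    q ≤ D.CrossSet.ncard
  exists_nice : ∃ (E : Type) (I : EdgeIndexing G E) (N : NiceDrawing I.src I.tgt), N.crossPairs.ncard ≤ p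

theorem EdgeIndexing.finite {V E : Type*} [Finite V] {G : SimpleGraph V} (I : EdgeIndexing G E) :
    Finite E :=
  Finite.of_equiv _ I.edge.symm

theorem mapEdgeSet_sumInl_ne_sumInr {V V' : Type*} {G : SimpleGraph V} {G' : SimpleGraph V'}
    (e : G.edgeSet) (f : G'.edgeSet) :
    (SimpleGraph.Embedding.sumInl : G ↪g G ⊕g G').mapEdgeSet e ≠
      SimpleGraph.Embedding.sumInr.mapEdgeSet f := by
  obtain ⟨e, he⟩ := e
  obtain ⟨f, hf⟩ := f
  intro h
  have h1 : e.map Sum.inl = f.map Sum.inr := congrArg Subtype.val h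
  induction e with | _ a b
  induction f with | _ c d
  simp at h1

theorem Drawing.comap_sum_ncard_le {V V' : Type*} {G : SimpleGraph V} {G' : SimpleGraph V'}
    {D : Drawing (G ⊕g G')} (h : D.CrossSet.Finite) :
    (D.comap SimpleGraph.Embedding.sumInl).CrossSet.ncard +
      (D.comap SimpleGraph.Embedding.sumInr).CrossSet.ncard ≤ D.CrossSet.ncard := by
  rw [← ncard_image_of_injective (D.comap SimpleGraph.Embedding.sumInl).CrossSet
      (comapCross_injective _),
    ← ncard_image_of_injective (D.comap SimpleGraph.Embedding.sumInr).CrossSet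
      (comapCross_injective _),
    ← ncard_union_eq _ ((comap_finite _ h).image _) ((comap_finite _ h).image _)]
  · exact ncard_le_ncard (union_subset (D.comap_image_subset _) (D.comap_image_subset _)) h
  · rw [Set.disjoint_left]
    rintro _ ⟨⟨p, z⟩, -, rfl⟩ ⟨⟨p', z'⟩, -, h⟩
    have h1 := congrArg Prod.snd h
    induction z with | _ a b
    induction z' with | _ c d
    simp only [comapCross, Sym2.map_mk, Sym2.eq_iff] at h1
    rcases h1 with ⟨h1, -⟩ | ⟨h1, -⟩
    · exact mapEdgeSet_sumInl_ne_sumInr _ _ h1.symm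
    · exact mapEdgeSet_sumInl_ne_sumInr _ _ h1.symm

namespace CrossingBounds

theorem sum {V V' : Type} [Finite V] [Finite V'] {G : SimpleGraph V} {G' : SimpleGraph V'}
    {p q p' q' : ℕ} (h : CrossingBounds G p q) (h' : CrossingBounds G' p' q') :
    CrossingBounds (G ⊕g G') (p + p') (q + q') where
  le_ncard D hfin := (add_le_add (h.le_ncard _ (Drawing.comap_finite _ hfin))
    (h'.le_ncard _ (Drawing.comap_finite _ hfin))).trans (Drawing.comap_sum_ncard_le hfin)
  le_ncard_rectilinear D hD hfin := (add_le_add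
    (h.le_ncard_rectilinear _ (hD.comap _) (Drawing.comap_finite _ hfin))
    (h'.le_ncard_rectilinear _ (hD.comap _) (Drawing.comap_finite _ hfin))).trans
    (Drawing.comap_sum_ncard_le hfin)
  exists_nice := by
    obtain ⟨E, I, N, hN⟩ := h.exists_nice
    obtain ⟨E', J, M, hM⟩ := h'.exists_nice
    have := I.finite
    have := J.finite
    obtain ⟨K, hK⟩ := N.exists_sum M
    exact ⟨_, I.sum J, K, hK.trans (add_le_add hN hM)⟩

theorem exists_copies {V : Type} [Finite V] {G : SimpleGraph V} {p q : ℕ}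
    (h : CrossingBounds G p q) (n : ℕ) :
    ∃ (W : Type) (_ : Finite W) (H : SimpleGraph W),
      CrossingBounds H ((n + 1) * p) ((n + 1) * q) := by
  induction n with
  | zero => exact ⟨V, inferInstance, G, by simpa using h⟩
  | succ n ih =>
    obtain ⟨W, hW, H, hH⟩ := ih
    exact ⟨_, inferInstance, _, by simpa only [add_mul, one_mul] using hH.sum h⟩

end CrossingBounds

theorem exists_rectilinear {n : ℕ} (G : SimpleGraph (Fin n)) :
    ∃ D : Drawing G, D.IsRectilinear ∧ D.CrossSet.Finite := by
  have hinj : ∀ v w : Fin n, v ≠ w → (v : ℝ) - w ≠ 0 := fun v w h h' =>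
    h (Fin.ext (by exact_mod_cast sub_eq_zero.1 h'))
  let N := NiceDrawing.straight (EdgeIndexing.refl G)
    (fun v => (100 * ((v : ℝ) + 1), (100 * ((v : ℝ) + 1)) ^ 2))
    (fun v w h => by
      by_contra hne
      refine hinj v w hne ?_
      simp only at h
      linarith)
    (fun v w h => by
      have h1 : (100 * ((w : ℝ) + 1)) ^ 2 - (100 * ((v : ℝ) + 1)) ^ 2 =
        (100 * ((w : ℝ) + 1) - 100 * ((v : ℝ) + 1)) * (100 * (w + 1) + 100 * (v + 1)) := by ring
      simp only [h1, abs_mul (_ - _)]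
      have h2 : 0 < |100 * ((w : ℝ) + 1) - 100 * ((v : ℝ) + 1)| := by
        rw [abs_pos]
        intro h3
        exact hinj w v h.symm (by linarith)
      have h3 : (0:ℝ) ≤ w := Nat.cast_nonneg _
      have h4 : (0:ℝ) ≤ v := Nat.cast_nonneg _
      rw [mul_comm]
      refine mul_lt_mul_of_pos_left ?_ h2
      rw [abs_of_nonneg (by linarith)]
      linarith)
    (fun u v w h1 h2 h3 h => by
      have h4 : ((v:ℝ) - u) * ((w - u) * (w - v)) = 0 := by
        simp only at h
        linear_combination (-1 / 1000000 : ℝ) * h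
      exact mul_ne_zero (hinj v u h1.symm) (mul_ne_zero (hinj w u h2.symm) (hinj w v h3.symm)) h4)
  exact ⟨N.toDrawing, N.isRectilinear fun e => ⟨_, _, rfl⟩,
    NiceDrawing.crossSet_finite (toFinite _)⟩

/-- The edges of the complete graph on five vertices. -/
def completeFive : EdgeIndexing (⊤ : SimpleGraph (Fin 5)) {p : Fin 5 × Fin 5 // p.1 < p.2} where
  edge := Equiv.ofBijective (fun p => ⟨s(p.1.1, p.1.2), by simpa using p.2.ne⟩) (by
    constructor
    · rintro ⟨⟨a, b⟩, h⟩ ⟨⟨c, d⟩, h'⟩ heq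
      have h1 : s(a, b) = s(c, d) := congrArg Subtype.val heq
      rcases Sym2.eq_iff.1 h1 with ⟨rfl, rfl⟩ | ⟨rfl, rfl⟩
      · rfl
      · exact absurd h (lt_asymm h')
    · rintro ⟨z, hz⟩
      induction z with | _ a b
      rcases lt_or_gt_of_ne (by simpa using hz : a ≠ b) with h | h
      · exact ⟨⟨(a, b), h⟩, rfl⟩
      · exact ⟨⟨(b, a), h⟩, Subtype.ext Sym2.eq_swap⟩)
  src p := p.1.1
  tgt p := p.1.2
  spec _ := rfl

theorem completeFive_le_ncard (D : Drawing (⊤ : SimpleGraph (Fin 5))) (h : D.CrossSet.Finite) :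
    1 ≤ D.CrossSet.ncard := by
  let A : Fin 5 → Fin 5 → Set Plane := fun i j =>
    {p | ∃ hij : i < j, p ∈ D.arcSet (completeFive.edge ⟨(i, j), hij⟩)}
  obtain ⟨i, j, k, l, hij, hkl, h1, h2, h3, h4, p, ⟨_, hp⟩, ⟨_, hp'⟩⟩ :=
    exists_independent_sets_meet D.vert A
    (fun i j hij => by
      have h1 : A i j = D.arcSet (completeFive.edge ⟨(i, j), hij⟩) := by
        ext p; exact ⟨fun ⟨_, h⟩ => h, fun h => ⟨hij, h⟩⟩
      rw [h1]
      exact D.joinedIn_arcSet (completeFive.spec _))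
    (fun i j k hij hi hj ⟨_, hk⟩ => by
      have := D.mem_of_vert_mem_arcSet hk
      rw [completeFive.spec, Sym2.mem_iff] at this
      exact this.elim hi hj)
  have hne : completeFive.edge ⟨(i, j), hij⟩ ≠ completeFive.edge ⟨(k, l), hkl⟩ := by
    intro h
    have := completeFive.edge.injective h
    simp only [Subtype.mk.injEq, Prod.mk.injEq] at this
    exact h1 this.1
  rcases D.common_vert_or_mem_crossSet hne hp hp' with ⟨w, hw, hw', -⟩ | hx
  · rw [completeFive.spec, Sym2.mem_iff] at hw hw'
    rcases hw with rfl | rfl <;> rcases hw' with hw' | hw'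
    · exact (h1 hw').elim
    · exact (h2 hw').elim
    · exact (h3 hw').elim
    · exact (h4 hw').elim
  · exact (ncard_pos h).2 ⟨_, hx⟩

/-- The ordinates, up to scaling, of five points drawing the complete graph with one crossing. -/
def fiveOrd : Fin 5 → ℤ := ![0, 1, 3, 2, 8]

theorem completeFive_exists_nice :
    ∃ N : NiceDrawing completeFive.src completeFive.tgt, N.crossPairs.ncard ≤ 1 := by
  have hval : ∀ v : Fin 5, ((v : ℕ) : ℝ) = ((v : ℕ) : ℤ) := fun v => by simp
  let N := NiceDrawing.straight completeFive (fun v => ((v : ℕ), 1000 * (fiveOrd v : ℝ)))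
    (fun v w h => Fin.ext (by simpa using h))
    (fun v w h => by
      have : ∀ v w : Fin 5, v ≠ w →
        33 * |((w : ℕ) : ℤ) - (v : ℕ)| < |1000 * fiveOrd w - 1000 * fiveOrd v| := by decide
      have := this v w h
      simp only
      exact_mod_cast this)
    (fun u v w h1 h2 h3 h => by
      have : ∀ u v w : Fin 5, u ≠ v → u ≠ w → v ≠ w →
        1000 * fiveOrd u * (((v : ℕ) : ℤ) - (u : ℕ)) +
          (1000 * fiveOrd v - 1000 * fiveOrd u) * (((w : ℕ) : ℤ) - (u : ℕ)) ≠
          (((v : ℕ) : ℤ) - (u : ℕ)) * (1000 * fiveOrd w) := by decide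
      refine this u v w h1 h2 h3 ?_
      simp only at h
      exact_mod_cast h)
  refine ⟨N, ?_⟩
  let num : {p : Fin 5 × Fin 5 // p.1 < p.2} → ℤ → ℤ := fun e x =>
    1000 * fiveOrd e.1.1 * (((e.1.2 : ℕ) : ℤ) - (e.1.1 : ℕ)) +
      (1000 * fiveOrd e.1.2 - 1000 * fiveOrd e.1.1) * (x - (e.1.1 : ℕ))
  let den : {p : Fin 5 × Fin 5 // p.1 < p.2} → ℤ := fun e => ((e.1.2 : ℕ) : ℤ) - (e.1.1 : ℕ)
  have hden : ∀ e, 0 < den e := by decide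
  have hnum : ∀ e, ∀ x : ℤ, den e * (N.curve e).toFun x = num e x := by
    intro e x
    have hne := N.x_ne e
    have := Curve.through_mul hne x
    simp only [num, den]
    push_cast
    exact this
  have hcert : ∀ e f, e ≠ f → 
      (min (max (((e.1.1 : ℕ) : ℤ)) (e.1.2 : ℕ)) (max ((f.1.1 : ℕ) : ℤ) (f.1.2 : ℕ)) ≤
        max (min ((e.1.1 : ℕ) : ℤ) (e.1.2 : ℕ)) (min ((f.1.1 : ℕ) : ℤ) (f.1.2 : ℕ)) ∨
      0 ≤ (num e (max (min ((e.1.1 : ℕ) : ℤ) (e.1.2 : ℕ)) (min ((f.1.1 : ℕ) : ℤ) (f.1.2 : ℕ))) *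
          den f -
        num f (max (min ((e.1.1 : ℕ) : ℤ) (e.1.2 : ℕ)) (min ((f.1.1 : ℕ) : ℤ) (f.1.2 : ℕ))) *
          den e) *
        (num e (min (max ((e.1.1 : ℕ) : ℤ) (e.1.2 : ℕ)) (max ((f.1.1 : ℕ) : ℤ) (f.1.2 : ℕ))) *
          den f -
        num f (min (max ((e.1.1 : ℕ) : ℤ) (e.1.2 : ℕ)) (max ((f.1.1 : ℕ) : ℤ) (f.1.2 : ℕ))) *
          den e)) ∨ s(e, f) = s(⟨(0, 2), by decide⟩, ⟨(1, 4), by decide⟩) := by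
    decide
  have hsub : N.crossPairs ⊆ {s(⟨(0, 2), by decide⟩, ⟨(1, 4), by decide⟩)} := by
    rintro z ⟨e, f, hef, rfl, x, hx, hx', h⟩
    refine (hcert e f hef).resolve_left fun hD => ?_
    refine Curve.toFun_ne_of_int (N.steep e) (N.steep f) (N.curve_injective.ne hef) (hden e)
      (hden f) (hnum e) (hnum f) hD (x := x) ?_ ?_ h
    · exact_mod_cast hx
    · exact_mod_cast hx'
  exact (ncard_le_ncard hsub).trans (ncard_singleton _).le

theorem crossingBounds_completeFive : CrossingBounds (⊤ : SimpleGraph (Fin 5)) 1 1 where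
  le_ncard := completeFive_le_ncard
  le_ncard_rectilinear D _ := completeFive_le_ncard D
  exists_nice := ⟨_, completeFive, completeFive_exists_nice⟩

theorem CrossingBounds.exists_fin {V : Type} [Finite V] {G : SimpleGraph V} {p q : ℕ}
    (h : CrossingBounds G p q) :
    ∃ (n : ℕ) (G' : SimpleGraph (Fin n)), pcrNum G' = p ∧ q ≤ rcrNum G' := by
  let e := Finite.equivFin V
  let φ : G ≃g G.map e.toEmbedding := SimpleGraph.Iso.map e G
  refine ⟨_, G.map e.toEmbedding, le_antisymm ?_ ?_, ?_⟩
  · obtain ⟨E, I, N, hN⟩ := h.exists_nice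
    have := I.finite
    have hfin : N.toDrawing.CrossSet.Finite := NiceDrawing.crossSet_finite (toFinite _)
    refine le_trans (Nat.sInf_le ⟨N.toDrawing.comap φ.symm.toEmbedding,
      N.isPseudolinear.comap _, Drawing.comap_finite _ hfin, rfl⟩) ?_
    exact (Drawing.comap_ncard_le _ hfin).trans
      ((NiceDrawing.crossSet_ncard_le (toFinite _)).trans hN)
  · obtain ⟨E, I, N, hN⟩ := h.exists_nice
    have := I.finite
    have hfin : N.toDrawing.CrossSet.Finite := NiceDrawing.crossSet_finite (toFinite _)
    refine le_csInf ⟨_, N.toDrawing.comap φ.symm.toEmbedding,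
      N.isPseudolinear.comap _, Drawing.comap_finite _ hfin, rfl⟩ ?_
    rintro _ ⟨D, -, hD, rfl⟩
    exact (h.le_ncard (D.comap φ.toEmbedding) (Drawing.comap_finite _ hD)).trans
      (Drawing.comap_ncard_le _ hD)
  · obtain ⟨D, hD, hfin⟩ := exists_rectilinear (G.map e.toEmbedding)
    refine le_csInf ⟨_, D, hD, hfin, rfl⟩ ?_
    rintro _ ⟨D, hD', hD, rfl⟩
    exact (h.le_ncard_rectilinear (D.comap φ.toEmbedding) (hD'.comap _)
      (Drawing.comap_finite _ hD)).trans (Drawing.comap_ncard_le _ hD)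

theorem exists_graph_of_gadget (hg : ∃ N : NiceDrawing GEdge.src GEdge.tgt, N.crossPairs.ncard ≤ 96)
    (m : ℕ) (hm : 1 ≤ m) : ∃ (n : ℕ) (G : SimpleGraph (Fin n)),
      pcrNum G = 36 * (1 + 4 * m) ∧ 36 * (1 + 4 * m) + m ≤ rcrNum G := by
  have h1 : CrossingBounds gadget 96 97 :=
    ⟨fun D h => (Gadget.crossing_bound h).1, fun D hD h => Gadget.rectilinear_bound hD h,
      ⟨_, gadgetEdges, hg⟩⟩
  obtain ⟨W, _, H, hH⟩ := h1.exists_copies (m - 1)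
  obtain ⟨W', _, H', hH'⟩ := crossingBounds_completeFive.exists_copies (35 + 48 * m)
  obtain ⟨n, G, hp, hq⟩ := (hH.sum hH').exists_fin
  exact ⟨n, G, by omega, by omega⟩

theorem eventually_add_mul_ne {a b p q : ℝ} (h : a = b → p ≠ q) :
    ∀ᶠ ε in nhdsWithin (0 : ℝ) (Ioi 0), a + ε * p ≠ b + ε * q := by
  rcases eq_or_ne a b with rfl | hab
  · filter_upwards [self_mem_nhdsWithin] with ε hε hh
    exact h rfl (mul_left_cancel₀ (ne_of_gt hε) (add_left_cancel hh))
  · refine nhdsWithin_le_nhds ?_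
    have hc : ContinuousAt (fun ε : ℝ => a + ε * p - (b + ε * q)) 0 := by fun_prop
    have h0 : (fun ε : ℝ => a + ε * p - (b + ε * q)) 0 ≠ 0 := by simpa using sub_ne_zero.2 hab
    filter_upwards [hc.eventually_ne h0] with ε hε hh
    exact hε (sub_eq_zero.2 hh)

theorem eventually_mul_nonneg {a b p q : ℝ} (h : 0 ≤ a * b) (hp : a = 0 → p = 0)
    (hq : b = 0 → q = 0) :
    ∀ᶠ ε in nhdsWithin (0 : ℝ) (Ioi 0), 0 ≤ (a + ε * p) * (b + ε * q) := by
  rcases eq_or_ne a 0 with ha | ha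
  · exact Filter.Eventually.of_forall fun ε => by simp [ha, hp ha]
  rcases eq_or_ne b 0 with hb | hb
  · exact Filter.Eventually.of_forall fun ε => by simp [hb, hq hb]
  refine nhdsWithin_le_nhds ?_
  have hc : ContinuousAt (fun ε : ℝ => (a + ε * p) * (b + ε * q)) 0 := by fun_prop
  have h0 : 0 < (fun ε : ℝ => (a + ε * p) * (b + ε * q)) 0 := by
    simpa using lt_of_le_of_ne h (mul_ne_zero ha hb).symm
  filter_upwards [hc.eventually (lt_mem_nhds h0)] with ε hε using hε.le

theorem openBetween_midpoint_left {a b : ℝ} (h : a ≠ b) :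
    openBetween a ((a + b) / 2) ⊆ openBetween a b := by
  rintro x ⟨h1, h2⟩
  rw [min_lt_iff] at h1
  rw [lt_max_iff] at h2
  rcases lt_or_gt_of_ne h with h3 | h3
  · rw [openBetween, min_eq_left h3.le, max_eq_right h3.le]
    constructor <;> rcases h1 with h1 | h1 <;> rcases h2 with h2 | h2 <;> linarith
  · rw [openBetween, min_eq_right h3.le, max_eq_left h3.le]
    constructor <;> rcases h1 with h1 | h1 <;> rcases h2 with h2 | h2 <;> linarith

theorem openBetween_comm (a b : ℝ) : openBetween a b = openBetween b a := by
  rw [openBetween, openBetween, min_comm, max_comm]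

theorem openBetween_midpoint_right {a b : ℝ} (h : a ≠ b) :
    openBetween ((a + b) / 2) b ⊆ openBetween a b := by
  rw [openBetween_comm _ b, openBetween_comm a b, add_comm]
  exact openBetween_midpoint_left h.symm

theorem midpoint_mem_openBetween {a b : ℝ} (h : a ≠ b) : (a + b) / 2 ∈ openBetween a b := by
  rcases lt_or_gt_of_ne h with h3 | h3
  · rw [openBetween, min_eq_left h3.le, max_eq_right h3.le]
    constructor <;> linarith
  · rw [openBetween, min_eq_right h3.le, max_eq_left h3.le]
    constructor <;> linarith

theorem disjoint_openBetween_midpoint (a b : ℝ) :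
    Disjoint (openBetween a ((a + b) / 2)) (openBetween ((a + b) / 2) b) := by
  rw [Set.disjoint_left]
  rintro x ⟨h1, h2⟩ ⟨h3, h4⟩
  rw [min_lt_iff] at h1 h3
  rw [lt_max_iff] at h2 h4
  rcases h1 with h1 | h1 <;> rcases h2 with h2 | h2 <;> rcases h3 with h3 | h3 <;>
    rcases h4 with h4 | h4 <;> linarith

theorem notMem_openBetween_left (a b : ℝ) : a ∉ openBetween a b := fun h => by
  have h1 := h.1
  have h2 := h.2
  rw [min_lt_iff] at h1
  rw [lt_max_iff] at h2
  rcases h1 with h1 | h1 <;> rcases h2 with h2 | h2 <;> linarith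

theorem notMem_openBetween_right (a b : ℝ) : b ∉ openBetween a b := by
  rw [openBetween_comm]; exact notMem_openBetween_left b a

theorem eq_or_eq_or_mem_openBetween {a b x : ℝ} (h : x ∈ uIcc a b) :
    x = a ∨ x = b ∨ x ∈ openBetween a b := by
  obtain ⟨h1, h2⟩ := h
  rcases eq_or_ne x a with h3 | h3
  · exact Or.inl h3
  rcases eq_or_ne x b with h4 | h4
  · exact Or.inr (Or.inl h4)
  refine Or.inr (Or.inr ⟨lt_of_le_of_ne h1 ?_, lt_of_le_of_ne h2 ?_⟩)
  · rcases min_choice a b with h | h <;> rw [h] <;> [exact h3.symm; exact h4.symm]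
  · rcases max_choice a b with h | h <;> rw [h] <;> [exact h3; exact h4]

namespace Curve

/-- Change the slope of a line, keeping its point of abscissa `a`. -/
def tilt (r a : ℝ) : Curve → Curve
  | line s t => line (s + r) (t - r * a)
  | bump t => bump t

theorem toFun_tilt_line {c : Curve} (h : ∃ s t, c = line s t) (r a x : ℝ) :
    (c.tilt r a).toFun x = c.toFun x + r * (x - a) := by
  obtain ⟨s, t, rfl⟩ := h
  simp only [tilt, toFun_line]
  ring

theorem tilt_zero (c : Curve) (a : ℝ) : c.tilt 0 a = c := by
  cases c <;> simp [tilt]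

theorem eventually_steep_tilt {c : Curve} (h : c.Steep) (r a : ℝ) :
    ∀ᶠ ε in nhdsWithin (0 : ℝ) (Ioi 0), (c.tilt (ε * r) a).Steep := by
  cases c with
  | bump t => exact Filter.Eventually.of_forall fun ε => trivial
  | line s t =>
    refine nhdsWithin_le_nhds ?_
    have hc : ContinuousAt (fun ε : ℝ => |s + ε * r|) 0 := by fun_prop
    have h0 : 33 < (fun ε : ℝ => |s + ε * r|) 0 := by simpa [Steep] using h
    exact hc.eventually (lt_mem_nhds h0)

theorem exists_toFun_ne {c c' : Curve} (h : c.Steep) (h' : c'.Steep) (hne : c ≠ c') :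
    ∃ x, c.toFun x ≠ c'.toFun x := by
  by_contra! hcon
  exact zero_ne_one (eq_of_toFun_eq h h' hne (hcon 0) (hcon 1))

end Curve

namespace NiceDrawing

theorem exists_reindex {V E V' E' : Type*} [Finite E'] {src tgt : E → V} {src' tgt' : E' → V'}
    (N : NiceDrawing src' tgt') {φ : V → V'} (hφ : Function.Injective φ) {ε : E → E'}
    (hε : Function.Injective ε) (hs : ∀ e, src' (ε e) = φ (src e))
    (ht : ∀ e, tgt' (ε e) = φ (tgt e)) :
    ∃ M : NiceDrawing src tgt, M.crossPairs.ncard ≤ N.crossPairs.ncard := by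
  let M : NiceDrawing src tgt := {
    pos := fun v => N.pos (φ v)
    pos_injective := N.pos_injective.comp hφ
    curve := fun e => N.curve (ε e)
    steep := fun e => N.steep _
    curve_injective := N.curve_injective.comp hε
    src_mem := fun e => by rw [← hs]; exact N.src_mem _
    tgt_mem := fun e => by rw [← ht]; exact N.tgt_mem _
    x_ne := fun e => by rw [← hs, ← ht]; exact N.x_ne _
    avoid := fun e v => by rw [← hs, ← ht]; exact N.avoid _ _ }
  have hdom : ∀ e, M.dom e = N.dom (ε e) := fun e => by
    simp only [dom, M]; rw [← hs, ← ht]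
  refine ⟨M, ?_⟩
  rw [← ncard_image_of_injective _ (Sym2.map.injective hε)]
  refine ncard_le_ncard ?_ (toFinite _)
  rintro _ ⟨z, ⟨e, f, hef, rfl, x, hx, hx', h⟩, rfl⟩
  exact ⟨ε e, ε f, hε.ne hef, rfl, x, hdom e ▸ hx, hdom f ▸ hx', h⟩

end NiceDrawing

section Thicken

variable {V O T K : Type*}

/-- The edge underlying an edge of a thickening. -/
def thickBase : O ⊕ T × K × Bool → O ⊕ T := Sum.map id Prod.fst

/-- First ends of the edges when every edge in `T` is replaced by `K` paths of length two. -/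
def thickSrc (src : O ⊕ T → V) : O ⊕ T × K × Bool → V ⊕ T × K
  | .inl o => .inl (src (.inl o))
  | .inr (t, _, false) => .inl (src (.inr t))
  | .inr (t, k, true) => .inr (t, k)

/-- Second ends of the edges when every edge in `T` is replaced by `K` paths of length two. -/
def thickTgt (tgt : O ⊕ T → V) : O ⊕ T × K × Bool → V ⊕ T × K
  | .inl o => .inl (tgt (.inl o))
  | .inr (t, k, false) => .inr (t, k)
  | .inr (t, _, true) => .inl (tgt (.inr t))

namespace NiceDrawing

variable {src tgt : O ⊕ T → V} (N : NiceDrawing src tgt) (η : K → ℝ)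

/-- The abscissa of the midpoint of an edge. -/
def mid (e : O ⊕ T) : ℝ := ((N.pos (src e)).1 + (N.pos (tgt e)).1) / 2

/-- The abscissas of the vertices of a thickening. -/
def thickX : V ⊕ T × K → ℝ := Sum.elim (fun v => (N.pos v).1) fun p => N.mid (.inr p.1)

/-- The limit ordinates of the vertices of a thickening. -/
def thickY : V ⊕ T × K → ℝ :=
  Sum.elim (fun v => (N.pos v).2) fun p => (N.curve (.inr p.1)).toFun (N.mid (.inr p.1))

/-- The displacements of the vertices of a thickening. -/
def thickShift (η : K → ℝ) : V ⊕ T × K → ℝ := Sum.elim (fun _ => 0) fun p => η p.2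

/-- The abscissa of the fixed end of an edge of a thickening. -/
def anchor : O ⊕ T × K × Bool → ℝ
  | .inl _ => 0
  | .inr (t, _, false) => (N.pos (src (.inr t))).1
  | .inr (t, _, true) => (N.pos (tgt (.inr t))).1

/-- The rate at which an edge of a thickening turns. -/
def rate (η : K → ℝ) : O ⊕ T × K × Bool → ℝ
  | .inl _ => 0
  | .inr (t, k, false) => η k / (N.mid (.inr t) - (N.pos (src (.inr t))).1)
  | .inr (t, k, true) => η k / (N.mid (.inr t) - (N.pos (tgt (.inr t))).1)

/-- The interval of abscissas of an edge of a thickening. -/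
def thickDom (e : O ⊕ T × K × Bool) : Set ℝ :=
  openBetween (N.thickX (thickSrc src e)) (N.thickX (thickTgt tgt e))

theorem mid_mem_dom (e : O ⊕ T) : N.mid e ∈ N.dom e := midpoint_mem_openBetween (N.x_ne e)

theorem mid_sub_src_ne (e : O ⊕ T) : N.mid e - (N.pos (src e)).1 ≠ 0 := by
  have := sub_ne_zero.2 (N.x_ne e)
  rw [mid]
  intro h
  exact this (by linarith)

theorem mid_sub_tgt_ne (e : O ⊕ T) : N.mid e - (N.pos (tgt e)).1 ≠ 0 := by
  have := sub_ne_zero.2 (N.x_ne e)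
  rw [mid]
  intro h
  exact this (by linarith)

theorem thickDom_subset (e : O ⊕ T × K × Bool) : N.thickDom e ⊆ N.dom (thickBase e) := by
  rcases e with o | ⟨t, k, _ | _⟩
  · exact subset_rfl
  · exact openBetween_midpoint_left (N.x_ne _)
  · exact openBetween_midpoint_right (N.x_ne _)

/-- The edges in `T` are straight and not crossed. -/
structure Thickenable : Prop where
  line : ∀ t, ∃ s u, N.curve (.inr t) = .line s u
  uncrossed : ∀ t f, f ≠ .inr t → ∀ x ∈ N.dom (.inr t), x ∈ N.dom f →
    (N.curve f).toFun x ≠ (N.curve (.inr t)).toFun x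

/-- The curves of a thickening. -/
def thickCurve (η : K → ℝ) (ε : ℝ) (e : O ⊕ T × K × Bool) : Curve :=
  (N.curve (thickBase e)).tilt (ε * N.rate η e) (N.anchor e)

variable {N} {η}

theorem toFun_thickCurve (h : N.Thickenable) (ε : ℝ) (e : O ⊕ T × K × Bool) (x : ℝ) :
    (N.thickCurve η ε e).toFun x =
      (N.curve (thickBase e)).toFun x + ε * (N.rate η e * (x - N.anchor e)) := by
  rcases e with o | ⟨t, k, b⟩
  · simp [thickCurve, rate, Curve.tilt_zero]
  · rw [thickCurve, ← mul_assoc]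
    exact Curve.toFun_tilt_line (h.line t) _ _ _

theorem thickSrc_mem (e : O ⊕ T × K × Bool) :
    (N.curve (thickBase e)).toFun (N.thickX (thickSrc src e)) = N.thickY (thickSrc src e) ∧
    N.rate η e * (N.thickX (thickSrc src e) - N.anchor e) = thickShift η (thickSrc src e) := by
  rcases e with o | ⟨t, k, _ | _⟩
  · exact ⟨N.src_mem _, by simp [rate, thickShift, thickSrc]⟩
  · exact ⟨N.src_mem _, by simp [thickShift, thickSrc, thickX, anchor]⟩
  · exact ⟨rfl, div_mul_cancel₀ _ (N.mid_sub_tgt_ne _)⟩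

theorem thickTgt_mem (e : O ⊕ T × K × Bool) :
    (N.curve (thickBase e)).toFun (N.thickX (thickTgt tgt e)) = N.thickY (thickTgt tgt e) ∧
    N.rate η e * (N.thickX (thickTgt tgt e) - N.anchor e) = thickShift η (thickTgt tgt e) := by
  rcases e with o | ⟨t, k, _ | _⟩
  · exact ⟨N.tgt_mem _, by simp [rate, thickShift, thickTgt]⟩
  · exact ⟨rfl, div_mul_cancel₀ _ (N.mid_sub_src_ne _)⟩
  · exact ⟨N.tgt_mem _, by simp [thickShift, thickTgt, thickX, anchor]⟩

theorem thick_pos_ne (h : N.Thickenable) (hη : Function.Injective η) {v w : V ⊕ T × K}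
    (hvw : v ≠ w) (hx : N.thickX v = N.thickX w) (hy : N.thickY v = N.thickY w) :
    thickShift η v ≠ thickShift η w := by
  have key : ∀ (v : V) (t : T), (N.pos v).1 = N.mid (.inr t) →
      (N.pos v).2 ≠ (N.curve (.inr t)).toFun (N.mid (.inr t)) := fun v t h1 h2 =>
    N.avoid (.inr t) v (by rw [h1]; exact N.mid_mem_dom _) (by rw [h1, h2])
  rcases v with v | ⟨t, k⟩ <;> rcases w with w | ⟨t', k'⟩
  · exact absurd (congrArg Sum.inl (N.pos_injective (Prod.ext hx hy))) hvw
  · exact absurd hy (key _ _ hx)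
  · exact absurd hy.symm (key _ _ hx.symm)
  · rcases eq_or_ne t t' with rfl | ht
    · exact fun hk => hvw (by rw [show k = k' from hη hk])
    · simp only [thickX, thickY, Sum.elim_inr] at hx hy
      refine absurd hy ?_
      rw [hx]
      exact h.uncrossed t' (.inr t) (by simpa using ht) _ (N.mid_mem_dom _)
        (hx ▸ N.mid_mem_dom _)

theorem thick_rate_ne (hη : Function.Injective η) {t : T} {k k' : K} (hk : k ≠ k') (b : Bool) :
    N.rate η (.inr (t, k, b)) ≠ N.rate η (.inr (t, k', b)) := by
  intro h
  cases b
  · exact hk (hη ((div_left_inj' (N.mid_sub_src_ne _)).1 h))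
  · exact hk (hη ((div_left_inj' (N.mid_sub_tgt_ne _)).1 h))

theorem thick_curve_ne (hη : Function.Injective η) (hη0 : ∀ k, η k ≠ 0)
    {e f : O ⊕ T × K × Bool} (hef : e ≠ f) :
    ∃ x, (N.curve (thickBase e)).toFun x = (N.curve (thickBase f)).toFun x →
      N.rate η e * (x - N.anchor e) ≠ N.rate η f * (x - N.anchor f) := by
  by_cases hb : thickBase e = thickBase f
  · have key : ∀ t k k', N.rate η (.inr (t, k, false)) *
        ((N.pos (src (.inr t))).1 - N.anchor (.inr (t, k, false))) ≠
        N.rate η (.inr (t, k', true)) *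
          ((N.pos (src (.inr t))).1 - N.anchor (.inr (t, k', true))) := fun t k k' => by
      simp only [anchor, sub_self, mul_zero, rate]
      exact (mul_ne_zero (div_ne_zero (hη0 _) (N.mid_sub_tgt_ne _))
        (sub_ne_zero.2 (N.x_ne _))).symm
    rcases e with o | ⟨t, k, b⟩ <;> rcases f with o' | ⟨t', k', b'⟩
    · simp [thickBase] at hb; exact absurd (congrArg _ hb) hef
    · simp [thickBase] at hb
    · simp [thickBase] at hb
    · have ht : t = t' := by simpa [thickBase] using hb
      subst ht
      cases b <;> cases b'
      · refine ⟨N.anchor (.inr (t, k, false)) + 1, fun _ => ?_⟩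
        have := thick_rate_ne (N := N) hη (t := t) (k := k) (k' := k') (by grind) false
        simpa [anchor] using this
      · exact ⟨_, fun _ => key _ _ _⟩
      · exact ⟨_, fun _ => (key _ _ _).symm⟩
      · refine ⟨N.anchor (.inr (t, k, true)) + 1, fun _ => ?_⟩
        have := thick_rate_ne (N := N) hη (t := t) (k := k) (k' := k') (by grind) true
        simpa [anchor] using this
  · obtain ⟨x, hx⟩ := Curve.exists_toFun_ne (N.steep (thickBase e)) (N.steep (thickBase f))
      (N.curve_injective.ne hb)
    exact ⟨x, fun h => absurd h hx⟩

theorem thick_avoid (h : N.Thickenable) {e : O ⊕ T × K × Bool} {v : V ⊕ T × K}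
    (hv : N.thickX v ∈ N.thickDom e) :
    (N.curve (thickBase e)).toFun (N.thickX v) ≠ N.thickY v := by
  rcases v with v | ⟨t, k⟩
  · exact N.avoid _ v (N.thickDom_subset e hv)
  · by_cases hb : thickBase e = .inr t
    · rcases e with o | ⟨t', k', _ | _⟩
      · simp [thickBase] at hb
      · have ht : t' = t := by simpa [thickBase] using hb
        subst ht
        exact absurd hv (notMem_openBetween_right _ _)
      · have ht : t' = t := by simpa [thickBase] using hb
        subst ht
        exact absurd hv (notMem_openBetween_left _ _)
    · exact h.uncrossed t _ hb _ (N.mid_mem_dom _) (N.thickDom_subset e hv)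

theorem thick_closure {e : O ⊕ T × K × Bool} {x : ℝ}
    (hx : x ∈ uIcc (N.thickX (thickSrc src e)) (N.thickX (thickTgt tgt e))) :
    x ∈ N.dom (thickBase e) ∨ (∃ v, (N.pos v).1 = x ∧
      (N.pos v).2 = (N.curve (thickBase e)).toFun x) ∧ N.rate η e * (x - N.anchor e) = 0 := by
  rcases eq_or_eq_or_mem_openBetween hx with rfl | rfl | hx
  · rcases e with o | ⟨t, k, _ | _⟩
    · exact Or.inr ⟨⟨_, rfl, (N.src_mem _).symm⟩, zero_mul _⟩
    · exact Or.inr ⟨⟨_, rfl, (N.src_mem _).symm⟩, by simp [anchor, thickX, thickSrc]⟩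
    · exact Or.inl (N.mid_mem_dom _)
  · rcases e with o | ⟨t, k, _ | _⟩
    · exact Or.inr ⟨⟨_, rfl, (N.tgt_mem _).symm⟩, zero_mul _⟩
    · exact Or.inl (N.mid_mem_dom _)
    · exact Or.inr ⟨⟨_, rfl, (N.tgt_mem _).symm⟩, by simp [anchor, thickX, thickTgt]⟩
  · exact Or.inl (N.thickDom_subset e hx)

theorem thick_touch (h : N.Thickenable) {t : T} {k : K} {b : Bool} {f : O ⊕ T × K × Bool}
    (hf : thickBase f ≠ .inr t) {x : ℝ}
    (hx : x ∈ uIcc (N.thickX (thickSrc src (.inr (t, k, b))))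
      (N.thickX (thickTgt tgt (.inr (t, k, b)))))
    (hx' : x ∈ uIcc (N.thickX (thickSrc src f)) (N.thickX (thickTgt tgt f)))
    (heq : (N.curve (.inr t)).toFun x - (N.curve (thickBase f)).toFun x = 0) :
    N.rate η (.inr (t, k, b)) * (x - N.anchor (.inr (t, k, b))) -
      N.rate η f * (x - N.anchor f) = 0 := by
  have heq := sub_eq_zero.1 heq
  rcases thick_closure (η := η) hx with h1 | ⟨⟨v, hv, hv'⟩, h1⟩ <;>
    rcases thick_closure (η := η) hx' with h2 | ⟨⟨w, hw, hw'⟩, h2⟩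
  · exact absurd heq.symm (h.uncrossed t _ hf x h1 h2)
  · subst hw
    exact absurd (heq.trans hw'.symm) (N.avoid _ w h1)
  · subst hv
    exact absurd (heq.symm.trans hv'.symm) (N.avoid _ v h2)
  · rw [h1, h2, sub_zero]

theorem thick_eventually_nonneg (h : N.Thickenable) {t : T} {k : K} {b : Bool}
    {f : O ⊕ T × K × Bool} (hf : thickBase f ≠ .inr t) :
    ∃ l r, N.thickDom (.inr (t, k, b)) ∩ N.thickDom f ⊆ Ioo l r ∧
    ∀ᶠ ε in nhdsWithin (0 : ℝ) (Ioi 0),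
      ((N.thickDom (.inr (t, k, b)) ∩ N.thickDom f).Nonempty →
      0 ≤ ((N.thickCurve η ε (.inr (t, k, b))).toFun l - (N.thickCurve η ε f).toFun l) *
        ((N.thickCurve η ε (.inr (t, k, b))).toFun r - (N.thickCurve η ε f).toFun r)) := by
  have hI : ∀ e : O ⊕ T × K × Bool,
      N.thickDom e = Ioo (min (N.thickX (thickSrc src e)) (N.thickX (thickTgt tgt e)))
        (max (N.thickX (thickSrc src e)) (N.thickX (thickTgt tgt e))) := fun e => rfl
  set e : O ⊕ T × K × Bool := .inr (t, k, b) with he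
  have hbe : thickBase e = .inr t := rfl
  set l := max (min (N.thickX (thickSrc src e)) (N.thickX (thickTgt tgt e)))
    (min (N.thickX (thickSrc src f)) (N.thickX (thickTgt tgt f))) with hl
  set r := min (max (N.thickX (thickSrc src e)) (N.thickX (thickTgt tgt e)))
    (max (N.thickX (thickSrc src f)) (N.thickX (thickTgt tgt f))) with hr
  have hinter : N.thickDom e ∩ N.thickDom f = Ioo l r := by
    rw [hI, hI, Ioo_inter_Ioo]
  refine ⟨l, r, hinter.subset, ?_⟩
  rcases lt_or_ge l r with hlr | hlr
  swap
  · refine Filter.Eventually.of_forall fun ε hne => ?_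
    rw [hinter, Ioo_eq_empty (not_lt.2 hlr)] at hne
    exact absurd hne not_nonempty_empty
  have hmem : ∀ x ∈ Icc l r, x ∈ uIcc (N.thickX (thickSrc src e)) (N.thickX (thickTgt tgt e)) ∧
      x ∈ uIcc (N.thickX (thickSrc src f)) (N.thickX (thickTgt tgt f)) := fun x hx =>
    ⟨⟨(le_max_left _ _).trans hx.1, hx.2.trans (min_le_left _ _)⟩,
      ⟨(le_max_right _ _).trans hx.1, hx.2.trans (min_le_right _ _)⟩⟩
  have hcont : Continuous fun x =>
      (N.curve (.inr t)).toFun x - (N.curve (thickBase f)).toFun x :=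
    (Curve.continuous_toFun _).sub (Curve.continuous_toFun _)
  have hnz : ∀ x ∈ Ioo l r,
      (N.curve (.inr t)).toFun x - (N.curve (thickBase f)).toFun x ≠ 0 := fun x hx h0 => by
    rw [← hinter] at hx
    exact h.uncrossed t _ hf x (N.thickDom_subset e hx.1) (N.thickDom_subset f hx.2)
      (sub_eq_zero.1 h0).symm
  have hsign : 0 ≤ ((N.curve (.inr t)).toFun l - (N.curve (thickBase f)).toFun l) *
      ((N.curve (.inr t)).toFun r - (N.curve (thickBase f)).toFun r) := by
    by_contra! hneg
    rcases mul_neg_iff.1 hneg with ⟨h1, h2⟩ | ⟨h1, h2⟩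
    · obtain ⟨x, hx, hx0⟩ := intermediate_value_Ioo' hlr.le hcont.continuousOn ⟨h2, h1⟩
      exact hnz x hx hx0
    · obtain ⟨x, hx, hx0⟩ := intermediate_value_Ioo hlr.le hcont.continuousOn ⟨h1, h2⟩
      exact hnz x hx hx0
  have hml := hmem l ⟨le_rfl, hlr.le⟩
  have hmr := hmem r ⟨hlr.le, le_rfl⟩
  filter_upwards [eventually_mul_nonneg hsign (thick_touch (η := η) h hf hml.1 hml.2)
    (thick_touch (η := η) h hf hmr.1 hmr.2)] with ε hε _
  rw [toFun_thickCurve h, toFun_thickCurve h, toFun_thickCurve h, toFun_thickCurve h, hbe]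
  refine hε.trans_eq ?_
  ring

theorem thick_eventually_ne [Finite T] [Finite O] [Finite K] (h : N.Thickenable)
    (hη : Function.Injective η)
    (hcurve : ∀ᶠ ε in nhdsWithin (0 : ℝ) (Ioi 0), ∀ e f, e ≠ f →
      N.thickCurve η ε e ≠ N.thickCurve η ε f)
    (hsteep : ∀ᶠ ε in nhdsWithin (0 : ℝ) (Ioi 0), ∀ e, (N.thickCurve η ε e).Steep)
    {t : T} {k : K} {b : Bool} {f : O ⊕ T × K × Bool} (hf : .inr (t, k, b) ≠ f) :
    ∀ᶠ ε in nhdsWithin (0 : ℝ) (Ioi 0), ∀ x ∈ N.thickDom (.inr (t, k, b)), x ∈ N.thickDom f →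
      (N.thickCurve η ε (.inr (t, k, b))).toFun x ≠ (N.thickCurve η ε f).toFun x := by
  by_cases hb : thickBase f = .inr t
  · rcases f with o | ⟨t', k', b'⟩
    · simp [thickBase] at hb
    have ht : t' = t := by simpa [thickBase] using hb
    subst ht
    rcases eq_or_ne b b' with rfl | hbb
    · filter_upwards [self_mem_nhdsWithin] with ε hε x hx hx'
      have hk : k ≠ k' := by rintro rfl; exact hf rfl
      have hxa : x - N.anchor (.inr (t', k, b)) ≠ 0 := by
        rintro h0
        rw [sub_eq_zero] at h0
        subst h0
        cases b
        · exact notMem_openBetween_left _ _ hx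
        · exact notMem_openBetween_right _ _ hx
      have ha : N.anchor (.inr (t', k', b)) = N.anchor (.inr (t', k, b)) := by cases b <;> rfl
      rw [toFun_thickCurve h, toFun_thickCurve h, ha]
      intro h0
      exact thick_rate_ne hη hk b
        (mul_right_cancel₀ hxa (mul_left_cancel₀ (ne_of_gt hε) (add_left_cancel h0)))
    · refine Filter.Eventually.of_forall fun ε x hx hx' => ?_
      have hdis := Set.disjoint_left.1
        (disjoint_openBetween_midpoint (N.pos (src (.inr t'))).1 (N.pos (tgt (.inr t'))).1)
      cases b <;> cases b'
      · exact absurd rfl hbb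
      · exact absurd hx' (hdis hx)
      · exact absurd hx (hdis hx')
      · exact absurd rfl hbb
  · obtain ⟨l, r, hsub, hev⟩ := thick_eventually_nonneg (η := η) h (k := k) (b := b) hb
    filter_upwards [hev, hcurve, hsteep] with ε hε hc hs x hx hx'
    exact Curve.toFun_ne_of_mul_nonneg (hs _) (hs _) (hc _ _ hf) (hsub ⟨hx, hx'⟩)
      (hε ⟨x, hx, hx'⟩)

/-- Replacing uncrossed straight edges by many paths of length two adds no crossings. -/
theorem Thickenable.exists_thicken [Finite V] [Finite T] [Finite O] [Finite K]
    (h : N.Thickenable) (hη : Function.Injective η) (hη0 : ∀ k, η k ≠ 0) :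
    ∃ M : NiceDrawing (thickSrc (K := K) src) (thickTgt (K := K) tgt),
      M.crossPairs.ncard ≤ N.crossPairs.ncard := by
  have hpos : ∀ᶠ ε in nhdsWithin (0 : ℝ) (Ioi 0), ∀ v w : V ⊕ T × K, v ≠ w →
      N.thickX v = N.thickX w →
      N.thickY v + ε * thickShift η v ≠ N.thickY w + ε * thickShift η w := by
    simp only [Filter.eventually_all]
    exact fun v w hvw hx => eventually_add_mul_ne (thick_pos_ne h hη hvw hx)
  have hcurve : ∀ᶠ ε in nhdsWithin (0 : ℝ) (Ioi 0), ∀ e f : O ⊕ T × K × Bool, e ≠ f →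
      N.thickCurve η ε e ≠ N.thickCurve η ε f := by
    simp only [Filter.eventually_all]
    intro e f hef
    obtain ⟨x, hx⟩ := thick_curve_ne (N := N) hη hη0 hef
    filter_upwards [eventually_add_mul_ne hx] with ε hε heq
    exact hε (by rw [← toFun_thickCurve h, ← toFun_thickCurve h, heq])
  have hsteep : ∀ᶠ ε in nhdsWithin (0 : ℝ) (Ioi 0), ∀ e : O ⊕ T × K × Bool,
      (N.thickCurve η ε e).Steep :=
    Filter.eventually_all.2 fun e => Curve.eventually_steep_tilt (N.steep _) _ _
  have havoid : ∀ᶠ ε in nhdsWithin (0 : ℝ) (Ioi 0), ∀ (e : O ⊕ T × K × Bool) (v : V ⊕ T × K),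
      N.thickX v ∈ N.thickDom e →
      (N.thickCurve η ε e).toFun (N.thickX v) ≠ N.thickY v + ε * thickShift η v := by
    simp only [Filter.eventually_all]
    intro e v hv
    simp only [toFun_thickCurve h]
    exact eventually_add_mul_ne fun h0 => absurd h0 (thick_avoid h hv)
  have hcross : ∀ᶠ ε in nhdsWithin (0 : ℝ) (Ioi 0), ∀ t k b (f : O ⊕ T × K × Bool),
      .inr (t, k, b) ≠ f → ∀ x ∈ N.thickDom (.inr (t, k, b)), x ∈ N.thickDom f →
      (N.thickCurve η ε (.inr (t, k, b))).toFun x ≠ (N.thickCurve η ε f).toFun x := by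
    rw [Filter.eventually_all]; intro t
    rw [Filter.eventually_all]; intro k
    rw [Filter.eventually_all]; intro b
    rw [Filter.eventually_all]; intro f
    rw [Filter.eventually_all]; intro hf
    exact thick_eventually_ne h hη hcurve hsteep hf
  obtain ⟨ε, hpos, hcurve, hsteep, havoid, hcross⟩ :=
    (hpos.and (hcurve.and (hsteep.and (havoid.and hcross)))).exists
  let M : NiceDrawing (thickSrc (K := K) src) (thickTgt (K := K) tgt) := {
    pos := fun v => (N.thickX v, N.thickY v + ε * thickShift η v)
    pos_injective := fun v w hvw => by
      by_contra hne
      exact hpos v w hne (congrArg Prod.fst hvw) (congrArg Prod.snd hvw)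
    curve := N.thickCurve η ε
    steep := hsteep
    curve_injective := fun e f hef => by
      by_contra hne
      exact hcurve e f hne hef
    src_mem := fun e => by
      rw [toFun_thickCurve h, (thickSrc_mem (η := η) e).1, (thickSrc_mem e).2]
    tgt_mem := fun e => by
      rw [toFun_thickCurve h, (thickTgt_mem (η := η) e).1, (thickTgt_mem e).2]
    x_ne := by
      rintro (o | ⟨t, k, _ | _⟩)
      · exact N.x_ne _
      · exact (sub_ne_zero.1 (N.mid_sub_src_ne _)).symm
      · exact sub_ne_zero.1 (N.mid_sub_tgt_ne _)
    avoid := havoid }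
  refine ⟨M, ?_⟩
  have hsub : M.crossPairs ⊆ Sym2.map Sum.inl '' (Sym2.map Sum.inl ⁻¹' N.crossPairs) := by
    rintro z ⟨e, f, hef, rfl, x, hx, hx', heq⟩
    rcases e with o | ⟨t, k, b⟩
    · rcases f with o' | ⟨t, k, b⟩
      · refine ⟨s(o, o'), ⟨.inl o, .inl o', by simpa using hef, rfl, x, hx, hx', ?_⟩, rfl⟩
        have h1 := toFun_thickCurve (η := η) h ε (.inl o) x
        have h2 := toFun_thickCurve (η := η) h ε (.inl o') x
        simp only [rate, zero_mul, mul_zero, add_zero] at h1 h2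
        exact h1.symm.trans (heq.trans h2)
      · exact absurd heq.symm (hcross t k b _ hef.symm x hx' hx)
    · exact absurd heq (hcross t k b f hef x hx hx')
  calc _ ≤ _ := ncard_le_ncard hsub (toFinite _)
    _ ≤ _ := ncard_image_le (toFinite _)
    _ = _ := (ncard_image_of_injective _ (Sym2.map.injective Sum.inl_injective)).symm
    _ ≤ _ := ncard_le_ncard (image_preimage_subset _ _) (toFinite _)

end NiceDrawing

end Thicken

/-- An edge of the frame: its index, and its ends from left to right. -/
structure Seg where
  id : ℕ
  lx : ℤ
  ly : ℤ
  rx : ℤ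
  ry : ℤ

namespace Seg

/-- The curve carrying an edge of the frame; all but one are straight. -/
def curve (s : Seg) : Curve :=
  if s.id = 3 then .bump 134689 else .through (s.lx, s.ly) (s.rx, s.ry)

/-- The denominator of the ordinates of integral points. -/
def den (s : Seg) : ℤ := if s.id = 3 then 1 else s.rx - s.lx

/-- The numerator of the ordinate of an integral point. -/
def num (s : Seg) (x : ℤ) : ℤ :=
  if s.id = 3 then 134689 + max 0 (2277 - 33 * ((x + 272).natAbs : ℤ))
  else s.ly * (s.rx - s.lx) + (s.ry - s.ly) * (x - s.lx)

/-- The vertical order of two edges at an integral point. -/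
def gap (s r : Seg) (x : ℤ) : ℤ := s.num x * r.den - r.num x * s.den

/-- The ends of an edge are in order and on its curve, the curve is steep, and the interior of
the edge avoids the given points. -/
def valid (ps : List (ℤ × ℤ)) (s : Seg) : Bool :=
  decide (s.lx < s.rx) && (decide (s.id = 3) || decide (33 * (s.rx - s.lx) < (s.ry - s.ly).natAbs)) &&
    decide (s.num s.lx = s.ly * s.den) && decide (s.num s.rx = s.ry * s.den) &&
    ps.all fun p => decide (p.1 ≤ s.lx) || decide (s.rx ≤ p.1) || !decide (s.num p.1 = p.2 * s.den)

/-- Two edges have distinct curves, and cross only if the pair is listed. -/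
def compatible (cs : List ℕ) (s r : Seg) : Bool :=
  (!decide (s.gap r r.lx = 0) || !decide (s.gap r r.rx = 0)) &&
    (decide (min s.rx r.rx ≤ max s.lx r.lx) ||
      decide (0 ≤ s.gap r (max s.lx r.lx) * s.gap r (min s.rx r.rx)) ||
      cs.contains (100 * s.id + r.id))

/-- All pairs from a list are compatible. -/
def allCompatible (cs : List ℕ) : List Seg → Bool
  | [] => true
  | s :: l => l.all (compatible cs s) && allCompatible cs l

theorem pairwise_of_allCompatible {cs : List ℕ} :
    ∀ {l : List Seg}, allCompatible cs l = true → l.Pairwise fun s r => compatible cs s r = true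
  | [], _ => List.Pairwise.nil
  | s :: l, h => by
    rw [allCompatible, Bool.and_eq_true, List.all_eq_true] at h
    exact List.Pairwise.cons h.1 (pairwise_of_allCompatible h.2)

end Seg

/-- The vertices of the frame: the rim, the tripod centres and the hub. -/
def framePos : List (ℤ × ℤ) :=
  [(-900, 810000), (-867, 751689), (-482, 232324), (-448, 200704), (-433, 187489),
   (-423, 178929), (-421, 177241), (-418, 174724), (-398, 158404), (-394, 155236),
   (-371, 137641), (-367, 134689), (-170, 28900), (-168, 28224), (-162, 26244), (-146, 21316),
   (-94, 8836), (-92, 8464), (19, 361), (23, 529), (174, 30276), (238, 56644), (315, 99225),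
   (318, 101124), (320, 102400), (333, 110889), (367, 134689), (423, 178929), (586, 343396),
   (589, 346921), (594, 352836), (-135, 134862), (-216, 127444), (-288, 152641),
   (-122, 122585), (-252, 159819), (-274, 136600), (0, -10000000)]

/-- The edges of the frame: chords, legs, rim edges and spokes. -/
def frameSegs : List Seg :=
  [⟨0, -867, 751689, 23, 529⟩, ⟨1, -867, 751689, -94, 8836⟩, ⟨2, -867, 751689, -168, 28224⟩,
   ⟨3, -367, 134689, 367, 134689⟩, ⟨4, -367, 134689, 318, 101124⟩,
   ⟨5, -367, 134689, 589, 346921⟩, ⟨6, -448, 200704, 238, 56644⟩,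
   ⟨7, -394, 155236, 238, 56644⟩, ⟨8, -421, 177241, 238, 56644⟩, ⟨9, -135, 134862, 174, 30276⟩,
   ⟨10, -135, 134862, 423, 178929⟩, ⟨11, -433, 187489, -135, 134862⟩,
   ⟨12, -216, 127444, -92, 8464⟩, ⟨13, -216, 127444, 320, 102400⟩,
   ⟨14, -371, 137641, -216, 127444⟩, ⟨15, -288, 152641, -162, 26244⟩,
   ⟨16, -288, 152641, 594, 352836⟩, ⟨17, -418, 174724, -288, 152641⟩,
   ⟨18, -122, 122585, 19, 361⟩, ⟨19, -122, 122585, 315, 99225⟩,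
   ⟨20, -423, 178929, -122, 122585⟩, ⟨21, -252, 159819, -146, 21316⟩,
   ⟨22, -252, 159819, 586, 343396⟩, ⟨23, -482, 232324, -252, 159819⟩,
   ⟨24, -274, 136600, -170, 28900⟩, ⟨25, -274, 136600, 333, 110889⟩,
   ⟨26, -398, 158404, -274, 136600⟩, ⟨27, -900, 810000, -867, 751689⟩,
   ⟨28, -867, 751689, -482, 232324⟩, ⟨29, -482, 232324, -448, 200704⟩,
   ⟨30, -448, 200704, -433, 187489⟩, ⟨31, -433, 187489, -423, 178929⟩,
   ⟨32, -423, 178929, -421, 177241⟩, ⟨33, -421, 177241, -418, 174724⟩,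
   ⟨34, -418, 174724, -398, 158404⟩, ⟨35, -398, 158404, -394, 155236⟩,
   ⟨36, -394, 155236, -371, 137641⟩, ⟨37, -371, 137641, -367, 134689⟩,
   ⟨38, -367, 134689, -170, 28900⟩, ⟨39, -170, 28900, -168, 28224⟩,
   ⟨40, -168, 28224, -162, 26244⟩, ⟨41, -162, 26244, -146, 21316⟩,
   ⟨42, -146, 21316, -94, 8836⟩, ⟨43, -94, 8836, -92, 8464⟩, ⟨44, -92, 8464, 19, 361⟩,
   ⟨45, 19, 361, 23, 529⟩, ⟨46, 23, 529, 174, 30276⟩, ⟨47, 174, 30276, 238, 56644⟩,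
   ⟨48, 238, 56644, 315, 99225⟩, ⟨49, 315, 99225, 318, 101124⟩, ⟨50, 318, 101124, 320, 102400⟩,
   ⟨51, 320, 102400, 333, 110889⟩, ⟨52, 333, 110889, 367, 134689⟩,
   ⟨53, 367, 134689, 423, 178929⟩, ⟨54, 423, 178929, 586, 343396⟩,
   ⟨55, 586, 343396, 589, 346921⟩, ⟨56, 589, 346921, 594, 352836⟩,
   ⟨57, -900, 810000, 594, 352836⟩, ⟨58, -867, 751689, 0, -10000000⟩,
   ⟨59, -482, 232324, 0, -10000000⟩, ⟨60, -448, 200704, 0, -10000000⟩,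
   ⟨61, -433, 187489, 0, -10000000⟩, ⟨62, -423, 178929, 0, -10000000⟩,
   ⟨63, -421, 177241, 0, -10000000⟩, ⟨64, -418, 174724, 0, -10000000⟩,
   ⟨65, -398, 158404, 0, -10000000⟩, ⟨66, -394, 155236, 0, -10000000⟩,
   ⟨67, -371, 137641, 0, -10000000⟩, ⟨68, -367, 134689, 0, -10000000⟩,
   ⟨69, -170, 28900, 0, -10000000⟩, ⟨70, -168, 28224, 0, -10000000⟩,
   ⟨71, -162, 26244, 0, -10000000⟩, ⟨72, -146, 21316, 0, -10000000⟩,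
   ⟨73, -94, 8836, 0, -10000000⟩, ⟨74, -92, 8464, 0, -10000000⟩, ⟨75, 0, -10000000, 19, 361⟩,
   ⟨76, 0, -10000000, 23, 529⟩, ⟨77, 0, -10000000, 174, 30276⟩, ⟨78, 0, -10000000, 238, 56644⟩,
   ⟨79, 0, -10000000, 315, 99225⟩, ⟨80, 0, -10000000, 318, 101124⟩,
   ⟨81, 0, -10000000, 320, 102400⟩, ⟨82, 0, -10000000, 333, 110889⟩,
   ⟨83, 0, -10000000, 367, 134689⟩, ⟨84, 0, -10000000, 423, 178929⟩,
   ⟨85, 0, -10000000, 586, 343396⟩, ⟨86, 0, -10000000, 589, 346921⟩,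
   ⟨87, 0, -10000000, 594, 352836⟩]

/-- The pairs of edges of the frame that cross. -/
def frameCrossings : List ℕ :=
  [3, 4, 5, 6, 7, 8, 11, 13, 16, 19, 22, 25, 103, 104, 105, 106, 107, 108, 111, 114, 116, 120,
   122, 125, 203, 204, 205, 206, 207, 208, 211, 214, 217, 220, 223, 225, 306, 307, 308, 309,
   314, 315, 320, 321, 326, 406, 407, 408, 409, 412, 415, 420, 421, 424, 506, 507, 508, 511,
   514, 515, 520, 523, 526, 610, 613, 616, 619, 621, 625, 709, 713, 715, 718, 721, 724, 809,
   813, 816, 818, 821, 825, 913, 919, 925, 1116, 1121, 1320, 1415, 1421, 1424, 1525, 1620,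
   1623, 2021, 2025, 2125]

theorem frameSegs_valid : frameSegs.all (Seg.valid framePos) = true := by decide +kernel

theorem frameSegs_allCompatible : Seg.allCompatible frameCrossings frameSegs = true := by
  decide +kernel

theorem mem_frameCrossings_lt : ∀ c ∈ frameCrossings, c / 100 < 27 ∧ c % 100 < 27 := by decide

namespace Seg

variable {s r : Seg} {ps : List (ℤ × ℤ)} {cs : List ℕ}

theorem valid_iff : s.valid ps = true ↔ s.lx < s.rx ∧
    (s.id = 3 ∨ 33 * (s.rx - s.lx) < (s.ry - s.ly).natAbs) ∧ s.num s.lx = s.ly * s.den ∧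
    s.num s.rx = s.ry * s.den ∧
    ∀ p ∈ ps, s.lx < p.1 → p.1 < s.rx → s.num p.1 ≠ p.2 * s.den := by
  simp only [valid, Bool.and_eq_true, Bool.or_eq_true, decide_eq_true_eq, List.all_eq_true,
    Bool.not_eq_true', decide_eq_false_iff_not, and_assoc]
  refine and_congr_right fun _ => and_congr_right fun _ => and_congr_right fun _ =>
    and_congr_right fun _ => forall₂_congr fun p _ => ?_
  by_cases h1 : s.lx < p.1 <;> by_cases h2 : p.1 < s.rx <;>
    simp [h1, h2, not_le.2, not_lt.1]

theorem den_pos (h : s.lx < s.rx) : 0 < s.den := by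
  unfold den
  split_ifs <;> omega

theorem den_mul_toFun (h : s.lx < s.rx) (x : ℤ) : (s.den : ℝ) * s.curve.toFun x = s.num x := by
  unfold den num curve
  split_ifs
  · rw [Curve.toFun_bump, tentHom_one]
    push_cast [Nat.cast_natAbs]
    ring
  · have hne : ((s.lx : ℝ), (s.ly : ℝ)).1 ≠ ((s.rx : ℝ), (s.ry : ℝ)).1 := by
      have : (s.lx : ℝ) < s.rx := by exact_mod_cast h
      exact this.ne
    have := Curve.through_mul hne x
    push_cast
    linarith

theorem toFun_eq_iff (h : s.lx < s.rx) (x y : ℤ) :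
    s.curve.toFun x = y ↔ s.num x = y * s.den := by
  have hd : (s.den : ℝ) ≠ 0 := by exact_mod_cast (den_pos h).ne'
  rw [← mul_right_inj' hd, den_mul_toFun h, mul_comm (s.den : ℝ)]
  exact_mod_cast Iff.rfl

theorem steep_curve (h : s.valid ps = true) : s.curve.Steep := by
  obtain ⟨h1, h2, -⟩ := valid_iff.1 h
  unfold curve
  split_ifs with h3
  · trivial
  · have h4 := h2.resolve_left h3
    have hlt : (s.lx : ℝ) < s.rx := by exact_mod_cast h1
    refine Curve.steep_through hlt.ne ?_
    simp only
    rw [abs_of_pos (sub_pos.2 hlt)]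
    rw [← Int.abs_eq_natAbs] at h4
    exact_mod_cast h4

theorem curve_ne_of_compatible (h : s.lx < s.rx) (h' : r.lx < r.rx)
    (hc : compatible cs s r = true) : s.curve ≠ r.curve := by
  intro heq
  have key : ∀ x : ℤ, s.gap r x = 0 := fun x => by
    have h1 := den_mul_toFun h x
    have h2 := den_mul_toFun h' x
    have h3 : (s.gap r x : ℝ) = 0 := by
      rw [gap]
      push_cast
      rw [← h1, ← h2, heq]
      ring
    exact_mod_cast h3
  simp [compatible, key] at hc

theorem mem_of_compatible (h : s.valid ps = true) (h' : r.valid ps = true)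
    (hc : compatible cs s r = true) {x : ℝ} (hx : x ∈ openBetween s.lx s.rx)
    (hx' : x ∈ openBetween r.lx r.rx) (heq : s.curve.toFun x = r.curve.toFun x) :
    100 * s.id + r.id ∈ cs := by
  have hs := (valid_iff.1 h).1
  have hr := (valid_iff.1 h').1
  have hne := curve_ne_of_compatible hs hr hc
  by_contra hcs
  refine Curve.toFun_ne_of_int (steep_curve h) (steep_curve h') hne (den_pos hs) (den_pos hr)
    (den_mul_toFun hs) (den_mul_toFun hr) ?_ hx hx' heq
  rw [min_eq_left hs.le, max_eq_right hs.le, min_eq_left hr.le, max_eq_right hr.le]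
  simp only [compatible, Bool.and_eq_true, Bool.or_eq_true, decide_eq_true_eq,
    List.contains_iff_mem, hcs, or_false] at hc
  exact hc.2

end Seg

/-- Indices of the chords and legs. -/
abbrev FrameObject := Fin 3 × Fin 3 ⊕ Fin 6 × Fin 3

/-- Indices of the rim edges and spokes. -/
abbrev FrameRim := Fin 31 ⊕ Fin 30

/-- A vertex of the rim, among the vertices of the frame. -/
def rimVert (i : Fin 31) : Fin 38 := Fin.castLE (by decide) i

/-- A tripod centre, among the vertices of the frame. -/
def ctrVert (t : Fin 6) : Fin 38 := ⟨31 + t, by omega⟩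

/-- The hub, among the vertices of the frame. -/
def hubVert : Fin 38 := 37

/-- The first end of an edge of the frame. -/
def frameSrc : FrameObject ⊕ FrameRim → Fin 38
  | .inl (.inl (c, _)) => rimVert (rootIdx c)
  | .inl (.inr (t, _)) => ctrVert t
  | .inr (.inl i) => rimVert i
  | .inr (.inr _) => hubVert

/-- The second end of an edge of the frame. -/
def frameTgt : FrameObject ⊕ FrameRim → Fin 38
  | .inl (.inl (c, i)) => rimVert (chordIdx c i)
  | .inl (.inr (t, q)) => rimVert (legIdx t q)
  | .inr (.inl i) => rimVert (i + 1)
  | .inr (.inr i) => rimVert i.succ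

/-- The position of an edge of the frame in the list of its edges. -/
def frameIdx : FrameObject ⊕ FrameRim → Fin 88
  | .inl (.inl (c, i)) => ⟨3 * c + i, by omega⟩
  | .inl (.inr (t, q)) => ⟨9 + 3 * t + q, by omega⟩
  | .inr (.inl i) => ⟨27 + i, by omega⟩
  | .inr (.inr i) => ⟨58 + i, by omega⟩

theorem frameIdx_injective : Function.Injective frameIdx := by
  rintro ((⟨c, i⟩ | ⟨t, q⟩) | i | i) ((⟨c', i'⟩ | ⟨t', q'⟩) | i' | i') h <;>
    simp only [frameIdx, Sum.inl.injEq, Sum.inr.injEq, Prod.mk.injEq,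
      reduceCtorEq, Fin.ext_iff] at h ⊢ <;> omega

/-- The coordinates of a vertex of the frame. -/
def framePoint (v : Fin 38) : ℤ × ℤ := framePos.get v

/-- The segment of an edge of the frame. -/
def frameSeg (e : FrameObject ⊕ FrameRim) : Seg := frameSegs.get (frameIdx e)

theorem frameSeg_id (e : FrameObject ⊕ FrameRim) : (frameSeg e).id = frameIdx e := by
  have : ∀ i : Fin 88, (frameSegs.get i).id = i := by decide
  exact this _

theorem frameSeg_ends : ∀ e : FrameObject ⊕ FrameRim,
    ((frameSeg e).lx, (frameSeg e).ly) = framePoint (frameSrc e) ∧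
      ((frameSeg e).rx, (frameSeg e).ry) = framePoint (frameTgt e) ∨
    ((frameSeg e).rx, (frameSeg e).ry) = framePoint (frameSrc e) ∧
      ((frameSeg e).lx, (frameSeg e).ly) = framePoint (frameTgt e) := by
  decide +kernel

theorem framePoint_fst_injective : Function.Injective fun v => (framePoint v).1 := by
  decide +kernel

theorem frameSeg_valid (e : FrameObject ⊕ FrameRim) : (frameSeg e).valid framePos = true :=
  List.all_eq_true.1 frameSegs_valid _ (List.get_mem _ _)

theorem frameSeg_compatible {e f : FrameObject ⊕ FrameRim} (h : frameIdx e < frameIdx f) :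
    Seg.compatible frameCrossings (frameSeg e) (frameSeg f) = true :=
  List.pairwise_iff_get.1 (Seg.pairwise_of_allCompatible frameSegs_allCompatible) _ _ h

theorem frame_openBetween (e : FrameObject ⊕ FrameRim) :
    openBetween ((framePoint (frameSrc e)).1 : ℝ) ((framePoint (frameTgt e)).1 : ℝ) =
      openBetween ((frameSeg e).lx : ℝ) ((frameSeg e).rx : ℝ) := by
  rcases frameSeg_ends e with ⟨h1, h2⟩ | ⟨h1, h2⟩
  · rw [← h1, ← h2]
  · rw [← h1, ← h2, openBetween_comm]

theorem frameSeg_curve_injective : Function.Injective fun e => (frameSeg e).curve := by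
  intro e f h
  have hlt := fun e => (Seg.valid_iff.1 (frameSeg_valid e)).1
  by_contra hef
  rcases lt_or_gt_of_ne (frameIdx_injective.ne hef) with h1 | h1
  · exact Seg.curve_ne_of_compatible (hlt e) (hlt f) (frameSeg_compatible h1) h
  · exact Seg.curve_ne_of_compatible (hlt f) (hlt e) (frameSeg_compatible h1) h.symm

theorem frameSeg_toFun_ends (e : FrameObject ⊕ FrameRim) {v : Fin 38}
    (hv : v = frameSrc e ∨ v = frameTgt e) :
    (frameSeg e).curve.toFun (framePoint v).1 = (framePoint v).2 := by
  obtain ⟨h1, -, h2, h3, -⟩ := Seg.valid_iff.1 (frameSeg_valid e)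
  rw [Seg.toFun_eq_iff h1]
  rcases frameSeg_ends e with ⟨h4, h5⟩ | ⟨h4, h5⟩ <;> rcases hv with rfl | rfl
  · rwa [← h4]
  · rwa [← h5]
  · rwa [← h4]
  · rwa [← h5]

/-- The drawing of the frame. -/
def frameDrawing : NiceDrawing frameSrc frameTgt where
  pos v := ((framePoint v).1, (framePoint v).2)
  pos_injective v w h := framePoint_fst_injective (Int.cast_injective (congrArg Prod.fst h))
  curve e := (frameSeg e).curve
  steep e := Seg.steep_curve (frameSeg_valid e)
  curve_injective := frameSeg_curve_injective
  src_mem e := frameSeg_toFun_ends e (Or.inl rfl)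
  tgt_mem e := frameSeg_toFun_ends e (Or.inr rfl)
  x_ne e h := by
    have h1 := (Seg.valid_iff.1 (frameSeg_valid e)).1
    have h2 : (framePoint (frameSrc e)).1 = (framePoint (frameTgt e)).1 := Int.cast_injective h
    rcases frameSeg_ends e with ⟨h4, h5⟩ | ⟨h4, h5⟩ <;> rw [← h4, ← h5] at h2 <;>
      simp only at h2 <;> omega
  avoid e v hv := by
    obtain ⟨h1, -, -, -, h2⟩ := Seg.valid_iff.1 (frameSeg_valid e)
    rw [frame_openBetween, openBetween, min_eq_left (by exact_mod_cast h1.le),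
      max_eq_right (by exact_mod_cast h1.le)] at hv
    rw [ne_eq, Seg.toFun_eq_iff h1]
    exact h2 _ (List.get_mem _ _) (Int.cast_lt.1 hv.1) (Int.cast_lt.1 hv.2)

/-- The code of a pair of edges of the frame. -/
def frameCode : Sym2 (FrameObject ⊕ FrameRim) → ℕ :=
  Sym2.lift ⟨fun e f => 100 * min (frameIdx e : ℕ) (frameIdx f) + max (frameIdx e : ℕ) (frameIdx f),
    fun e f => by simp only [min_comm, max_comm]⟩

theorem frameCode_injective : Function.Injective frameCode := by
  intro z z' h
  induction z with | _ e f
  induction z' with | _ e' f'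
  have h1 : 100 * min (frameIdx e : ℕ) (frameIdx f) + max (frameIdx e : ℕ) (frameIdx f) =
    100 * min (frameIdx e' : ℕ) (frameIdx f') + max (frameIdx e' : ℕ) (frameIdx f') := h
  have h2 : (frameIdx e : ℕ) = frameIdx e' ∧ (frameIdx f : ℕ) = frameIdx f' ∨
      (frameIdx e : ℕ) = frameIdx f' ∧ (frameIdx f : ℕ) = frameIdx e' := by omega
  rw [Sym2.eq_iff]
  exact h2.imp (And.imp (fun h => frameIdx_injective (Fin.ext h))
    fun h => frameIdx_injective (Fin.ext h)) (And.imp (fun h => frameIdx_injective (Fin.ext h))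
    fun h => frameIdx_injective (Fin.ext h))

theorem frameCode_mem {z : Sym2 (FrameObject ⊕ FrameRim)} (hz : z ∈ frameDrawing.crossPairs) :
    frameCode z ∈ frameCrossings := by
  obtain ⟨e, f, hef, rfl, x, hx, hx', h⟩ := hz
  have hx0 : x ∈ openBetween ((frameSeg e).lx : ℝ) (frameSeg e).rx := frame_openBetween e ▸ hx
  have hx0' : x ∈ openBetween ((frameSeg f).lx : ℝ) (frameSeg f).rx := frame_openBetween f ▸ hx'
  change 100 * min (frameIdx e : ℕ) (frameIdx f) + max (frameIdx e : ℕ) (frameIdx f) ∈ _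
  rcases lt_or_gt_of_ne (frameIdx_injective.ne hef) with h1 | h1
  · have := Seg.mem_of_compatible (frameSeg_valid e) (frameSeg_valid f) (frameSeg_compatible h1)
      hx0 hx0' h
    rw [frameSeg_id, frameSeg_id] at this
    rwa [min_eq_left (Fin.le_def.1 h1.le), max_eq_right (Fin.le_def.1 h1.le)]
  · have := Seg.mem_of_compatible (frameSeg_valid f) (frameSeg_valid e) (frameSeg_compatible h1)
      hx0' hx0 h.symm
    rw [frameSeg_id, frameSeg_id] at this
    rwa [min_eq_right (Fin.le_def.1 h1.le), max_eq_left (Fin.le_def.1 h1.le)]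

theorem frameDrawing_ncard_le : frameDrawing.crossPairs.ncard ≤ 96 := by
  rw [← ncard_image_of_injective _ frameCode_injective]
  have hsub : frameCode '' frameDrawing.crossPairs ⊆ (frameCrossings.toFinset : Set ℕ) := by
    rintro _ ⟨z, hz, rfl⟩
    simpa using frameCode_mem hz
  refine (ncard_le_ncard hsub (Finset.finite_toSet _)).trans ?_
  rw [ncard_coe_finset]
  exact List.toFinset_card_le _

theorem frameDrawing_thickenable : frameDrawing.Thickenable where
  line t := by
    have h3 : (frameSeg (.inr t)).id ≠ 3 := by
      rw [frameSeg_id]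
      rcases t with i | i <;> simp only [frameIdx] <;> omega
    exact ⟨_, _, if_neg h3⟩
  uncrossed t f hf x hx hx' h := by
    have h1 := mem_frameCrossings_lt _
      (frameCode_mem ⟨f, .inr t, hf, rfl, x, hx', hx, h⟩)
    change (100 * min (frameIdx f : ℕ) (frameIdx (.inr t)) +
      max (frameIdx f : ℕ) (frameIdx (.inr t))) / 100 < 27 ∧ (100 * min (frameIdx f : ℕ)
      (frameIdx (.inr t)) + max (frameIdx f : ℕ) (frameIdx (.inr t))) % 100 < 27 at h1
    have h2 : 27 ≤ (frameIdx (.inr t) : ℕ) := by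
      rcases t with i | i <;> simp only [frameIdx] <;> omega
    have h3 := (frameIdx f).2
    omega

/-- The vertices of the gadget as vertices of the thickened frame. -/
def GVert.toFrame : GVert → Fin 38 ⊕ FrameRim × Fin 193
  | g i => .inl (rimVert i)
  | hub => .inl hubVert
  | ctr t => .inl (ctrVert t)
  | cmid i k => .inr (.inl i, k)
  | smid i k => .inr (.inr i, k)

/-- The edges of the gadget as edges of the thickened frame. -/
def GEdge.toFrame : GEdge → FrameObject ⊕ FrameRim × Fin 193 × Bool
  | chord c i => .inl (.inl (c, i))
  | leg t q => .inl (.inr (t, q))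
  | cyc i k b => .inr (.inl i, k, b)
  | spk i k b => .inr (.inr i, k, b)

theorem GVert.toFrame_injective : Function.Injective GVert.toFrame := by
  rintro (i | _ | t | ⟨i, k⟩ | ⟨i, k⟩) (i' | _ | t' | ⟨i', k'⟩ | ⟨i', k'⟩) h <;>
    simp [toFrame, rimVert, hubVert, ctrVert, Fin.ext_iff] at h ⊢ <;> omega

theorem GEdge.toFrame_injective : Function.Injective GEdge.toFrame := by
  rintro (⟨c, i⟩ | ⟨t, q⟩ | ⟨i, k, b⟩ | ⟨i, k, b⟩) (⟨c', i'⟩ | ⟨t', q'⟩ | ⟨i', k', b'⟩ | ⟨i', k', b'⟩)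
    h <;> simp_all [toFrame]

theorem exists_gadget_drawing :
    ∃ N : NiceDrawing GEdge.src GEdge.tgt, N.crossPairs.ncard ≤ 96 := by
  obtain ⟨M, hM⟩ := frameDrawing_thickenable.exists_thicken (K := Fin 193)
    (η := fun k => (k : ℝ) + 1) (fun k k' h => Fin.ext (by simpa using h))
    fun k => by positivity
  obtain ⟨N, hN⟩ := M.exists_reindex GVert.toFrame_injective GEdge.toFrame_injective
    (src := GEdge.src) (tgt := GEdge.tgt)
    (by rintro (⟨c, i⟩ | ⟨t, q⟩ | ⟨i, k, _ | _⟩ | ⟨i, k, _ | _⟩) <;> rfl)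
    (by rintro (⟨c, i⟩ | ⟨t, q⟩ | ⟨i, k, _ | _⟩ | ⟨i, k, _ | _⟩) <;> rfl)
  exact ⟨N, hN.trans (hM.trans frameDrawing_ncard_le)⟩

/-- Theorem. For each integer `m ≥ 1` there exists a finite simple graph `G` such
that `pcr G = 36 (1 + 4 m)` and `rcr G ≥ 36 (1 + 4 m) + m`.  (In particular, the
rectilinear crossing number of `G` strictly exceeds its pseudolinear crossing
number.) -/
theorem exists_graph_pcrNum_eq_and_rcrNum_ge (m : ℕ) (hm : 1 ≤ m) :
    ∃ (n : ℕ) (G : SimpleGraph (Fin n)),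
      pcrNum G = 36 * (1 + 4 * m) ∧ 36 * (1 + 4 * m) + m ≤ rcrNum G := by
  exact exists_graph_of_gadget exists_gadget_drawing m hm

end
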